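/- Let d ≥ 3 be an odd integer, and let V ⊂ S^{d-1} have exactly d+3 elements with vol(conv V) ≥ vol(conv W) for every W ⊂ S^{d-1} with exactly d+3 elements. Then there is a partition V = V₁ ∪ V₂ ∪ V₃ and positive integers k₁, k₂, k₃ with k₁+k₂+k₃ = d, each kᵢ ∈ {⌊d/3⌋, ⌈d/3⌉}, |Vᵢ| = kᵢ+1, such that ⟨u,v⟩ = −1/kᵢ for all distinct u,v ∈ Vᵢ and ⟨u,v⟩ = 0 for u ∈ Vᵢ, v ∈ Vⱼ with i ≠ j; moreover vol(conv V) = (1/d!) · ∏_{i=1}^{3} (kᵢ+1)^{(kᵢ+1)/2} · kᵢ^{−kᵢ/2}. -/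

import Mathlib

open MeasureTheory Real RealInnerProductSpace
open scoped Classical

/-- continuant matrix -/
noncomputable def Bm (a : ℝ) : Matrix (Fin 2) (Fin 2) ℝ := !![a, -1; 1, 0]
noncomputable def PB (l : List ℝ) : Matrix (Fin 2) (Fin 2) ℝ := (l.map Bm).prod
noncomputable def Kh (l : List ℝ) : ℝ := (-1) ^ (l.length / 2) * PB l 0 0
noncomputable def GG (l : List ℝ) : ℝ := (-1) ^ (l.length / 2) * (PB l).trace

lemma PB_append (l m : List ℝ) : PB (l ++ m) = PB l * PB m := by simp [PB]
lemma PB_nil : PB [] = 1 := by simp [PB]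
lemma PB_cons (a : ℝ) (m : List ℝ) : PB (a :: m) = Bm a * PB m := by simp [PB]
lemma PB_sing (a : ℝ) : PB [a] = Bm a := by simp [PB]

lemma PB_snoc00 (l : List ℝ) (a : ℝ) : PB (l ++ [a]) 0 0 = a * PB l 0 0 + PB l 0 1 := by
  rw [PB_append, PB_sing]; simp [Matrix.mul_apply, Fin.sum_univ_two, Bm]; ring
lemma PB_snoc01 (l : List ℝ) (a : ℝ) : PB (l ++ [a]) 0 1 = - PB l 0 0 := by
  rw [PB_append, PB_sing]; simp [Matrix.mul_apply, Fin.sum_univ_two, Bm]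

lemma Kh_even_snoc2 (l : List ℝ) (h : Even l.length) (c a : ℝ) :
    Kh (l ++ [c] ++ [a]) = Kh l - a * Kh (l ++ [c]) := by
  obtain ⟨p, hp⟩ := h
  have h1 : (l ++ [c] ++ [a]).length / 2 = p + 1 := by simp; omega
  have h2 : (l ++ [c]).length / 2 = p := by simp; omega
  have h3 : l.length / 2 = p := by omega
  unfold Kh
  rw [h1, h2, h3, PB_snoc00 (l ++ [c]), PB_snoc01]; ring

lemma Kh_odd_snoc2 (l : List ℝ) (h : Odd l.length) (c a : ℝ) :
    Kh (l ++ [c] ++ [a]) = Kh l + a * Kh (l ++ [c]) := by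
  obtain ⟨p, hp⟩ := h
  have h1 : (l ++ [c] ++ [a]).length / 2 = p + 1 := by simp; omega
  have h2 : (l ++ [c]).length / 2 = p + 1 := by simp; omega
  have h3 : l.length / 2 = p := by omega
  unfold Kh
  rw [h1, h2, h3, PB_snoc00 (l ++ [c]), PB_snoc01]; ring

def InvR (S u w : ℝ) : Prop :=
  0 < S ∧ 0 < w ∧ (S ≤ 1 → w ≤ S * u) ∧ (1 ≤ S → S ≤ 3 → (2 - S) * w ≤ u) ∧
    (3 ≤ S → - w ≤ (4 - S) * u)

lemma InvR_start (b : ℝ) (hb : 0 < b) (hb4 : b < 4) : InvR b 1 b := by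
  refine ⟨hb, hb, fun _ => by linarith, fun _ _ => by nlinarith [sq_nonneg (b-1)], fun _ => by linarith⟩

lemma InvR_ustep (S u w b : ℝ) (h : InvR S u w) (hb : 0 < b) (hb4 : S + b < 4) :
    InvR (S + b) (u - b * w) w := by
  obtain ⟨hS, hw, h1, h2, h3⟩ := h
  rcases le_total S 1 with hS1 | hS1
  · have h1 := h1 hS1
    have hu : 0 < u := by nlinarith
    have h2' : (2 - S) * w ≤ u := by
      nlinarith [mul_le_mul_of_nonneg_left h1 (by linarith : 0 ≤ 2 - S), sq_nonneg (S - 1), mul_nonneg hu.le (sq_nonneg (S-1))]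
    refine ⟨by linarith, hw, fun hh => ?_, fun _ _ => ?_, fun hh => ?_⟩
    · have e0 : 0 ≤ w * (b * (1 - S * (S + b))) := by
        refine mul_nonneg hw.le (mul_nonneg hb.le ?_); nlinarith
      have e1 := mul_le_mul_of_nonneg_left h1 (by linarith : 0 ≤ S + b)
      have : S * w ≤ S * ((S+b) * (u - b * w)) := by nlinarith
      exact le_of_mul_le_mul_left this hS
    · nlinarith
    · nlinarith [mul_le_mul_of_nonneg_left h2' (by linarith : 0 ≤ 4 - (S+b)), mul_nonneg hw.le (sq_nonneg (S+b-3))]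
  rcases le_total S 3 with hS3 | hS3
  · have h2' := h2 hS1 hS3
    refine ⟨by linarith, hw, fun hh => by linarith, fun _ _ => by nlinarith, fun hh => ?_⟩
    nlinarith [mul_le_mul_of_nonneg_left h2' (by linarith : 0 ≤ 4 - (S+b)), mul_nonneg hw.le (sq_nonneg (S+b-3))]
  · have h3' := h3 hS3
    refine ⟨by linarith, hw, fun hh => by linarith, fun _ _ => by linarith, fun hh => ?_⟩
    have e : (4 - (S+b)) * (- w) ≤ (4 - (S+b)) * ((4-S) * u) :=
      mul_le_mul_of_nonneg_left h3' (by linarith)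
    have e2 : (4 - S) * (-w) ≤ (4 - S) * ((4 - (S + b)) * (u - b * w)) := by
      have : 0 ≤ b * w * (1 - (4-S) * (4 - (S+b))) := by
        apply mul_nonneg (by positivity); nlinarith
      nlinarith
    exact le_of_mul_le_mul_left e2 (by linarith)

lemma InvR_wstep (S u w b : ℝ) (h : InvR S u w) (hb : 0 < b) (hb4 : S + b < 4) :
    InvR (S + b) u (w + b * u) := by
  obtain ⟨hS, hw, h1, h2, h3⟩ := h
  rcases le_or_gt 0 u with hu | hu
  · have hw' : 0 < w + b * u := by positivity
    refine ⟨by linarith, hw', fun hh => by nlinarith [h1 (by linarith)], fun hh hh' => ?_, fun hh => by nlinarith⟩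
    rcases le_total 2 (S + b) with h22 | h22
    · nlinarith
    rcases le_total S 1 with hS1 | hS1
    · have := h1 hS1
      nlinarith [mul_nonneg hu (sq_nonneg (S+b-1)), mul_le_mul_of_nonneg_left this (by linarith : 0 ≤ 2 - (S+b))]
    · have := h2 hS1 (by linarith)
      have e : (2 - (S+b)) * ((2 - S) * w) ≤ (2 - (S+b)) * u := mul_le_mul_of_nonneg_left this (by linarith)
      have e2 : (2 - S) * ((2 - (S + b)) * (w + b * u)) ≤ (2 - S) * u := by
        have : 0 ≤ u * ((2-S) - (2 - (S+b)) - (2-S) * (2-(S+b)) * b) := by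
          apply mul_nonneg hu
          have : (2-S) * (2-(S+b)) ≤ 1 := by nlinarith
          nlinarith
        nlinarith
      exact le_of_mul_le_mul_left e2 (by linarith)
  · have hS1 : 1 ≤ S := by
      by_contra hc; push Not at hc; nlinarith [h1 hc.le]
    rcases le_total S 3 with hS3 | hS3
    · have h2 := h2 hS1 hS3
      have hS2 : 2 < S := by
        by_contra hc; push Not at hc; nlinarith
      have hw' : 0 < w + b * u := by
        have : 0 ≤ w * (1 - (4 - S) * (S - 2)) := mul_nonneg hw.le (by nlinarith [sq_nonneg (S-3)])
        nlinarith [mul_le_mul_of_nonneg_left h2 hb.le, mul_pos hw (mul_pos (sub_pos.2 hb4) (sub_pos.2 hS2))]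
      refine ⟨by linarith, hw', fun hh => by linarith, fun hh hh' => ?_, fun hh => ?_⟩
      · have e : (2 - S) * w * (1 + b * (S + b - 2)) ≤ u * (1 + b * (S + b - 2)) :=
          mul_le_mul_of_nonneg_right h2 (by nlinarith)
        have : (S-2) * (S + b - 2) ≤ 1 := by nlinarith
        have : 0 ≤ w * b * (1 - (S-2) * (S + b - 2)) := by apply mul_nonneg (by positivity); linarith
        nlinarith
      · nlinarith [mul_nonneg hw.le (sq_nonneg (S-3))]
    · have h3 := h3 hS3
      have hw' : 0 < w + b * u := by
        nlinarith
      refine ⟨by linarith, hw', fun hh => by linarith, fun hh hh' => by linarith, fun hh => by nlinarith⟩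

lemma state_inv (l : List ℝ) : (∀ a ∈ l, 0 < a) → l.sum < 4 →
    (∀ p, l.length = 2 * p → 
      (l = [] ∨ InvR l.sum ((-1)^p * PB l 0 0) ((-1)^p * PB l 0 1))) ∧
    (∀ p, l.length = 2 * p + 1 → InvR l.sum (-((-1)^p * PB l 0 1)) ((-1)^p * PB l 0 0)) := by
  induction l using List.reverseRecOn with
  | nil => intro _ _; simp
  | append_singleton l a ih =>
    intro hpos hsum
    have ha : 0 < a := hpos a (by simp)
    have hpos' : ∀ b ∈ l, 0 < b := fun b hb => hpos b (by simp [hb])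
    have hsum' : l.sum + a < 4 := by simpa using hsum
    obtain ⟨ih1, ih2⟩ := ih hpos' (by linarith)
    refine ⟨fun p hp => ?_, fun p hp => ?_⟩
    · right
      obtain ⟨q, rfl⟩ : ∃ q, p = q + 1 := ⟨p - 1, by simp at hp; omega⟩
      have := ih2 q (by simp at hp; omega)
      have := InvR_ustep _ _ _ a this ha hsum'
      rw [PB_snoc00, PB_snoc01]
      simp only [List.sum_append, List.sum_singleton]
      convert this using 1 <;> ring
    · rcases ih1 p (by simpa using hp) with h | h
      · subst h
        have hp0 : p = 0 := by simpa using hp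
        subst hp0
        simp [PB_sing, Bm]
        exact InvR_start a ha (by simpa using hsum')
      · have := InvR_wstep _ _ _ a h ha hsum'
        rw [PB_snoc00, PB_snoc01]
        simp only [List.sum_append, List.sum_singleton]
        convert this using 1 <;> ring

lemma Kh_even_le (l : List ℝ) (hpos : ∀ a ∈ l, 0 < a) (he : Even l.length) (hK : Kh l ≤ 0) : 2 ≤ l.sum := by
  by_contra hc
  push Not at hc
  obtain ⟨p, hp⟩ := he
  have hp' : l.length = 2 * p := by omega
  rcases (state_inv l hpos (by linarith)).1 p hp' with h | h
  · subst h; simp [Kh, PB_nil] at hK; linarith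
  · have e : Kh l = (-1)^p * PB l 0 0 := by unfold Kh; rw [hp']; simp
    rw [← e] at h
    obtain ⟨hS, hw, h1, h2, h3⟩ := h
    rcases le_total l.sum 1 with hS1 | hS1
    · nlinarith [h1 hS1]
    · nlinarith [h2 hS1 (by linarith)]

lemma Kh_odd_pos (l : List ℝ) (hpos : ∀ a ∈ l, 0 < a) (he : Odd l.length) (hs : l.sum < 4) : 0 < Kh l := by
  obtain ⟨p, hp⟩ := he
  have h := (state_inv l hpos (by linarith)).2 p hp
  have e : Kh l = (-1)^p * PB l 0 0 := by 
    unfold Kh; rw [hp]; congr 2; omega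
  rw [← e] at h
  exact h.2.1

lemma GG_comm (l m : List ℝ) : GG (l ++ m) = GG (m ++ l) := by
  unfold GG; rw [PB_append, PB_append, Matrix.trace_mul_comm]; simp [add_comm]

lemma GG_rot {l m : List ℝ} (h : l ~r m) : GG l = GG m := by
  obtain ⟨n, rfl⟩ := h
  rw [List.rotate_eq_drop_append_take_mod, GG_comm, List.take_append_drop]

lemma GG_contract (l m : List ℝ) (a b : ℝ) : GG (l ++ [a, 0, b] ++ m) = GG (l ++ [a + b] ++ m) := by
  unfold GG
  have h : PB [a, 0, b] = - PB [a + b] := by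
    simp only [PB_cons, PB_nil, mul_one, Bm]
    ext i j; fin_cases i <;> fin_cases j <;> simp [Matrix.mul_apply, Fin.sum_univ_two] <;> ring
  have h1 : (l ++ [a, 0, b] ++ m).length / 2 = (l ++ [a + b] ++ m).length / 2 + 1 := by
    simp; omega
  rw [h1, PB_append, PB_append, h, PB_append, PB_append, pow_succ]; simp

lemma GG_formula (x p q r : ℝ) (l1 : List ℝ) (h : Odd l1.length) :
    GG (x :: l1 ++ [p] ++ [q] ++ [r]) = Kh (x :: l1 ++ [p]) * (1 - q * r) + Kh (l1 ++ [p] ++ [q])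
      + r * Kh (x :: l1) := by
  obtain ⟨k, hk⟩ := h
  have h1 : (x :: l1 ++ [p] ++ [q] ++ [r]).length / 2 = k + 2 := by simp; omega
  have h2 : (x :: l1 ++ [p]).length / 2 = k + 1 := by simp; omega
  have h3 : (l1 ++ [p] ++ [q]).length / 2 = k + 1 := by simp; omega
  have h4 : (x :: l1).length / 2 = k + 1 := by simp; omega
  unfold GG Kh
  rw [h1, h2, h3, h4, Matrix.trace_fin_two, PB_snoc00, PB_snoc01, PB_snoc00 (x :: l1 ++ [p]), PB_snoc01]
  have : PB (x :: l1 ++ [p] ++ [q] ++ [r]) 1 1 = - PB (l1 ++ [p] ++ [q]) 0 0 := by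
    rw [PB_append]
    have : x :: l1 ++ [p] ++ [q] = x :: (l1 ++ [p] ++ [q]) := by simp
    rw [this, PB_cons, PB_sing]
    generalize PB (l1 ++ [p] ++ [q]) = A
    simp only [Matrix.mul_apply, Fin.sum_univ_two, Bm]
    simp
  rw [this]; ring

lemma GG_concave (e o : List ℝ) (i j : ℝ) (he : Even e.length) (ho : Odd o.length) :
    (i + j) * GG (e ++ [j] ++ o ++ [i]) = j * GG (e ++ [i + j] ++ o ++ [0]) + 
      i * GG (e ++ [0] ++ o ++ [i + j]) - (i + j) * (Kh e * Kh o * i * j) := by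
  obtain ⟨p, hp⟩ := he
  obtain ⟨q, hq⟩ := ho
  have h1 : ∀ a b : ℝ, (e ++ [a] ++ o ++ [b]).length / 2 = p + q + 1 := by intro a b; simp; omega
  have h2 : e.length / 2 = p := by omega
  have h3 : o.length / 2 = q := by omega
  unfold GG Kh
  rw [h1, h1, h1, h2, h3]
  simp only [PB_append, PB_sing, Matrix.trace_fin_two, Matrix.mul_apply, Fin.sum_univ_two, Bm]
  simp
  ring

noncomputable def scl (s : ℝ) (ms : List ℕ) : List ℝ := ms.map (fun m : ℕ => s * (m : ℝ))

lemma scl_append (s : ℝ) (a b : List ℕ) : scl s (a ++ b) = scl s a ++ scl s b := by simp [scl]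
lemma scl_cons (s : ℝ) (a : ℕ) (b : List ℕ) : scl s (a :: b) = (s * a) :: scl s b := by simp [scl]
lemma scl_nil (s : ℝ) : scl s [] = [] := by simp [scl]
lemma scl_length (s : ℝ) (a : List ℕ) : (scl s a).length = a.length := by simp [scl]
lemma scl_sum (s : ℝ) (a : List ℕ) : (scl s a).sum = s * (a.sum : ℕ) := by
  induction a with
  | nil => simp [scl]
  | cons x a ih => rw [scl_cons]; simp [ih]; ring
lemma scl_pos (s : ℝ) (hs : 0 < s) (a : List ℕ) (h : ∀ m ∈ a, 0 < m) : ∀ x ∈ scl s a, 0 < x := by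
  intro x hx
  simp only [scl, List.mem_map] at hx
  obtain ⟨m, hm, rfl⟩ := hx
  have := h m hm
  positivity
lemma scl_rot (s : ℝ) {a b : List ℕ} (h : a ~r b) : scl s a ~r scl s b := h.map _

lemma snoc_of_ne {α : Type*} (l : List α) (h : l ≠ []) : ∃ l' a, l = l' ++ [a] :=
  ⟨l.dropLast, l.getLast h, (List.dropLast_append_getLast h).symm⟩

lemma odd_run_pos (s : ℝ) (hs : 0 < s) (ms : List ℕ) (hpos : ∀ m ∈ ms, 0 < m) (hodd : Odd ms.length)
    (hE : ∀ e j o i, ms ~r e ++ [j] ++ o ++ [i] → Even e.length → Odd o.length → 0 < Kh (scl s e)) :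
    ∀ k, ∀ o rest, o.length = 2 * k + 1 → 2 ≤ rest.length → ms ~r o ++ rest → 0 < Kh (scl s o) := by
  intro k
  induction k with
  | zero => 
    intro o rest ho hr hrot
    obtain ⟨a, rfl⟩ := List.length_eq_one_iff.1 ho
    have : 0 < a := hpos a (hrot.perm.mem_iff.2 (by simp))
    simp [scl, Kh, PB_sing, Bm]; positivity
  | succ k ih =>
    intro o rest ho hr hrot
    obtain ⟨o1, a, rfl⟩ := snoc_of_ne o (by rintro rfl; simp at ho)
    obtain ⟨l, c, rfl⟩ := snoc_of_ne o1 (by rintro rfl; simp at ho)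
    have hl : l.length = 2 * k + 1 := by simp at ho; omega
    have ha : 0 < a := hpos a (hrot.perm.mem_iff.2 (by simp))
    obtain ⟨r1, i, rfl⟩ := snoc_of_ne rest (by rintro rfl; simp at hr)
    have hlen := hrot.perm.length_eq
    have h1 : 0 < Kh (scl s (l ++ [c])) := by
      refine hE (l ++ [c]) a r1 i (by simpa using hrot) (by simp [hl, parity_simps]) ?_
      rw [hlen] at hodd
      simp [hl, parity_simps] at hodd ⊢
      simpa [parity_simps] using hodd
    have h2 : 0 < Kh (scl s l) := ih l ([c] ++ [a] ++ (r1 ++ [i])) hl (by simp) (by simpa using hrot)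
    rw [scl_append, scl_append]
    have e1 : scl s [c] = [s * c] := by simp [scl]
    have e2 : scl s [a] = [s * a] := by simp [scl]
    rw [e1, e2, Kh_odd_snoc2 _ (by rw [scl_length]; exact ⟨k, hl⟩)]
    rw [scl_append, e1] at h1
    positivity

theorem GG_pos (s : ℝ) (hs : 0 < s) (n : ℕ) (hT : s * n < 6)
    (base : ∀ ms : List ℕ, ms.length = 5 → (∀ m ∈ ms, 0 < m) → ms.sum = n → 0 < GG (scl s ms)) :
    ∀ k, ∀ ms : List ℕ, ms.length = 2 * k + 5 → (∀ m ∈ ms, 0 < m) → ms.sum = n → 0 < GG (scl s ms) := by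
  intro k
  induction k with
  | zero => intro ms h; exact base ms (by omega)
  | succ k ih =>
    intro ms hlen hpos hsum
    by_cases hE : ∀ e j o i, ms ~r e ++ [j] ++ o ++ [i] → Even e.length → Odd o.length → 0 < Kh (scl s e)
    · have hO := odd_run_pos s hs ms hpos ⟨k + 3, by omega⟩ hE
      obtain ⟨l', r, rfl⟩ := snoc_of_ne ms (by rintro rfl; simp at hlen)
      obtain ⟨l', q, rfl⟩ := snoc_of_ne l' (by rintro rfl; simp at hlen)
      obtain ⟨l', p, rfl⟩ := snoc_of_ne l' (by rintro rfl; simp at hlen)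
      obtain ⟨x, l1, rfl⟩ := List.exists_cons_of_ne_nil (l := l') (by rintro rfl; simp at hlen)
      have hl1 : l1.length = 2 * k + 3 := by simp at hlen; omega
      have a1 : 0 < Kh (scl s (x :: l1 ++ [p])) := hO (k + 2) _ ([q] ++ [r]) (by simp; omega) (by simp) 
        (by simp [List.IsRotated.refl])
      have a2 : 0 < Kh (scl s (l1 ++ [p] ++ [q])) := hO (k + 2) _ ([r] ++ [x]) (by simp; omega) (by simp)
        ⟨1, by simp [List.rotate_cons_succ]⟩
      have a3 : 0 < Kh (scl s (x :: l1)) := hE _ p [q] r (List.IsRotated.refl _) 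
        ⟨k + 2, by simp; omega⟩ (by simp)
      have a4 : 0 < Kh (scl s ([q] ++ [r])) := hE _ x l1 p (by
          have := @List.isRotated_append _ (x :: l1 ++ [p]) ([q] ++ [r])
          simpa using this) ⟨1, by simp⟩ ⟨k + 1, by omega⟩
      have hr : 0 < r := hpos r (by simp)
      simp only [scl_append, scl_cons, scl_nil] at a1 a2 a3 a4 ⊢
      rw [GG_formula _ _ _ _ _ (by rw [scl_length]; exact ⟨k + 1, by omega⟩)]
      have e4 := Kh_even_snoc2 [] (by simp) (s * q) (s * r)
      have e5 : Kh [s * (q:ℝ)] = s * q := by simp [Kh, PB_sing, Bm]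
      have e6 : Kh [] = 1 := by simp [Kh, PB_nil]
      rw [List.nil_append, e5, e6] at e4
      rw [e4] at a4
      have : 0 < 1 - s * q * (s * r) := by linarith
      have hr' : (0:ℝ) < r := by exact_mod_cast hr
      positivity
    · push Not at hE
      obtain ⟨e, j, o, i, hrot, he, ho, hK⟩ := hE
      have hpos' : ∀ m ∈ e ++ [j] ++ o ++ [i], 0 < m := fun m hm => hpos m (hrot.perm.mem_iff.2 hm)
      have hsum' : (e ++ [j] ++ o ++ [i]).sum = n := by rw [← hsum]; exact hrot.perm.sum_eq.symm
      have hlen' : (e ++ [j] ++ o ++ [i]).length = 2 * (k + 1) + 5 := by rw [← hlen]; exact hrot.perm.length_eq.symm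
      have hpe : ∀ m ∈ e, 0 < m := fun m hm => hpos' m (by simp [hm])
      have hpo : ∀ m ∈ o, 0 < m := fun m hm => hpos' m (by simp [hm])
      have hi : 0 < i := hpos' i (by simp)
      have hj : 0 < j := hpos' j (by simp)
      rw [GG_rot (scl_rot s hrot)]
      have se : 2 ≤ (scl s e).sum := Kh_even_le _ (scl_pos s hs e hpe) (by rwa [scl_length]) hK
      have so : (scl s o).sum < 4 := by
        rw [scl_sum] at se ⊢
        have : ((e.sum + j + o.sum + i : ℕ) : ℝ) = n := by rw [← hsum']; simp [add_assoc]
        rw [Nat.cast_add, Nat.cast_add, Nat.cast_add] at this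
        have hj' : (0:ℝ) < j := by exact_mod_cast hj
        have hi' : (0:ℝ) < i := by exact_mod_cast hi
        rw [← this] at hT
        have := mul_pos hs hi'
        have := mul_pos hs hj'
        nlinarith
      have hKo : 0 < Kh (scl s o) := Kh_odd_pos _ (scl_pos s hs o hpo) (by rwa [scl_length]) so
      have hconc := GG_concave (scl s e) (scl s o) (s * i) (s * j) (by rwa [scl_length]) (by rwa [scl_length])
      have hene : e ≠ [] := by
        rintro rfl; simp [scl, Kh, PB_nil] at hK; linarith
      have hone : o ≠ [] := by rintro rfl; simp at ho
      have g1 : 0 < GG (scl s e ++ [s * i + s * j] ++ scl s o ++ [0]) := by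
        obtain ⟨x, e', rfl⟩ := List.exists_cons_of_ne_nil hene
        obtain ⟨o', y, rfl⟩ := snoc_of_ne o hone
        have := ih ((y + x) :: e' ++ [i + j] ++ o') (by simp at hlen' ⊢; omega) (by
          intro m hm
          simp only [List.mem_append, List.mem_cons, List.not_mem_nil, or_false] at hm
          rcases hm with ((h | h) | h) | h
          · have := hpe x (by simp); omega
          · exact hpe m (by simp [h])
          · omega
          · exact hpo m (by simp [h])) (by simp at hsum' ⊢; omega)
        have e1 : scl s ((y + x) :: e' ++ [i + j] ++ o') = [] ++ [s * y + s * x] ++ (scl s e' ++ [s * i + s * j] ++ scl s o') := by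
          simp [scl_append, scl_cons, scl_nil]; constructor <;> ring
        rw [e1, ← GG_contract] at this
        have e2 : GG (scl s (x :: e') ++ [s * i + s * j] ++ scl s (o' ++ [y]) ++ [0]) = 
            GG ([] ++ [s * y, 0, s * x] ++ (scl s e' ++ [s * i + s * j] ++ scl s o')) := by
          have := GG_comm (scl s (x :: e') ++ [s * i + s * j] ++ scl s o') [s * y, 0]
          simp only [scl_append, scl_cons, scl_nil] at this ⊢
          simpa using this
        rw [e2]; exact this
      have g2 : 0 < GG (scl s e ++ [0] ++ scl s o ++ [s * i + s * j]) := by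
        obtain ⟨e', x, rfl⟩ := snoc_of_ne e hene
        obtain ⟨y, o', rfl⟩ := List.exists_cons_of_ne_nil hone
        have := ih (e' ++ [x + y] ++ (o' ++ [i + j])) (by simp at hlen' ⊢; omega) (by
          intro m hm
          simp only [List.mem_append, List.mem_cons, List.not_mem_nil, or_false] at hm
          rcases hm with (h | h) | (h | h)
          · exact hpe m (by simp [h])
          · have := hpe x (by simp); omega
          · exact hpo m (by simp [h])
          · omega) (by simp at hsum' ⊢; omega)
        have e1 : scl s (e' ++ [x + y] ++ (o' ++ [i + j])) = scl s e' ++ [s * x + s * y] ++ (scl s o' ++ [s * i + s * j]) := by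
          simp [scl_append, scl_cons, scl_nil]; constructor <;> ring
        rw [e1, ← GG_contract] at this
        simp only [scl_append, scl_cons, scl_nil] at this ⊢
        simpa using this
      have hj' : (0:ℝ) < j := by exact_mod_cast hj
      have hi' : (0:ℝ) < i := by exact_mod_cast hi
      have hsi := mul_pos hs hi'
      have hsj := mul_pos hs hj'
      have hd : 0 ≤ -(Kh (scl s e) * Kh (scl s o) * (s * i) * (s * j)) := by
        have : 0 ≤ -(Kh (scl s e)) := by linarith
        have := mul_nonneg (mul_nonneg (mul_nonneg this hKo.le) hsi.le) hsj.le
        linarith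
      have : 0 < (s * i + s * j) * GG (scl s e ++ [s * j] ++ scl s o ++ [s * i]) := by
        rw [hconc]
        have := mul_pos hsj g1
        have := mul_pos hsi g2
        have := mul_nonneg (add_pos hsi hsj).le hd
        linarith
      have := pos_of_mul_pos_right this (by positivity)
      simpa [scl_append, scl_cons, scl_nil] using this

lemma GG5 (x y z p q : ℝ) : GG [x, y, z, p, q] = (x + y + z + p + q) - (x + p) * y * (z + q) 
    + p * q * (x * y * z + y - x - z) := by
  simp only [GG, PB_cons, PB_nil, mul_one, Bm, Matrix.trace_fin_two, Matrix.mul_apply, Fin.sum_univ_two]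
  simp
  ring

lemma D_bounds (x y z : ℝ) (hx : 0 < x) (hz : 0 < z) (hxy : x ≤ y) (hzy : z ≤ y) (hy : 1 < y) :
    (y - 1 ≤ x * y * z + y - x - z) ∨ (x * (y - 1) ≤ x * y * z + y - x - z) ∨ 
      (z * (y - 1) ≤ x * y * z + y - x - z) := by
  rcases le_total 1 z with h | h
  · right; left; nlinarith [mul_pos hx (by linarith : 0 < y), mul_nonneg (mul_pos hx (by linarith : 0 < y)).le (sub_nonneg.2 h)]
  rcases le_total 1 x with h' | h'
  · right; right; nlinarith [mul_nonneg (mul_pos hz (by linarith : 0 < y)).le (sub_nonneg.2 h')]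
  left
  nlinarith [mul_nonneg (sub_nonneg.2 h) (sub_nonneg.2 h'), mul_pos hx hz, mul_pos (mul_pos hx hz) (sub_pos.2 hy)]

lemma D_pos (x y z : ℝ) (hx : 0 < x) (hz : 0 < z) (hxy : x ≤ y) (hzy : z ≤ y) (hy : 1 < y) :
    0 < x * y * z + y - x - z := by
  have h1 := mul_pos hx (sub_pos.2 hy)
  have h2 := mul_pos hz (sub_pos.2 hy)
  rcases D_bounds x y z hx hz hxy hzy hy with h | h | h <;> linarith

/-- the `P`-condition on `n` and `s` -/
def GoodNS (n : ℕ) (s : ℝ) : Prop := ∃ t : ℕ,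
  (n = 3 * t ∧ 0 < t ∧ s ^ 2 * (t:ℝ) ^ 3 ≤ 3 * t) ∨ 
  (n = 3 * t + 1 ∧ 3 ≤ t ∧ s ^ 2 * ((t:ℝ) ^ 2 * (t + 1)) * ((3 * t - 2) * t * (t + 1) - 2) ≤ 
    (3 * t + 1) * ((3 * t - 2) * t * (t + 1))) ∨
  (n = 3 * t + 2 ∧ (t = 2 ∨ 4 ≤ t) ∧ s ^ 2 * ((t:ℝ) * (t + 1) ^ 2) * ((3 * t - 1) * t * (t + 1) - 2) ≤ 
    (3 * t + 2) * ((3 * t - 1) * t * (t + 1)))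

lemma amgm3 (a b c t : ℝ) (ha : 0 ≤ a) (hb : 0 ≤ b) (hc : 0 ≤ c) (h : a + b + c = 3 * t) : a * b * c ≤ t ^ 3 := by
  have ht : t = (a + b + c) / 3 := by linarith
  subst ht
  nlinarith [mul_nonneg ha (sq_nonneg (b - c)), mul_nonneg hb (sq_nonneg (a - c)), mul_nonneg hc (sq_nonneg (a - b)), mul_nonneg (add_nonneg (add_nonneg ha hb) hc) (sq_nonneg (a-b)), mul_nonneg (add_nonneg (add_nonneg ha hb) hc) (sq_nonneg (b-c)), mul_nonneg (add_nonneg (add_nonneg ha hb) hc) (sq_nonneg (a-c))]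

lemma unb1 (a b c t : ℝ) (ha : 0 ≤ a) (ht : 1 ≤ t) (h : a + b + c = 3 * t + 1)
    (hat : a ≤ t - 1) : a * b * c ≤ (t - 1) * (t + 1) ^ 2 := by
  have h1 : 4 * (b * c) ≤ (3 * t + 1 - a) ^ 2 := by
    have : 3 * t + 1 - a = b + c := by linarith
    rw [this]; nlinarith [sq_nonneg (b - c)]
  have h2 : a * (3 * t + 1 - a) ^ 2 ≤ (t - 1) * (2 * t + 2) ^ 2 := by
    obtain ⟨u, hu⟩ : ∃ u, u = t - 1 - a := ⟨_, rfl⟩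
    have hu0 : 0 ≤ u := by linarith
    have : a = t - 1 - u := by linarith
    subst this
    have : (0:ℝ) ≤ u * ((2*t+2+u)^2 - (t-1) * (4*t+4+u)) := by
      apply mul_nonneg hu0; nlinarith
    nlinarith
  nlinarith [mul_le_mul_of_nonneg_left h1 ha]

lemma unb2 (a b c t : ℝ) (ha : a ≤ 3 * t + 2) (ht : 1 ≤ t) (h : a + b + c = 3 * t + 2)
    (hat : t + 2 ≤ a) : a * b * c ≤ (t + 2) * t ^ 2 := by
  have h1 : 4 * (b * c) ≤ (3 * t + 2 - a) ^ 2 := by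
    have : 3 * t + 2 - a = b + c := by linarith
    rw [this]; nlinarith [sq_nonneg (b - c)]
  have h2 : a * (3 * t + 2 - a) ^ 2 ≤ (t + 2) * (2 * t) ^ 2 := by
    obtain ⟨u, hu⟩ : ∃ u, u = a - (t + 2) := ⟨_, rfl⟩
    have hu0 : 0 ≤ u := by linarith
    have : a = t + 2 + u := by linarith
    subst this
    have hu2 : u ≤ 2 * t := by linarith
    have : (0:ℝ) ≤ u * ((t+2) * (4 * t - u) - (2*t-u)^2) := by
      apply mul_nonneg hu0; nlinarith
    nlinarith
  nlinarith [mul_le_mul_of_nonneg_left h1 (by linarith : 0 ≤ a)]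

/-- balanced estimate -/
lemma bal_est (x y z p q s t n R E : ℝ) (hs : 0 < s) (ht : 3 ≤ t) (hx : s ≤ x) (hz : s ≤ z) (hp : s ≤ p) (hq : s ≤ q)
    (hxy : x ≤ y) (hzy : z ≤ y) (hxp : (t - 1) * s ^ 2 ≤ x * p) (hzq : (t - 1) * s ^ 2 ≤ z * q) (hy : t * s ≤ y) 
    (hsum : x + y + z + p + q = n * s) (hprod : (x + p) * y * (z + q) = s ^ 3 * R) (hR : s ^ 2 * R ≤ n + E)
    (h1 : 1 < t * s) (hE1 : E < s * (t * s - 1)) (hE2 : E < s ^ 2 * (t - 1) * (t * s - 1)) :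
    0 < GG [x, y, z, p, q] := by
  rw [GG5, hsum, hprod]
  have hp0 : 0 < p := by linarith
  have hq0 : 0 < q := by linarith
  have hx0 : 0 < x := by linarith
  have hz0 : 0 < z := by linarith
  have hpq0 : 0 ≤ p * q := by positivity
  have ht1 : 0 ≤ (t - 1) * s ^ 2 := mul_nonneg (by linarith) (by positivity)
  have hpq : s ^ 2 ≤ p * q := by nlinarith
  have key : s * E < p * q * (x * y * z + y - x - z) := by
    rcases D_bounds x y z (by linarith) (by linarith) hxy hzy (by linarith) with h | h | h
    · have a1 : s ^ 2 * (t * s - 1) ≤ p * q * (y - 1) := by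
        apply mul_le_mul hpq (by linarith) (by linarith) (by positivity)
      have a2 := mul_le_mul_of_nonneg_left h hpq0
      nlinarith
    · have a1 : (t-1) * s ^ 2 * s * (t * s - 1) ≤ x * p * q * (y - 1) := by
        apply mul_le_mul _ (by linarith) (by linarith) (by positivity)
        exact mul_le_mul hxp hq hs.le (by positivity)
      have a2 := mul_le_mul_of_nonneg_left h hpq0
      nlinarith
    · have a1 : (t-1) * s ^ 2 * s * (t * s - 1) ≤ z * q * p * (y - 1) := by
        apply mul_le_mul _ (by linarith) (by linarith) (by positivity)
        exact mul_le_mul hzq hp hs.le (by positivity)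
      have a2 := mul_le_mul_of_nonneg_left h hpq0
      nlinarith
  have := mul_le_mul_of_nonneg_left hR hs.le
  nlinarith

lemma G5_small (x y z p q : ℝ) (hx : 0 < x) (hz : 0 < z) (hp : 0 < p) (hq : 0 < q) (hy0 : 0 < y)
    (hxy : x ≤ y) (hzy : z ≤ y) (hpy : p ≤ y) (hqy : q ≤ y) (hy : y ≤ 1) : 0 < GG [x, y, z, p, q] := by
  have e : GG [x, y, z, p, q] = x * (1 - y * z) + y * (1 - z * p) + z * (1 - p * q) + p * (1 - q * x) + 
      q * (1 - x * y) + x * y * z * p * q := by rw [GG5]; ring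
  rw [e]
  have aux : ∀ a b : ℝ, 0 < a → 0 < b → a ≤ 1 → b ≤ 1 → 0 ≤ 1 - a * b := by intro a b h1 h2 h3 h4; nlinarith
  have := aux y z hy0 hz hy (by linarith)
  have := aux z p hz hp (by linarith) (by linarith)
  have := aux p q hp hq (by linarith) (by linarith)
  have := aux q x hq hx (by linarith) (by linarith)
  have := aux x y hx hy0 (by linarith) (by linarith)
  positivity

lemma G5_prod (x y z p q : ℝ) (hx : 0 < x) (hz : 0 < z) (hp : 0 < p) (hq : 0 < q) (hy0 : 0 < y)
    (hxy : x ≤ y) (hzy : z ≤ y) (hpy : p ≤ y) (hqy : q ≤ y) 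
    (h : (x + p) * y * (z + q) ≤ x + y + z + p + q) : 0 < GG [x, y, z, p, q] := by
  rcases le_or_gt y 1 with hy | hy
  · exact G5_small x y z p q hx hz hp hq hy0 hxy hzy hpy hqy hy
  · rw [GG5]
    have := mul_pos (mul_pos hp hq) (D_pos x y z hx hz hxy hzy hy)
    linarith

lemma nat_pq (a b : ℕ) (t : ℕ) (ha : 0 < a) (hb : 0 < b) (h : t ≤ a + b) : (t:ℝ) - 1 ≤ a * b := by
  have : t ≤ a * b + 1 := by nlinarith
  have : (t:ℝ) ≤ a * b + 1 := by exact_mod_cast this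
  linarith

lemma case8 (s : ℝ) (hs : 0 < s) (h : s ^ 2 * 18 * 28 ≤ 240) (mx my mz mp mq : ℕ) (hx : 0 < mx) (hz : 0 < mz)
    (hp : 0 < mp) (hq : 0 < mq) (hxy : mx ≤ my) (hzy : mz ≤ my) (hpy : mp ≤ my) (hqy : mq ≤ my)
    (hsum : mx + my + mz + mp + mq = 8) (hmy : my ≤ 3) :
    0 < GG [s * mx, s * my, s * mz, s * mp, s * mq] := by
  rw [GG5]
  have h1 : mx ≤ 3 := by omega
  have h2 : mz ≤ 3 := by omega
  have h3 : mp ≤ 3 := by omega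
  obtain rfl : mq = 8 - mx - my - mz - mp := by omega
  have hs2 : s^2 ≤ 10/21 := by linarith
  set r := s ^ 2 with hr
  have hr0 : 0 < r := by positivity
  have key : ∀ A B C : ℝ, 0 < A - B * r + C * r ^ 2 → 0 < s * (A - B * r + C * r ^ 2) := fun A B C h => mul_pos hs h
  have hmy2 : 2 ≤ my := by omega
  interval_cases my <;> interval_cases mx <;> (try omega) <;> interval_cases mz <;> (try omega) <;> interval_cases mp <;> (try omega) <;> norm_num
  all_goals first 
    | (have := key 8 18 8 (by nlinarith); rw [hr] at this; linarith)
    | (have := key 8 20 8 (by nlinarith); rw [hr] at this; linarith)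
    | (have := key 8 18 6 (by nlinarith); rw [hr] at this; nlinarith [pow_pos hs 3, pow_pos hs 5])

set_option maxHeartbeats 2000000 in
lemma base5_max (n : ℕ) (s : ℝ) (hs : 0 < s) (hg : GoodNS n s) (mx my mz mp mq : ℕ) (hx : 0 < mx) (hz : 0 < mz)
    (hp : 0 < mp) (hq : 0 < mq) (hxy : mx ≤ my) (hzy : mz ≤ my) (hpy : mp ≤ my) (hqy : mq ≤ my)
    (hsum : mx + my + mz + mp + mq = n) : 0 < GG [s * mx, s * my, s * mz, s * mp, s * mq] := by
  have cx : (0:ℝ) < mx := by exact_mod_cast hx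
  have cz : (0:ℝ) < mz := by exact_mod_cast hz
  have cp : (0:ℝ) < mp := by exact_mod_cast hp
  have cq : (0:ℝ) < mq := by exact_mod_cast hq
  have cxy : (mx:ℝ) ≤ my := by exact_mod_cast hxy
  have czy : (mz:ℝ) ≤ my := by exact_mod_cast hzy
  have cpy : (mp:ℝ) ≤ my := by exact_mod_cast hpy
  have cqy : (mq:ℝ) ≤ my := by exact_mod_cast hqy
  have cy : (0:ℝ) < my := by linarith
  have csum : (mx:ℝ) + my + mz + mp + mq = n := by exact_mod_cast hsum
  have hs2 : 0 < s ^ 2 := by positivity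
  have simple : s ^ 2 * (((mx:ℝ) + mp) * my * (mz + mq)) ≤ n → 
      0 < GG [s * (mx:ℝ), s * my, s * mz, s * mp, s * mq] := by
    intro h
    apply G5_prod <;> try positivity
    any_goals (apply mul_le_mul_of_nonneg_left _ hs.le; assumption)
    rw [← csum] at h
    have := mul_le_mul_of_nonneg_left h hs.le
    nlinarith
  obtain ⟨t, ⟨hn, ht, h⟩ | ⟨hn, ht, h⟩ | ⟨hn, ht, h⟩⟩ := hg
  · apply simple
    have := amgm3 ((mx:ℝ) + mp) my (mz + mq) t (by linarith) (by linarith) (by linarith) (by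
      rw [hn] at csum; push_cast at csum; linarith)
    rw [hn]; push_cast
    nlinarith
  · have htr : (3:ℝ) ≤ t := by exact_mod_cast ht
    have hcs : (mx:ℝ) + my + mz + mp + mq = 3 * t + 1 := by rw [csum, hn]; push_cast; ring
    set W : ℝ := (3 * t - 2) * t * (t + 1) with hW
    have hW1 : 20 * t ≤ W := by rw [hW]; nlinarith only [htr, mul_nonneg (sub_nonneg.2 htr) (sub_nonneg.2 htr)]
    by_cases hu : mx + mp ≤ t - 1 ∨ my ≤ t - 1 ∨ mz + mq ≤ t - 1
    · apply simple
      have hb : ((mx:ℝ) + mp) * my * (mz + mq) ≤ (t - 1) * (t + 1) ^ 2 := by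
        have hcast : ((t - 1 : ℕ) : ℝ) = t - 1 := by rw [Nat.cast_sub (by omega)]; simp
        rcases hu with hu | hu | hu
        · exact unb1 _ _ _ t (by linarith) (by linarith) (by linarith) (by rw [← hcast]; exact_mod_cast hu)
        · have := unb1 (my:ℝ) (mx + mp) (mz + mq) t (by linarith) (by linarith) (by linarith) (by rw [← hcast]; exact_mod_cast hu)
          linarith
        · have := unb1 ((mz:ℝ) + mq) (mx + mp) my t (by linarith) (by linarith) (by linarith) (by rw [← hcast]; exact_mod_cast hu)
          linarith
      have hb2 := mul_le_mul_of_nonneg_left hb hs2.le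
      refine hb2.trans ?_
      rw [hn]; push_cast
      have hW2 : 0 < W - 2 := by linarith
      have hW3 : 2 * t ^ 2 ≤ W := by rw [hW]; nlinarith only [htr, mul_nonneg (sub_nonneg.2 htr) (sub_nonneg.2 htr), mul_nonneg (mul_nonneg (sub_nonneg.2 htr) (sub_nonneg.2 htr)) (sub_nonneg.2 htr)]
      -- s2 t2(t+1)(W-2) ≤ (3t+1) W
      have e1 : t ^ 2 * (s ^ 2 * ((t - 1) * (t + 1) ^ 2)) = (t ^ 2 - 1) * (s ^ 2 * ((t:ℝ) ^ 2 * (t + 1))) := by ring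
      have e2 : (t ^ 2 - 1) * (s ^ 2 * ((t:ℝ) ^ 2 * (t + 1))) * (W - 2) ≤ (t ^ 2 - 1) * ((3 * t + 1) * W) := by
        have := mul_le_mul_of_nonneg_left h (by nlinarith only [htr] : (0:ℝ) ≤ t ^ 2 - 1)
        linarith
      have e3 : ((t:ℝ) ^ 2 - 1) * ((3 * t + 1) * W) ≤ t ^ 2 * (3 * t + 1) * (W - 2) := by linarith [mul_nonneg (by linarith : (0:ℝ) ≤ 3 * t + 1) (sub_nonneg.2 hW3)]
      have e4 : (t ^ 2 * (W - 2)) * (s ^ 2 * ((t - 1) * (t + 1) ^ 2)) ≤ (t ^ 2 * (W - 2)) * (3 * (t:ℝ) + 1) := by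
        calc _ = (W - 2) * (t ^ 2 * (s ^ 2 * ((t - 1) * (t + 1) ^ 2))) := by ring
          _ = _ := by rw [e1]
          _ ≤ _ := by linarith
      exact le_of_mul_le_mul_left e4 (by positivity)
    · push Not at hu
      obtain ⟨u1, u2, u3⟩ := hu
      by_cases hsm : s ^ 2 * (((mx:ℝ) + mp) * my * (mz + mq)) ≤ n
      · exact simple hsm
      push Not at hsm
      have hprod : ((mx:ℝ) + mp) * my * (mz + mq) = t ^ 2 * (t + 1) := by
        have : (mx + mp = t ∧ my = t ∧ mz + mq = t + 1) ∨ (mx + mp = t ∧ my = t + 1 ∧ mz + mq = t) ∨ 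
          (mx + mp = t + 1 ∧ my = t ∧ mz + mq = t) := by omega
        have : (mx + mp) * my * (mz + mq) = t ^ 2 * (t + 1) := by
          rcases this with ⟨h1, h2, h3⟩ | ⟨h1, h2, h3⟩ | ⟨h1, h2, h3⟩ <;> rw [h1, h2, h3] <;> ring
        exact_mod_cast this
      rw [hprod, hn] at hsm
      push_cast at hsm
      have hss : 5/2 ≤ (t * s) ^ 2 := by
        have : 5/2 * ((t:ℝ)+1) ≤ (t * s) ^ 2 * (t + 1) := by linarith
        exact le_of_mul_le_mul_right this (by linarith)
      have hts : 1.58 ≤ t * s := by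
        by_contra hc; push Not at hc; nlinarith only [mul_pos (by linarith : (0:ℝ) < t) hs, hc, hss]
      have hW2 : 0 < W - 2 := by linarith
      set E : ℝ := 2 * (3 * t + 1) / (W - 2) with hE
      have hEm : E * (W - 2) = 2 * (3 * t + 1) := by rw [hE]; field_simp
      have hWb : 2 * (3 * t + 1) * t < 0.9 * (W - 2) := by
        rw [hW]; nlinarith only [htr, mul_nonneg (sub_nonneg.2 htr) (sub_nonneg.2 htr), mul_nonneg (mul_nonneg (sub_nonneg.2 htr) (sub_nonneg.2 htr)) (sub_nonneg.2 htr)]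
      have hEt : E * t < 0.9 := by
        have : (E * t) * (W - 2) < 0.9 * (W - 2) := by
          calc _ = E * (W - 2) * t := by ring
            _ < _ := by rw [hEm]; exact hWb
        exact lt_of_mul_lt_mul_right this hW2.le
      have hE0 : 0 < E := by rw [hE]; positivity
      refine bal_est _ _ _ _ _ s t n (t ^ 2 * (t + 1)) E hs htr ?_ ?_ ?_ ?_ ?_ ?_ ?_ ?_ ?_ ?_ ?_ ?_ (by linarith) ?_ ?_
      · exact le_mul_of_one_le_right hs.le (by exact_mod_cast hx)
      · exact le_mul_of_one_le_right hs.le (by exact_mod_cast hz)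
      · exact le_mul_of_one_le_right hs.le (by exact_mod_cast hp)
      · exact le_mul_of_one_le_right hs.le (by exact_mod_cast hq)
      · exact mul_le_mul_of_nonneg_left cxy hs.le
      · exact mul_le_mul_of_nonneg_left czy hs.le
      · have := nat_pq mx mp t hx hp (by omega)
        linarith [mul_le_mul_of_nonneg_left this hs2.le]
      · have := nat_pq mz mq t hz hq (by omega)
        linarith [mul_le_mul_of_nonneg_left this hs2.le]
      · have : (t:ℝ) ≤ my := by exact_mod_cast (by omega : t ≤ my)
        rw [mul_comm]; exact mul_le_mul_of_nonneg_left this hs.le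
      · rw [← csum]; ring
      · rw [← hprod]; ring
      · rw [hn]; push_cast
        have : (s ^ 2 * (t ^ 2 * (t + 1))) * (W - 2) ≤ (3 * (t:ℝ) + 1 + E) * (W - 2) := by linarith
        exact le_of_mul_le_mul_right this hW2
      · have : E * t < (s * (t * s - 1)) * t := by
          have a1 : 1.58 * 0.58 ≤ (t * s) * (t * s - 1) := mul_le_mul hts (by linarith) (by norm_num) (by linarith)
          linarith
        exact lt_of_mul_lt_mul_right this (by linarith)
      · have a1 : 2.49 * (2/3 * 0.58) ≤ (t * s)^2 * ((t - 1)/t * (t * s - 1)) := by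
          apply mul_le_mul (by linarith) _ (by norm_num) (by positivity)
          apply mul_le_mul _ (by linarith) (by norm_num) _
          · rw [le_div_iff₀ (by linarith)]; linarith
          · apply div_nonneg <;> linarith
        have : E * t < (s ^ 2 * (t - 1) * (t * s - 1)) * t := by
          have : (t * s)^2 * ((t - 1)/t * (t * s - 1)) = (s ^ 2 * (t - 1) * (t * s - 1)) * t := by
            field_simp
          linarith
        exact lt_of_mul_lt_mul_right this (by linarith)
  · have ht2 : 2 ≤ t := by omega
    have htr : (2:ℝ) ≤ t := by exact_mod_cast ht2
    have hcs : (mx:ℝ) + my + mz + mp + mq = 3 * t + 2 := by rw [csum, hn]; push_cast; ring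
    set W : ℝ := (3 * t - 1) * t * (t + 1) with hW
    have hW1 : 15 * t ≤ W := by rw [hW]; nlinarith only [htr, mul_nonneg (sub_nonneg.2 htr) (sub_nonneg.2 htr)]
    have hW2 : 0 < W - 2 := by linarith
    by_cases hu : t + 2 ≤ mx + mp ∨ t + 2 ≤ my ∨ t + 2 ≤ mz + mq
    · apply simple
      have hb : ((mx:ℝ) + mp) * my * (mz + mq) ≤ (t + 2) * t ^ 2 := by
        rcases hu with hu | hu | hu
        · exact unb2 _ _ _ t (by linarith) (by linarith) (by linarith) (by exact_mod_cast hu)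
        · have := unb2 (my:ℝ) (mx + mp) (mz + mq) t (by linarith) (by linarith) (by linarith) (by exact_mod_cast hu)
          linarith
        · have := unb2 ((mz:ℝ) + mq) (mx + mp) my t (by linarith) (by linarith) (by linarith) (by exact_mod_cast hu)
          linarith
      have hb2 := mul_le_mul_of_nonneg_left hb hs2.le
      refine hb2.trans ?_
      rw [hn]; push_cast
      have hW3 : 2 * (t + 1) ^ 2 ≤ W := by rw [hW]; nlinarith only [htr, mul_nonneg (sub_nonneg.2 htr) (sub_nonneg.2 htr), mul_nonneg (mul_nonneg (sub_nonneg.2 htr) (sub_nonneg.2 htr)) (sub_nonneg.2 htr)]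
      have e1 : (t + 1) ^ 2 * (s ^ 2 * ((t + 2) * t ^ 2)) = ((t + 1) ^ 2 - 1) * (s ^ 2 * ((t:ℝ) * (t + 1) ^ 2)) := by ring
      have e2 : ((t + 1) ^ 2 - 1) * (s ^ 2 * ((t:ℝ) * (t + 1) ^ 2)) * (W - 2) ≤ ((t + 1) ^ 2 - 1) * ((3 * t + 2) * W) := by
        have := mul_le_mul_of_nonneg_left h (by nlinarith only [htr] : (0:ℝ) ≤ (t + 1) ^ 2 - 1)
        linarith
      have e3 : (((t:ℝ) + 1) ^ 2 - 1) * ((3 * t + 2) * W) ≤ (t + 1) ^ 2 * (3 * t + 2) * (W - 2) := by linarith [mul_nonneg (by linarith : (0:ℝ) ≤ 3 * t + 2) (sub_nonneg.2 hW3)]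
      have e4 : ((t + 1) ^ 2 * (W - 2)) * (s ^ 2 * ((t + 2) * t ^ 2)) ≤ ((t + 1) ^ 2 * (W - 2)) * (3 * (t:ℝ) + 2) := by
        calc _ = (W - 2) * ((t + 1) ^ 2 * (s ^ 2 * ((t + 2) * t ^ 2))) := by ring
          _ = _ := by rw [e1]
          _ ≤ _ := by linarith
      exact le_of_mul_le_mul_left e4 (by positivity)
    · push Not at hu
      obtain ⟨u1, u2, u3⟩ := hu
      rcases ht with rfl | ht4
      · have : s ^ 2 * 18 * 28 ≤ 240 := by 
          rw [hW] at h; norm_num at h; linarith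
        exact case8 s hs this mx my mz mp mq hx hz hp hq hxy hzy hpy hqy (by omega) (by omega)
      have ht4r : (4:ℝ) ≤ t := by exact_mod_cast ht4
      by_cases hsm : s ^ 2 * (((mx:ℝ) + mp) * my * (mz + mq)) ≤ n
      · exact simple hsm
      push Not at hsm
      have hprod : ((mx:ℝ) + mp) * my * (mz + mq) = t * (t + 1) ^ 2 := by
        have : (mx + mp = t ∧ my = t + 1 ∧ mz + mq = t + 1) ∨ (mx + mp = t + 1 ∧ my = t + 1 ∧ mz + mq = t) ∨ 
          (mx + mp = t + 1 ∧ my = t ∧ mz + mq = t + 1) := by omega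
        have : (mx + mp) * my * (mz + mq) = t * (t + 1) ^ 2 := by
          rcases this with ⟨h1, h2, h3⟩ | ⟨h1, h2, h3⟩ | ⟨h1, h2, h3⟩ <;> rw [h1, h2, h3] <;> ring
        exact_mod_cast this
      rw [hprod, hn] at hsm
      push_cast at hsm
      have hss : 56/25 ≤ (t * s) ^ 2 := by
        have : 56/25 * ((t:ℝ)+1) ^ 2 ≤ (t * s) ^ 2 * (t + 1) ^ 2 := by
          have := mul_le_mul_of_nonneg_left hsm.le (by linarith : (0:ℝ) ≤ t)
          nlinarith only [this, ht4r]
        exact le_of_mul_le_mul_right this (by positivity)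
      have hts : 1.49 ≤ t * s := by
        by_contra hc; push Not at hc; nlinarith only [mul_pos (by linarith : (0:ℝ) < t) hs, hc, hss]
      set E : ℝ := 2 * (3 * t + 2) / (W - 2) with hE
      have hEm : E * (W - 2) = 2 * (3 * t + 2) := by rw [hE]; field_simp
      have hWb : 2 * (3 * t + 2) * t < 0.7 * (W - 2) := by
        rw [hW]; nlinarith only [ht4r, mul_nonneg (sub_nonneg.2 ht4r) (sub_nonneg.2 ht4r), mul_nonneg (mul_nonneg (sub_nonneg.2 ht4r) (sub_nonneg.2 ht4r)) (sub_nonneg.2 ht4r)]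
      have hEt : E * t < 0.7 := by
        have : (E * t) * (W - 2) < 0.7 * (W - 2) := by
          calc _ = E * (W - 2) * t := by ring
            _ < _ := by rw [hEm]; exact hWb
        exact lt_of_mul_lt_mul_right this hW2.le
      have hE0 : 0 < E := by rw [hE]; positivity
      refine bal_est _ _ _ _ _ s t n (t * (t + 1) ^ 2) E hs (by linarith) ?_ ?_ ?_ ?_ ?_ ?_ ?_ ?_ ?_ ?_ ?_ ?_ (by linarith) ?_ ?_
      · exact le_mul_of_one_le_right hs.le (by exact_mod_cast hx)
      · exact le_mul_of_one_le_right hs.le (by exact_mod_cast hz)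
      · exact le_mul_of_one_le_right hs.le (by exact_mod_cast hp)
      · exact le_mul_of_one_le_right hs.le (by exact_mod_cast hq)
      · exact mul_le_mul_of_nonneg_left cxy hs.le
      · exact mul_le_mul_of_nonneg_left czy hs.le
      · have := nat_pq mx mp t hx hp (by omega)
        linarith [mul_le_mul_of_nonneg_left this hs2.le]
      · have := nat_pq mz mq t hz hq (by omega)
        linarith [mul_le_mul_of_nonneg_left this hs2.le]
      · have : (t:ℝ) ≤ my := by exact_mod_cast (by omega : t ≤ my)
        rw [mul_comm]; exact mul_le_mul_of_nonneg_left this hs.le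
      · rw [← csum]; ring
      · rw [← hprod]; ring
      · rw [hn]; push_cast
        have : (s ^ 2 * (t * (t + 1) ^ 2)) * (W - 2) ≤ (3 * (t:ℝ) + 2 + E) * (W - 2) := by linarith
        exact le_of_mul_le_mul_right this hW2
      · have : E * t < (s * (t * s - 1)) * t := by
          have a1 : 1.49 * 0.49 ≤ (t * s) * (t * s - 1) := mul_le_mul hts (by linarith) (by norm_num) (by linarith)
          linarith
        exact lt_of_mul_lt_mul_right this (by linarith)
      · have a1 : 2.24 * (3/4 * 0.49) ≤ (t * s)^2 * ((t - 1)/t * (t * s - 1)) := by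
          apply mul_le_mul (by linarith) _ (by norm_num) (by positivity)
          apply mul_le_mul _ (by linarith) (by norm_num) _
          · rw [le_div_iff₀ (by linarith)]; linarith
          · apply div_nonneg <;> linarith
        have : E * t < (s ^ 2 * (t - 1) * (t * s - 1)) * t := by
          have : (t * s)^2 * ((t - 1)/t * (t * s - 1)) = (s ^ 2 * (t - 1) * (t * s - 1)) * t := by
            field_simp
          linarith
        exact lt_of_mul_lt_mul_right this (by linarith)

lemma base5 (n : ℕ) (s : ℝ) (hs : 0 < s) (hg : GoodNS n s) (ms : List ℕ) (hlen : ms.length = 5) 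
    (hpos : ∀ m ∈ ms, 0 < m) (hsum : ms.sum = n) : 0 < GG (scl s ms) := by
  match ms, hlen with
  | [a, b, c, e, f], _ =>
    simp at hpos hsum
    obtain ⟨h1, h2, h3, h4, h5⟩ := hpos
    have key : ∀ x y z p q : ℕ, [a, b, c, e, f] ~r [x, y, z, p, q] → 0 < x → 0 < z → 0 < p → 0 < q → 
        x ≤ y → z ≤ y → p ≤ y → q ≤ y → x + y + z + p + q = n → 0 < GG (scl s [a, b, c, e, f]) := by
      intro x y z p q hr k1 k2 k3 k4 k5 k6 k7 k8 k9
      rw [GG_rot (scl_rot s hr)]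
      have := base5_max n s hs hg x y z p q k1 k2 k3 k4 k5 k6 k7 k8 k9
      simpa [scl] using this
    have : (a ≤ b ∧ c ≤ b ∧ e ≤ b ∧ f ≤ b) ∨ (b ≤ c ∧ e ≤ c ∧ f ≤ c ∧ a ≤ c) ∨ (c ≤ e ∧ f ≤ e ∧ a ≤ e ∧ b ≤ e) ∨
      (e ≤ f ∧ a ≤ f ∧ b ≤ f ∧ c ≤ f) ∨ (f ≤ a ∧ b ≤ a ∧ c ≤ a ∧ e ≤ a) := by omega
    rcases this with ⟨k1, k2, k3, k4⟩ | ⟨k1, k2, k3, k4⟩ | ⟨k1, k2, k3, k4⟩ | ⟨k1, k2, k3, k4⟩ | ⟨k1, k2, k3, k4⟩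
    · exact key a b c e f ⟨0, rfl⟩ h1 h3 h4 h5 k1 k2 k3 k4 (by omega)
    · exact key b c e f a ⟨1, rfl⟩ h2 h4 h5 h1 k1 k2 k3 k4 (by omega)
    · exact key c e f a b ⟨2, rfl⟩ h3 h5 h1 h2 k1 k2 k3 k4 (by omega)
    · exact key e f a b c ⟨3, rfl⟩ h4 h1 h2 h3 k1 k2 k3 k4 (by omega)
    · exact key f a b c e ⟨4, rfl⟩ h5 h2 h3 h4 k1 k2 k3 k4 (by omega)

lemma GoodNS_lt6 (n : ℕ) (s : ℝ) (hs : 0 < s) (hg : GoodNS n s) : s * n < 6 := by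
  have hs2 : 0 < s ^ 2 := by positivity
  suffices h : (s * n) ^ 2 < 6 ^ 2 by
    exact lt_of_pow_lt_pow_left₀ 2 (by norm_num) h
  obtain ⟨t, ⟨hn, ht, h⟩ | ⟨hn, ht, h⟩ | ⟨hn, ht, h⟩⟩ := hg
  · have htr : (1:ℝ) ≤ t := by exact_mod_cast ht
    have : s ^ 2 * (t:ℝ) ^ 2 ≤ 3 := by
      have : s ^ 2 * (t:ℝ) ^ 2 * t ≤ 3 * t := by linarith
      exact le_of_mul_le_mul_right this (by linarith)
    rw [hn]; push_cast; nlinarith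
  · have htr : (3:ℝ) ≤ t := by exact_mod_cast ht
    have hW : (60:ℝ) ≤ (3 * t - 2) * t * (t + 1) := by nlinarith [mul_nonneg (sub_nonneg.2 htr) (sub_nonneg.2 htr)]
    set W : ℝ := (3 * t - 2) * t * (t + 1) with hWd
    have h2 : s ^ 2 * ((t:ℝ) ^ 2 * (t + 1)) ≤ (3 * t + 1) * (30/29) := by
      have : s ^ 2 * ((t:ℝ) ^ 2 * (t + 1)) * (W - 2) ≤ (3 * t + 1) * (30/29) * (W - 2) := by
        refine h.trans ?_
        rw [mul_assoc]
        apply mul_le_mul_of_nonneg_left _ (by linarith)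
        linarith
      exact le_of_mul_le_mul_right this (by linarith)
    rw [hn]; push_cast
    have h3 : (3 * (t:ℝ) + 1) ^ 3 * (30/29) < 36 * (t ^ 2 * (t + 1)) := by nlinarith [mul_nonneg (sub_nonneg.2 htr) (sub_nonneg.2 htr), mul_nonneg (mul_nonneg (sub_nonneg.2 htr) (sub_nonneg.2 htr)) (sub_nonneg.2 htr)]
    have h4 := mul_le_mul_of_nonneg_left h2 (sq_nonneg (3 * (t:ℝ) + 1))
    have h5 : (s * (3 * (t:ℝ) + 1)) ^ 2 * (t ^ 2 * (t + 1)) < 6 ^ 2 * (t ^ 2 * (t + 1)) := by linarith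
    exact lt_of_mul_lt_mul_right h5 (by positivity)
  · have htr : (2:ℝ) ≤ t := by exact_mod_cast (by omega : 2 ≤ t)
    have hW : (30:ℝ) ≤ (3 * t - 1) * t * (t + 1) := by nlinarith [mul_nonneg (sub_nonneg.2 htr) (sub_nonneg.2 htr)]
    set W : ℝ := (3 * t - 1) * t * (t + 1) with hWd
    have h2 : s ^ 2 * ((t:ℝ) * (t + 1) ^ 2) ≤ (3 * t + 2) * (15/14) := by
      have : s ^ 2 * ((t:ℝ) * (t + 1) ^ 2) * (W - 2) ≤ (3 * t + 2) * (15/14) * (W - 2) := by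
        refine h.trans ?_
        rw [mul_assoc]
        apply mul_le_mul_of_nonneg_left _ (by linarith)
        linarith
      exact le_of_mul_le_mul_right this (by linarith)
    rw [hn]; push_cast
    have h3 : (3 * (t:ℝ) + 2) ^ 3 * (15/14) < 36 * (t * (t + 1) ^ 2) := by nlinarith [mul_nonneg (sub_nonneg.2 htr) (sub_nonneg.2 htr), mul_nonneg (mul_nonneg (sub_nonneg.2 htr) (sub_nonneg.2 htr)) (sub_nonneg.2 htr)]
    have h4 := mul_le_mul_of_nonneg_left h2 (sq_nonneg (3 * (t:ℝ) + 2))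
    have h5 : (s * (3 * (t:ℝ) + 2)) ^ 2 * (t * (t + 1) ^ 2) < 6 ^ 2 * (t * (t + 1) ^ 2) := by linarith
    exact lt_of_mul_lt_mul_right h5 (by positivity)

noncomputable def hK (k : ℕ) : ℝ := ((k:ℝ) + 1) ^ (k + 1) / (k:ℝ) ^ k

lemma hK_pos (k : ℕ) : 0 < hK k := by
  unfold hK
  rcases Nat.eq_zero_or_pos k with rfl | h
  · simp
  · positivity

lemma pow_le_exp_aux (y : ℝ) (hy : 0 ≤ y) (k : ℕ) : y ^ k ≤ Real.exp (k * (y - 1)) := by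
  rw [Real.exp_nat_mul]
  apply pow_le_pow_left₀ hy
  linarith [Real.add_one_le_exp (y - 1)]

lemma s_bound (d : ℕ) (k1 k2 k3 : ℕ) (h1 : 0 < k1) (h2 : 0 < k2) (h3 : 0 < k3) (hk : k1 + k2 + k3 = d) (s X : ℝ)
    (h : s ^ 2 * (d:ℝ) ^ d * (hK k1 * hK k2 * hK k3) ≤ ((d:ℝ) + 3) ^ (d + 1))
    (hX : X = k1 * (((d:ℝ) + 3) * k1 / (d * (k1 + 1)) - 1) + k2 * (((d:ℝ) + 3) * k2 / (d * (k2 + 1)) - 1) + 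
      k3 * (((d:ℝ) + 3) * k3 / (d * (k3 + 1)) - 1)) :
    s ^ 2 * (((k1:ℝ) + 1) * (k2 + 1) * (k3 + 1)) * (1 - X) ≤ (d:ℝ) + 3 := by
  have hd : (0:ℝ) < d := by exact_mod_cast (by omega : 0 < d)
  have c1 : (0:ℝ) < k1 := by exact_mod_cast h1
  have c2 : (0:ℝ) < k2 := by exact_mod_cast h2
  have c3 : (0:ℝ) < k3 := by exact_mod_cast h3
  set n : ℝ := (d:ℝ) + 3 with hn
  have hn0 : 0 < n := by positivity
  have e1 := pow_le_exp_aux (n * k1 / (d * (k1 + 1))) (by positivity) k1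
  have e2 := pow_le_exp_aux (n * k2 / (d * (k2 + 1))) (by positivity) k2
  have e3 := pow_le_exp_aux (n * k3 / (d * (k3 + 1))) (by positivity) k3
  have key : (n * k1 / (d * (k1 + 1))) ^ k1 * (n * k2 / (d * (k2 + 1))) ^ k2 * (n * k3 / (d * (k3 + 1))) ^ k3 ≤ Real.exp X := by
    rw [hX, Real.exp_add, Real.exp_add]
    gcongr
  have main : s ^ 2 * (((k1:ℝ) + 1) * (k2 + 1) * (k3 + 1)) ≤ n * Real.exp X := by
    refine le_trans ?_ (mul_le_mul_of_nonneg_left key hn0.le)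
    have hdd : (d:ℝ) ^ d = (d:ℝ) ^ k1 * (d:ℝ) ^ k2 * (d:ℝ) ^ k3 := by rw [← pow_add, ← pow_add, hk]
    have hnn : n ^ (d + 1) = n ^ k1 * n ^ k2 * n ^ k3 * n := by rw [← pow_add, ← pow_add, hk, pow_succ]
    rw [hdd, hnn] at h
    unfold hK at h
    set A := (d:ℝ) ^ k1 * (d:ℝ) ^ k2 * (d:ℝ) ^ k3 * (((k1:ℝ) + 1) ^ k1 * (k2 + 1) ^ k2 * (k3 + 1) ^ k3) / ((k1:ℝ) ^ k1 * (k2:ℝ) ^ k2 * (k3:ℝ)^ k3) with hA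
    have hA0 : 0 < A := by positivity
    have l1 : s ^ 2 * (((k1:ℝ) + 1) * (k2 + 1) * (k3 + 1)) * A ≤ n ^ k1 * n ^ k2 * n ^ k3 * n := by
      refine le_trans (le_of_eq ?_) h
      rw [hA]; field_simp; ring
    have l2 : n ^ k1 * n ^ k2 * n ^ k3 * n = (n * ((n * k1 / (d * (k1 + 1))) ^ k1 * (n * k2 / (d * (k2 + 1))) ^ k2 * (n * k3 / (d * (k3 + 1))) ^ k3)) * A := by
      rw [hA]; simp only [div_pow, mul_pow]; field_simp
    rw [l2] at l1
    exact le_of_mul_le_mul_right l1 hA0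
  have hneg : 1 - X ≤ Real.exp (-X) := by linarith [Real.add_one_le_exp (-X)]
  calc _ ≤ s ^ 2 * (((k1:ℝ) + 1) * (k2 + 1) * (k3 + 1)) * Real.exp (-X) := by gcongr
    _ ≤ n * Real.exp X * Real.exp (-X) := by gcongr
    _ = n := by rw [mul_assoc, ← Real.exp_add]; simp

lemma goodNS_of (d : ℕ) (hd : 3 ≤ d) (hodd : Odd d) (s : ℝ)
    (h : s ^ 2 * (d:ℝ) ^ d * (hK (d / 3) * hK ((d + 1) / 3) * hK ((d + 2) / 3)) ≤ ((d:ℝ) + 3) ^ (d + 1)) : 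
    GoodNS (d + 3) s := by
  have q1 : 0 < d / 3 := by omega
  have q2 : 0 < (d + 1) / 3 := by omega
  have q3 : 0 < (d + 2) / 3 := by omega
  have q4 : d / 3 + (d + 1) / 3 + (d + 2) / 3 = d := by omega
  obtain ⟨r, hr⟩ := hodd
  have hcase : (∃ t, d = 3 * t + 3) ∨ (∃ t, d = 3 * t + 7) ∨ (d = 5) ∨ (∃ t, d = 3 * t + 11) := by
    have : d % 3 = 0 ∨ d % 3 = 1 ∨ d % 3 = 2 := by omega
    rcases this with h | h | h
    · left; exact ⟨d / 3 - 1, by omega⟩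
    · right; left; exact ⟨(d - 7) / 3, by omega⟩
    · right; right
      by_cases h5 : d = 5
      · left; exact h5
      · right; exact ⟨(d - 11) / 3, by omega⟩
  have hb := s_bound d (d / 3) ((d + 1) / 3) ((d + 2) / 3) q1 q2 q3 q4 s _ h rfl
  rcases hcase with ⟨t, rfl⟩ | ⟨t, rfl⟩ | rfl | ⟨t, rfl⟩
  · refine ⟨t + 2, Or.inl ⟨by ring, by omega, ?_⟩⟩
    have a1 : (3 * t + 3) / 3 = t + 1 := by omega
    have a2 : (3 * t + 3 + 1) / 3 = t + 1 := by omega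
    have a3 : (3 * t + 3 + 2) / 3 = t + 1 := by omega
    rw [a1, a2, a3] at hb
    push_cast at hb ⊢
    have ht : (0:ℝ) ≤ t := by positivity
    have e : ((3 * (t:ℝ) + 3 + 3) * (t + 1) / ((3 * t + 3) * (t + 1 + 1)) - 1) = 0 := by
      field_simp; ring
    rw [e] at hb
    ring_nf at hb ⊢; linarith
  · refine ⟨t + 3, Or.inr (Or.inl ⟨by ring, by omega, ?_⟩)⟩
    have a1 : (3 * t + 7) / 3 = t + 2 := by omega
    have a2 : (3 * t + 7 + 1) / 3 = t + 2 := by omega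
    have a3 : (3 * t + 7 + 2) / 3 = t + 3 := by omega
    rw [a1, a2, a3] at hb
    push_cast at hb ⊢
    have ht : (0:ℝ) ≤ t := by positivity
    have e : ((t:ℝ) + 2) * ((3 * (t:ℝ) + 7 + 3) * (t + 2) / ((3 * t + 7) * (t + 2 + 1)) - 1) + 
      (t + 2) * ((3 * (t:ℝ) + 7 + 3) * (t + 2) / ((3 * t + 7) * (t + 2 + 1)) - 1) + 
      (t + 3) * ((3 * (t:ℝ) + 7 + 3) * (t + 3) / ((3 * t + 7) * (t + 3 + 1)) - 1) = 2 / ((3 * t + 7) * (t + 3) * (t + 4)) := by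
      rw [show (t:ℝ) + 2 + 1 = t + 3 by ring, show (t:ℝ) + 3 + 1 = t + 4 by ring]
      field_simp
      ring
    rw [e] at hb
    have hp : 0 < (3 * (t:ℝ) + 7) * (t + 3) * (t + 4) := by positivity
    have hW : (1 - 2 / ((3 * (t:ℝ) + 7) * (t + 3) * (t + 4))) * ((3 * (t:ℝ) + 7) * (t + 3) * (t + 4)) = (3 * (t:ℝ) + 7) * (t + 3) * (t + 4) - 2 := by
      rw [sub_mul, div_mul_cancel₀ _ hp.ne', one_mul]
    have hb2 := mul_le_mul_of_nonneg_right hb hp.le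
    rw [mul_assoc _ (1 - _), hW] at hb2
    refine le_trans (le_of_eq ?_) (hb2.trans (le_of_eq ?_))
    · ring
    · ring
  · refine ⟨2, Or.inr (Or.inr ⟨by norm_num, by norm_num, ?_⟩)⟩
    norm_num at hb ⊢; linarith
  · refine ⟨t + 4, Or.inr (Or.inr ⟨by ring, by omega, ?_⟩)⟩
    have a1 : (3 * t + 11) / 3 = t + 3 := by omega
    have a2 : (3 * t + 11 + 1) / 3 = t + 4 := by omega
    have a3 : (3 * t + 11 + 2) / 3 = t + 4 := by omega
    rw [a1, a2, a3] at hb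
    push_cast at hb ⊢
    have ht : (0:ℝ) ≤ t := by positivity
    have e : ((t:ℝ) + 3) * ((3 * (t:ℝ) + 11 + 3) * (t + 3) / ((3 * t + 11) * (t + 3 + 1)) - 1) + 
      (t + 4) * ((3 * (t:ℝ) + 11 + 3) * (t + 4) / ((3 * t + 11) * (t + 4 + 1)) - 1) + 
      (t + 4) * ((3 * (t:ℝ) + 11 + 3) * (t + 4) / ((3 * t + 11) * (t + 4 + 1)) - 1) = 2 / ((3 * t + 11) * (t + 4) * (t + 5)) := by
      rw [show (t:ℝ) + 3 + 1 = t + 4 by ring, show (t:ℝ) + 4 + 1 = t + 5 by ring]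
      field_simp
      ring
    rw [e] at hb
    have hp : 0 < (3 * (t:ℝ) + 11) * (t + 4) * (t + 5) := by positivity
    have hW : (1 - 2 / ((3 * (t:ℝ) + 11) * (t + 4) * (t + 5))) * ((3 * (t:ℝ) + 11) * (t + 4) * (t + 5)) = (3 * (t:ℝ) + 11) * (t + 4) * (t + 5) - 2 := by
      rw [sub_mul, div_mul_cancel₀ _ hp.ne', one_mul]
    have hb2 := mul_le_mul_of_nonneg_right hb hp.le
    rw [mul_assoc _ (1 - _), hW] at hb2
    refine le_trans (le_of_eq ?_) (hb2.trans (le_of_eq ?_))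
    · ring
    · ring

lemma log_hK (k : ℕ) : Real.log (hK k) = ((k:ℝ) + 1) * Real.log (k + 1) - k * Real.log k := by
  unfold hK
  rcases Nat.eq_zero_or_pos k with rfl | hk
  · simp
  have hk' : (0:ℝ) < k := by exact_mod_cast hk
  rw [Real.log_div (by positivity) (by positivity), Real.log_pow, Real.log_pow]
  push_cast; ring

lemma hK_anti : StrictAntiOn (fun x : ℝ => (x + 2) * Real.log (x + 2) - 2 * ((x + 1) * Real.log (x + 1)) + x * Real.log x) (Set.Ici 0) := by
  have hc : ∀ c : ℝ, Continuous (fun x : ℝ => (x + c) * Real.log (x + c)) := fun c =>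
    Real.continuous_mul_log.comp (continuous_id.add continuous_const)
  apply strictAntiOn_of_deriv_neg (convex_Ici 0)
  · exact (((hc 2).sub ((hc 1).const_mul 2)).add Real.continuous_mul_log).continuousOn
  · intro x hx
    rw [interior_Ici, Set.mem_Ioi] at hx
    have hd : ∀ c : ℝ, 0 ≤ c → HasDerivAt (fun x : ℝ => (x + c) * Real.log (x + c)) (Real.log (x + c) + 1) x := by
      intro c hc
      exact (Real.hasDerivAt_mul_log (by positivity : x + c ≠ 0)).comp_add_const x c
    have := (((hd 2 (by norm_num)).sub ((hd 1 (by norm_num)).const_mul 2)).add (Real.hasDerivAt_mul_log hx.ne'))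
    have h2 := this.deriv
    have h3 : Real.log (x + 2) + Real.log x < 2 * Real.log (x + 1) := by
      rw [← Real.log_mul (by positivity) (by positivity), ← Real.log_rpow (by positivity)]
      apply Real.log_lt_log (by positivity)
      norm_num; nlinarith
    refine lt_of_eq_of_lt h2 ?_
    linarith

/-- Smoothing -/
lemma hK_smooth (a b : ℕ) (h : b + 2 ≤ a) : hK a * hK b < hK (a - 1) * hK (b + 1) := by
  obtain ⟨c, rfl⟩ : ∃ c, a = c + 1 := ⟨a - 1, by omega⟩
  simp only [Nat.add_sub_cancel]
  have hbc : (b:ℝ) < c := by exact_mod_cast (by omega : b < c)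
  have h1 := hK_anti (Set.mem_Ici.mpr (by positivity : (0:ℝ) ≤ b)) (Set.mem_Ici.mpr (by positivity : (0:ℝ) ≤ c)) hbc
  have p := hK_pos
  rw [← Real.log_lt_log_iff (mul_pos (p _) (p _)) (mul_pos (p _) (p _)), Real.log_mul (p _).ne' (p _).ne',
    Real.log_mul (p _).ne' (p _).ne', log_hK, log_hK, log_hK, log_hK]
  push_cast
  simp only at h1
  rw [show (c:ℝ) + 1 + 1 = c + 2 by ring, show (b:ℝ) + 1 + 1 = b + 2 by ring]
  linarith

/-- elementary shear step -/
noncomputable def Kst (s : ℝ) (b : Bool) : Matrix (Fin 2) (Fin 2) ℝ :=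
  if b then !![1, s; 0, 1] else !![1, 0; -s, 1]

noncomputable def Kmat (s : ℝ) : List Bool → Matrix (Fin 2) (Fin 2) ℝ
  | [] => 1
  | b :: bs => Kst s b * Kmat s bs

def runsL : List ℕ → Bool → List Bool
  | [], _ => []
  | m :: ms, b => List.replicate m b ++ runsL ms (!b)

lemma Kmat_append (s : ℝ) (l m : List Bool) : Kmat s (l ++ m) = Kmat s l * Kmat s m := by
  induction l with
  | nil => simp [Kmat]
  | cons a l ih => simp [Kmat, ih, Matrix.mul_assoc]

lemma Kmat_det (s : ℝ) (l : List Bool) : (Kmat s l).det = 1 := by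
  induction l with
  | nil => simp [Kmat]
  | cons a l ih => rw [Kmat, Matrix.det_mul, ih]; cases a <;> simp [Kst, Matrix.det_fin_two]

lemma runs_exist (l : List Bool) (b : Bool) (hl : ∀ h : l ≠ [], l.head h = b) : ∃ ms : List ℕ, (∀ m ∈ ms, 0 < m) ∧ l = runsL ms b := by
  induction l generalizing b with
  | nil => exact ⟨[], by simp, rfl⟩
  | cons a l ih =>
    have hab : a = b := hl (by simp)
    subst hab
    by_cases hc : ∀ h : l ≠ [], l.head h = a
    · obtain ⟨ms, hp, rfl⟩ := ih a hc
      cases ms with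
      | nil => exact ⟨[1], by simp, by simp [runsL]⟩
      | cons m ms =>
        refine ⟨(m+1) :: ms, ?_, ?_⟩
        · intro x hx
          rcases List.mem_cons.mp hx with rfl | hx
          · omega
          · exact hp x (List.mem_cons_of_mem _ hx)
        · simp [runsL, List.replicate_succ]
    · push Not at hc
      obtain ⟨h, hne⟩ := hc
      obtain ⟨ms, hp, e⟩ := ih (!a) (fun _ => by cases a <;> simp_all)
      refine ⟨1 :: ms, ?_, ?_⟩
      · intro x hx
        rcases List.mem_cons.mp hx with rfl | hx
        · omega
        · exact hp x hx
      · simp [runsL, ← e]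

lemma runs_length (ms : List ℕ) (b : Bool) : (runsL ms b).length = ms.sum := by
  induction ms generalizing b with
  | nil => rfl
  | cons m ms ih => simp [runsL, ih]

lemma Kmat_replicate (s : ℝ) (m : ℕ) (b : Bool) : Kmat s (List.replicate m b) = Kst (s * m) b := by
  induction m with
  | zero => cases b <;> simp [Kmat, Kst, Matrix.one_fin_two]
  | succ m ih =>
    rw [List.replicate_succ, Kmat, ih]
    cases b <;> simp [Kst] <;> ring

noncomputable def Jm : Matrix (Fin 2) (Fin 2) ℝ := !![0, 1; -1, 0]

lemma Kst_not (s : ℝ) (b : Bool) : Kst s (!b) = - (Jm * Kst s b * Jm) := by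
  cases b <;> simp [Kst, Jm]

lemma Jm_sq : Jm * Jm = -1 := by
  simp [Jm, Matrix.one_fin_two]

lemma Kmat_not (s : ℝ) (l : List Bool) : Kmat s (l.map (!·)) = - (Jm * Kmat s l * Jm) := by
  induction l with
  | nil => simp [Kmat, Jm_sq]
  | cons a l ih =>
    rw [List.map_cons, Kmat, ih, Kmat, Kst_not]
    calc _ = Jm * Kst s a * (Jm * Jm) * Kmat s l * Jm := by simp only [Matrix.neg_mul, Matrix.mul_neg, neg_neg, Matrix.mul_assoc]
      _ = _ := by rw [Jm_sq]; simp [Matrix.mul_assoc]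

lemma runs_not (ms : List ℕ) (b : Bool) : runsL ms (!b) = (runsL ms b).map (!·) := by
  induction ms generalizing b with
  | nil => rfl
  | cons m ms ih => simp [runsL, ih, Function.comp_def]

lemma Kmat_runs (s : ℝ) (ms : List ℕ) : Kmat s (runsL ms true) = PB (scl s ms) * Jm ^ ms.length := by
  induction ms with
  | nil => simp [runsL, Kmat, scl_nil, PB_nil]
  | cons m ms ih =>
    have h1 : runsL ms (!true) = (runsL ms true).map (!·) := runs_not ms true
    rw [runsL, Kmat_append, Kmat_replicate, h1, Kmat_not, ih, scl_cons, PB_cons, List.length_cons, pow_succ]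
    have h2 : Bm (s * m) = - (Kst (s * m) true * Jm) := by
      simp [Bm, Kst, Jm]
    rw [h2]
    simp only [Matrix.neg_mul, Matrix.mul_neg, Matrix.mul_assoc]

lemma Jm_pow_even (k : ℕ) : Jm ^ (2 * k) = (-1 : ℝ) ^ k • (1 : Matrix (Fin 2) (Fin 2) ℝ) := by
  rw [pow_mul, pow_two, Jm_sq]
  rcases Nat.even_or_odd k with h | h <;> simp [h.neg_one_pow]

lemma skew_eq (A : Matrix (Fin 2) (Fin 2) ℝ) : A 0 1 - A 1 0 = - (A * Jm).trace := by
  simp [Matrix.trace, Jm, Matrix.mul_apply, Fin.sum_univ_two]; ring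

lemma Kmat_runs_odd (s : ℝ) (ms : List ℕ) (k : ℕ) (h : ms.length = 2 * k + 1) :
    Kmat s (runsL ms true) 0 1 - Kmat s (runsL ms true) 1 0 = GG (scl s ms) := by
  rw [skew_eq, Kmat_runs, h, pow_succ, Matrix.mul_assoc, Matrix.mul_assoc, Jm_sq, Jm_pow_even]
  unfold GG
  rw [scl_length, h, show (2 * k + 1) / 2 = k by omega]
  simp

lemma Kmat_runs_even (s : ℝ) (ms : List ℕ) (k : ℕ) (h : ms.length = 2 * k) :
    Kmat s (runsL ms true) 0 1 - Kmat s (runsL ms true) 1 0 = GG (scl s ms ++ [0]) := by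
  rw [skew_eq, Kmat_runs, h, Matrix.mul_assoc, Jm_pow_even]
  unfold GG
  rw [List.length_append, scl_length, h, show (2 * k + [(0:ℝ)].length) / 2 = k by simp; omega, PB_append, PB_sing]
  have : Bm 0 = - Jm := by simp [Bm, Jm]
  rw [this]; simp

theorem skew_pos (n : ℕ) (s : ℝ) (hs : 0 < s) (hg : GoodNS n s) (ms : List ℕ) (hp : ∀ m ∈ ms, 0 < m) (hl : 5 ≤ ms.length)
    (hsum : ms.sum = n) : 0 < Kmat s (runsL ms true) 0 1 - Kmat s (runsL ms true) 1 0 := by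
  have hGG := GG_pos s hs n (GoodNS_lt6 n s hs hg) (fun ms h1 h2 h3 => base5 n s hs hg ms h1 h2 h3)
  rcases Nat.even_or_odd ms.length with h | h
  · obtain ⟨k, hk⟩ := h
    rw [Kmat_runs_even s ms k (by omega)]
    obtain ⟨a, l, rfl⟩ : ∃ a l, ms = a :: l := by
      cases ms with
      | nil => simp at hl
      | cons a l => exact ⟨a, l, rfl⟩
    have hl0 : l ≠ [] := by rintro rfl; simp at hl
    obtain ⟨mid, z, rfl⟩ : ∃ mid z, l = mid ++ [z] := ⟨l.dropLast, l.getLast hl0, (List.dropLast_append_getLast hl0).symm⟩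
    have e1 : GG (scl s (a :: (mid ++ [z])) ++ [0]) = GG (scl s ((z + a) :: mid)) := by
      have := GG_contract [] (scl s mid) (s * z) (s * a)
      have r : scl s (a :: (mid ++ [z])) ++ [0] ~r [] ++ [s * (z:ℝ), 0, s * a] ++ scl s mid := by
        simp only [scl_cons, scl_append, scl_nil]
        have : s * (a:ℝ) :: (scl s mid ++ [s * (z:ℝ)]) ++ [0] = ([s * (a:ℝ)] ++ scl s mid) ++ [s * (z:ℝ), 0] := by simp
        rw [this]
        refine List.IsRotated.trans List.isRotated_append ?_
        simp
        exact List.IsRotated.refl _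
      rw [GG_rot r, this, scl_cons]
      push_cast; congr 1; simp; ring
    rw [e1]
    simp only [List.length_cons, List.length_append, List.length_nil] at hk hl
    apply hGG ((mid.length - 4) / 2)
    · simp only [List.length_cons]; omega
    · intro m hm
      rcases List.mem_cons.mp hm with rfl | hm
      · have := hp a (by simp); omega
      · exact hp m (by simp [hm])
    · simp at hsum ⊢; omega
  · obtain ⟨k, hk⟩ := h
    rw [Kmat_runs_odd s ms k hk]
    exact hGG (k - 2) ms (by omega) hp hsum

/-- indicator weight: 1 if j<i, j minus, i plus -/
noncomputable def wt {n : ℕ} (ε : Fin n → Bool) (i j : Fin n) : ℝ :=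
  if j < i ∧ ε j = false ∧ ε i = true then 1 else 0

noncomputable def TT {n : ℕ} (ε : Fin n → Bool) (g h : Fin n → ℂ) : ℝ :=
  ∑ i, ∑ j, wt ε i j * ((starRingEnd ℂ) (h i) * g j).im

noncomputable def FF {n : ℕ} (ε : Fin n → Bool) (g : Fin n → ℂ) (a : Fin n) : ℂ :=
  - Complex.I * (∑ j, (wt ε a j : ℂ) * g j) + Complex.I * (∑ i, (wt ε i a : ℂ) * g i)

lemma TT_symm {n : ℕ} (ε : Fin n → Bool) (g h : Fin n → ℂ) :
    TT ε g h + TT ε h g = ∑ a, ((starRingEnd ℂ) (h a) * FF ε g a).re := by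
  have e : ∀ a, ((starRingEnd ℂ) (h a) * FF ε g a).re = 
      ∑ j, wt ε a j * ((starRingEnd ℂ) (h a) * g j).im + ∑ i, wt ε i a * ((starRingEnd ℂ) (g i) * h a).im := by
    intro a
    unfold FF
    rw [mul_add, Complex.add_re]
    congr 1
    · rw [mul_left_comm, neg_mul, Complex.neg_re, Complex.I_mul_re, neg_neg, Finset.mul_sum, Complex.im_sum]
      apply Finset.sum_congr rfl; intro j _
      simp; ring
    · rw [mul_left_comm, Complex.I_mul_re, Finset.mul_sum, Complex.im_sum, ← Finset.sum_neg_distrib]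
      apply Finset.sum_congr rfl; intro j _
      simp; ring
  simp_rw [e, Finset.sum_add_distrib]
  unfold TT
  congr 1
  exact Finset.sum_comm

lemma TT_line {n : ℕ} (ε : Fin n → Bool) (g h : Fin n → ℂ) (t : ℝ) :
    TT ε (fun i => g i + t * h i) (fun i => g i + t * h i) = TT ε g g + t * (TT ε g h + TT ε h g) + t ^ 2 * TT ε h h := by
  unfold TT
  simp only [mul_add, Finset.mul_sum, ← Finset.sum_add_distrib]
  apply Finset.sum_congr rfl; intro i _
  apply Finset.sum_congr rfl; intro j _
  simp; ring

lemma TT_smul {n : ℕ} (ε : Fin n → Bool) (h : Fin n → ℂ) (t : ℝ) :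
    TT ε (fun i => t * h i) (fun i => t * h i) = t ^ 2 * TT ε h h := by
  unfold TT
  simp only [Finset.mul_sum]
  apply Finset.sum_congr rfl; intro i _
  apply Finset.sum_congr rfl; intro j _
  simp; ring

lemma quad_lin (b c : ℝ) (h : ∀ t : ℝ, 0 ≤ t * b + t ^ 2 * c) : b = 0 := by
  by_contra hb
  have hc : 0 < |c| + 1 := by positivity
  have := h (- b / (|c| + 1))
  have e : - b / (|c| + 1) * b + (- b / (|c| + 1)) ^ 2 * c = - (b ^ 2 / (|c| + 1) ^ 2) * (|c| + 1 - c) := by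
    field_simp
    ring
  rw [e] at this
  have h1 : 0 < b ^ 2 / (|c| + 1) ^ 2 := by positivity
  have h2 : 0 < |c| + 1 - c := by linarith [le_abs_self c]
  nlinarith

lemma max_exists {n : ℕ} (ε : Fin n → Bool) (f : Fin n → ℂ) (hf0 : ∑ i, f i = 0) (hf2 : ∑ i, ‖f i‖ ^ 2 = 2) :
    ∃ g : Fin n → ℂ, ∑ i, g i = 0 ∧ ∑ i, ‖g i‖ ^ 2 = 2 ∧ TT ε f f ≤ TT ε g g ∧ 
      ∀ h : Fin n → ℂ, ∑ i, h i = 0 → TT ε h h ≤ TT ε g g / 2 * ∑ i, ‖h i‖ ^ 2 := by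
  set K : Set (Fin n → ℂ) := {g | ∑ i, g i = 0 ∧ ∑ i, ‖g i‖ ^ 2 = 2} with hK
  have hcl : IsClosed K := by
    apply IsClosed.inter
    · exact isClosed_eq (by fun_prop) continuous_const
    · exact isClosed_eq (by fun_prop) continuous_const
  have hbd : K ⊆ Metric.closedBall 0 2 := by
    intro g hg
    rw [mem_closedBall_zero_iff, pi_norm_le_iff_of_nonneg (by norm_num)]
    intro i
    have h1 : ‖g i‖ ^ 2 ≤ 2 := by
      rw [← hg.2]
      exact Finset.single_le_sum (f := fun i => ‖g i‖ ^ 2) (fun j _ => by positivity) (Finset.mem_univ i)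
    nlinarith [norm_nonneg (g i)]
  have hcomp : IsCompact K := (isCompact_closedBall 0 2).of_isClosed_subset hcl hbd
  have hcont : Continuous (fun g : Fin n → ℂ => TT ε g g) := by
    unfold TT
    fun_prop
  obtain ⟨g, hgK, hmax⟩ := hcomp.exists_isMaxOn ⟨f, hf0, hf2⟩ hcont.continuousOn
  refine ⟨g, hgK.1, hgK.2, hmax ⟨hf0, hf2⟩, ?_⟩
  intro h hh
  by_cases hz : ∑ i, ‖h i‖ ^ 2 = 0
  · have : h = 0 := by
      funext i
      have := (Finset.sum_eq_zero_iff_of_nonneg (fun i _ => by positivity)).mp hz i (Finset.mem_univ i)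
      simpa using this
    subst this
    simp [TT]
  · have hpos : 0 < ∑ i, ‖h i‖ ^ 2 := lt_of_le_of_ne (Finset.sum_nonneg fun i _ => by positivity) (Ne.symm hz)
    set q := ∑ i, ‖h i‖ ^ 2 with hq
    set t := √(2 / q) with ht
    have ht2 : t ^ 2 = 2 / q := Real.sq_sqrt (by positivity)
    have hm : (fun i => (t:ℂ) * h i) ∈ K := by
      refine ⟨?_, ?_⟩
      · rw [← Finset.mul_sum, hh, mul_zero]
      · simp only [norm_mul, mul_pow, ← Finset.mul_sum, Complex.norm_real, ← hq, norm_eq_abs, sq_abs, ht2]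
        field_simp
    have h3 : TT ε (fun i => (t:ℂ) * h i) (fun i => (t:ℂ) * h i) ≤ TT ε g g := hmax hm
    rw [TT_smul, ht2, div_mul_eq_mul_div, div_le_iff₀ hpos] at h3
    linarith

lemma station {n : ℕ} (ε : Fin n → Bool) (g : Fin n → ℂ) (hg0 : ∑ i, g i = 0) (hg2 : ∑ i, ‖g i‖ ^ 2 = 2) 
    (hm : ∀ h : Fin n → ℂ, ∑ i, h i = 0 → TT ε h h ≤ TT ε g g / 2 * ∑ i, ‖h i‖ ^ 2) :
    ∃ μ : ℂ, ∀ a, (TT ε g g : ℂ) * g a = FF ε g a + μ := by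
  set σ := TT ε g g with hσ
  have hn : n ≠ 0 := by
    rintro rfl; simp at hg2
  have hn' : (n:ℂ) ≠ 0 := by exact_mod_cast hn
  set u : Fin n → ℂ := fun a => (σ:ℂ) * g a - FF ε g a with hu
  set μ : ℂ := (∑ a, u a) / n with hμ
  set h : Fin n → ℂ := fun a => u a - μ with hh
  have hh0 : ∑ a, h a = 0 := by
    simp only [hh, Finset.sum_sub_distrib, Finset.sum_const, Finset.card_univ, Fintype.card_fin, nsmul_eq_mul, hμ]
    field_simp; simp
  have hlin : ∑ a, ((starRingEnd ℂ) (h a) * u a).re = 0 := by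
    apply quad_lin _ (σ / 2 * ∑ i, ‖h i‖ ^ 2 - TT ε h h)
    intro t
    have h1 := hm (fun i => g i + t * h i) (by rw [Finset.sum_add_distrib, ← Finset.mul_sum, hg0, hh0]; simp)
    rw [TT_line, TT_symm, ← hσ] at h1
    have h2 : ∑ i, ‖g i + t * h i‖ ^ 2 = ∑ i, ‖g i‖ ^ 2 + 2 * t * ∑ i, ((starRingEnd ℂ) (h i) * g i).re + t ^ 2 * ∑ i, ‖h i‖ ^ 2 := by
      rw [Finset.mul_sum, Finset.mul_sum, ← Finset.sum_add_distrib, ← Finset.sum_add_distrib]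
      apply Finset.sum_congr rfl; intro i _
      simp only [← Complex.normSq_eq_norm_sq, Complex.normSq_apply]
      simp; ring
    rw [h2, hg2] at h1
    have h3 : ∑ a, ((starRingEnd ℂ) (h a) * u a).re = σ * ∑ i, ((starRingEnd ℂ) (h i) * g i).re - ∑ a, ((starRingEnd ℂ) (h a) * FF ε g a).re := by
      rw [Finset.mul_sum, ← Finset.sum_sub_distrib]
      apply Finset.sum_congr rfl; intro i _
      simp only [hu]
      simp; ring
    rw [h3]
    nlinarith
  have hsq : ∑ a, ‖h a‖ ^ 2 = 0 := by
    rw [← hlin]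
    have : ∑ a, ((starRingEnd ℂ) (h a) * u a).re = ∑ a, ‖h a‖ ^ 2 + ((starRingEnd ℂ) (∑ a, h a) * μ).re := by
      rw [map_sum, Finset.sum_mul, Complex.re_sum, ← Finset.sum_add_distrib]
      apply Finset.sum_congr rfl; intro i _
      have : u i = h i + μ := by simp [hh]
      rw [this, mul_add, Complex.add_re, ← Complex.normSq_eq_norm_sq, ← Complex.normSq_eq_conj_mul_self]
      simp
    rw [this, hh0]; simp
  refine ⟨μ, fun a => ?_⟩
  have := (Finset.sum_eq_zero_iff_of_nonneg (fun i _ => by positivity)).mp hsq a (Finset.mem_univ a)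
  have h0 : h a = 0 := by simpa using this
  simp only [hh, hu] at h0
  linear_combination h0

section transfer
variable {n : ℕ} (ε : Fin n → Bool) (g : Fin n → ℂ) (μ : ℂ)

noncomputable def Pk (k : ℕ) : ℂ := (∑ i : Fin n, if k ≤ i.val ∧ ε i = true then g i else 0) - Complex.I * μ
noncomputable def Nk (k : ℕ) : ℂ := - Complex.I * ((∑ i : Fin n, if i.val < k ∧ ε i = false then g i else 0) + Complex.I * μ)

lemma Pk_step (k : Fin n) : Pk ε g μ k = Pk ε g μ (k + 1) + (if ε k = true then g k else 0) := by
  unfold Pk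
  rw [sub_add_eq_add_sub]
  congr 1
  have : (if ε k = true then g k else 0) = ∑ i : Fin n, if i = k then (if ε k = true then g k else 0) else 0 := by simp
  rw [this, ← Finset.sum_add_distrib]
  apply Finset.sum_congr rfl; intro i _
  by_cases hik : i = k
  · subst hik; simp
  · have h1 : i.val ≠ k.val := fun h => hik (Fin.ext h)
    have : (k.val ≤ i.val) ↔ (k.val + 1 ≤ i.val) := by omega
    simp [hik, this]

lemma Nk_step (k : Fin n) : Nk ε g μ k = Nk ε g μ (k + 1) + Complex.I * (if ε k = false then g k else 0) := by
  unfold Nk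
  have : (∑ i : Fin n, if i.val < k.val + 1 ∧ ε i = false then g i else 0) = (∑ i : Fin n, if i.val < k.val ∧ ε i = false then g i else 0) + 
      (if ε k = false then g k else 0) := by
    have : (if ε k = false then g k else 0) = ∑ i : Fin n, if i = k then (if ε k = false then g k else 0) else 0 := by simp
    rw [this, ← Finset.sum_add_distrib]
    apply Finset.sum_congr rfl; intro i _
    by_cases hik : i = k
    · subst hik; simp
    · have h1 : i.val ≠ k.val := fun h => hik (Fin.ext h)
      have : (i.val < k.val + 1) ↔ (i.val < k.val) := by omega
      simp [hik, this]
  rw [this]; ring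

lemma FF_plus (a : Fin n) (h : ε a = true) : FF ε g a + μ = Nk ε g μ a := by
  unfold FF Nk wt
  have h2 : ∑ i, (((if a < i ∧ ε a = false ∧ ε i = true then 1 else 0 : ℝ)) : ℂ) * g i = 0 := by
    apply Finset.sum_eq_zero; intro i _; simp [h]
  have h1 : ∑ j, (((if j < a ∧ ε j = false ∧ ε a = true then 1 else 0 : ℝ)) : ℂ) * g j = ∑ i : Fin n, if i.val < a.val ∧ ε i = false then g i else 0 := by
    apply Finset.sum_congr rfl; intro i _
    simp only [h, Fin.lt_def, and_true]
    split_ifs <;> simp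
  rw [h1, h2]
  linear_combination μ * Complex.I_mul_I

lemma FF_minus (a : Fin n) (h : ε a = false) : FF ε g a + μ = Complex.I * Pk ε g μ (a + 1) := by
  unfold FF Pk wt
  have h2 : ∑ i, (((if i < a ∧ ε i = false ∧ ε a = true then 1 else 0 : ℝ)) : ℂ) * g i = 0 := by
    apply Finset.sum_eq_zero; intro i _; simp [h]
  have h1 : ∑ j, (((if a < j ∧ ε a = false ∧ ε j = true then 1 else 0 : ℝ)) : ℂ) * g j = ∑ i : Fin n, if a.val + 1 ≤ i.val ∧ ε i = true then g i else 0 := by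
    apply Finset.sum_congr rfl; intro i _
    simp only [h, Fin.lt_def, true_and, Nat.succ_le_iff]
    split_ifs <;> simp
  rw [h1, h2]
  linear_combination μ * Complex.I_mul_I

lemma transfer_eq (s σ : ℝ) (hσ : s * σ = 1) (hst : ∀ a, (σ : ℂ) * g a = FF ε g a + μ) (m k : ℕ) (hk : k + m = n) :
    Pk ε g μ k = (Kmat s ((List.ofFn ε).drop k) 0 0 : ℝ) * Pk ε g μ n + (Kmat s ((List.ofFn ε).drop k) 0 1 : ℝ) * Nk ε g μ n ∧ 
    Nk ε g μ k = (Kmat s ((List.ofFn ε).drop k) 1 0 : ℝ) * Pk ε g μ n + (Kmat s ((List.ofFn ε).drop k) 1 1 : ℝ) * Nk ε g μ n := by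
  induction m generalizing k with
  | zero =>
    obtain rfl : k = n := by omega
    rw [List.drop_eq_nil_of_le (by simp)]
    simp [Kmat]
  | succ m ih =>
    obtain ⟨i1, i2⟩ := ih (k + 1) (by omega)
    have hkn : k < n := by omega
    rw [List.drop_eq_getElem_cons (by simpa using hkn)]
    simp only [List.getElem_ofFn]
    set A := Kmat s ((List.ofFn ε).drop (k + 1)) with hA
    have p := Pk_step ε g μ ⟨k, hkn⟩
    have q := Nk_step ε g μ ⟨k, hkn⟩
    have st := hst ⟨k, hkn⟩
    have hσc : (s:ℂ) * σ = 1 := by exact_mod_cast hσ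
    simp only [Kmat, ← hA]
    simp only at p q
    cases hb : ε ⟨k, hkn⟩
    · rw [FF_minus ε g μ _ hb] at st
      simp only [hb] at p q st
      have hgk : g ⟨k, hkn⟩ = s * (Complex.I * Pk ε g μ (k + 1)) := by
        linear_combination s * st - g ⟨k, hkn⟩ * hσc
      rw [p, q, hgk]
      simp [Kst, Matrix.mul_apply, Fin.sum_univ_two]
      refine ⟨i1, ?_⟩
      linear_combination i2 + s * Pk ε g μ (k + 1) * Complex.I_mul_I - s * i1
    · rw [FF_plus ε g μ _ hb] at st
      simp only [hb] at p q st
      simp only [Bool.true_eq_false, if_false, mul_zero, add_zero, if_true] at p q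
      have hgk : g ⟨k, hkn⟩ = s * Nk ε g μ (k + 1) := by
        linear_combination s * st - g ⟨k, hkn⟩ * hσc + s * q
      rw [p, q, hgk]
      simp [Kst, Matrix.mul_apply, Fin.sum_univ_two]
      refine ⟨?_, i2⟩
      linear_combination i1 + s * i2

end transfer

theorem spectral {n : ℕ} (ε : Fin n → Bool) (s0 : ℝ) (hs0 : 0 < s0)
    (hne : ∀ s, 0 < s → s ≤ s0 → Kmat s (List.ofFn ε) 0 1 - Kmat s (List.ofFn ε) 1 0 ≠ 0)
    (f : Fin n → ℂ) (hf0 : ∑ i, f i = 0) (hf2 : ∑ i, ‖f i‖ ^ 2 = 2) : TT ε f f < 1 / s0 := by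
  obtain ⟨g, hg0, hg2, hle, hm⟩ := max_exists ε f hf0 hf2
  refine lt_of_le_of_lt hle ?_
  obtain ⟨μ, hst⟩ := station ε g hg0 hg2 hm
  set σ := TT ε g g with hσ
  by_contra hcon
  push Not at hcon
  have hσ0 : 0 < σ := lt_of_lt_of_le (by positivity) hcon
  have hsle : 1 / σ ≤ s0 := by
    rw [div_le_iff₀ hσ0]; rw [div_le_iff₀ hs0] at hcon; linarith
  have hn1 := hne (1 / σ) (by positivity) hsle
  have hsσ : 1 / σ * σ = 1 := by field_simp
  set s := 1 / σ with hs
  obtain ⟨t1, t2⟩ := transfer_eq ε g μ s σ hsσ hst n 0 (by omega)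
  rw [List.drop_zero] at t1 t2
  have hdet := Kmat_det s (List.ofFn ε)
  rw [Matrix.det_fin_two] at hdet
  set A := Kmat s (List.ofFn ε) with hA
  have hsplit : (∑ i : Fin n, if ε i = true then g i else 0) + (∑ i : Fin n, if ε i = false then g i else 0) = 0 := by
    refine Eq.trans ?_ hg0
    rw [← Finset.sum_add_distrib]
    apply Finset.sum_congr rfl; intro i _
    cases ε i <;> simp
  have p0 : Pk ε g μ 0 = (∑ i : Fin n, if ε i = true then g i else 0) - Complex.I * μ := by simp [Pk]
  have n0 : Nk ε g μ 0 = μ := by simp [Nk]; linear_combination (-μ) * Complex.I_mul_I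
  have pn : Pk ε g μ n = - Complex.I * μ := by
    have : ∀ i : Fin n, ¬ (n ≤ i.val) := fun i => by omega
    simp [Pk, this]
  have nn : Nk ε g μ n = Complex.I * Pk ε g μ 0 := by
    rw [p0]; simp only [Nk, Fin.is_lt, true_and]
    linear_combination (-Complex.I) * hsplit 
  rw [nn, pn] at t1 t2
  rw [n0] at t2
  have hz : Pk ε g μ 0 = 0 ∧ μ = 0 := by
    have hdc : (A 0 0 : ℂ) * A 1 1 - A 0 1 * A 1 0 = 1 := by exact_mod_cast hdet
    have hdet2 : ((A 0 1 : ℂ) - A 1 0) ≠ 0 := by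
      intro h; apply hn1; exact_mod_cast h
    set x := Pk ε g μ 0 with hx
    have e1 : ((A 0 1 : ℂ) - A 1 0) * x = 0 := by
      linear_combination Complex.I * (1 + Complex.I * A 1 0) * t1 - Complex.I * Complex.I * A 0 0 * t2 - Complex.I ^ 3 * x * hdc + (((A 0 1 : ℂ) - A 1 0) * x - Complex.I * x) * Complex.I_mul_I
    have e2 : ((A 0 1 : ℂ) - A 1 0) * μ = 0 := by
      linear_combination Complex.I * (Complex.I * A 1 1 * t1 + (1 - Complex.I * A 0 1) * t2) - Complex.I ^ 3 * μ * hdc + (((A 0 1 : ℂ) - A 1 0) * μ - Complex.I * μ) * Complex.I_mul_I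
    exact ⟨(mul_eq_zero.mp e1).resolve_left hdet2, (mul_eq_zero.mp e2).resolve_left hdet2⟩
  obtain ⟨z1, z2⟩ := hz
  have hall : ∀ k ≤ n, Pk ε g μ k = 0 ∧ Nk ε g μ k = 0 := by
    intro k hk
    obtain ⟨u1, u2⟩ := transfer_eq ε g μ s σ hsσ hst (n - k) k (by omega)
    have pn0 : Pk ε g μ n = 0 := by rw [pn, z2, mul_zero]
    have nn0 : Nk ε g μ n = 0 := by rw [nn, z1, mul_zero]
    rw [pn0, nn0, mul_zero, mul_zero, add_zero] at u1 u2
    exact ⟨u1, u2⟩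
  have hg : ∀ a, g a = 0 := by
    intro a
    have st := hst a
    have hσc : (σ:ℂ) ≠ 0 := by exact_mod_cast hσ0.ne'
    cases hb : ε a
    · rw [FF_minus ε g μ _ hb, (hall (a + 1) (by omega)).1, mul_zero] at st
      exact (mul_eq_zero.mp st).resolve_left hσc
    · rw [FF_plus ε g μ _ hb, (hall a (by omega)).2] at st
      exact (mul_eq_zero.mp st).resolve_left hσc
  simp [hg] at hg2

/-- balanced constant -/
noncomputable def Cbal (d : ℕ) : ℝ := hK (d/3) * hK ((d+1)/3) * hK ((d+2)/3)

lemma Cbal_pos (d : ℕ) : 0 < Cbal d := mul_pos (mul_pos (hK_pos _) (hK_pos _)) (hK_pos _)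

lemma TT_lt (d : ℕ) (hd : 3 ≤ d) (hodd : Odd d) (ε : Fin (d+3) → Bool) (ms : List ℕ) (hp : ∀ m ∈ ms, 0 < m) (hl : 5 ≤ ms.length)
    (he : List.ofFn ε = runsL ms true) (f : Fin (d+3) → ℂ) (hf0 : ∑ i, f i = 0) (hf2 : ∑ i, ‖f i‖^2 = 2) :
    TT ε f f < √((d:ℝ)^d * Cbal d / ((d:ℝ)+3)^(d+1)) := by
  have hC := Cbal_pos d
  have hd0 : (0:ℝ) < d := by exact_mod_cast (by omega : 0 < d)
  set R := (d:ℝ)^d * Cbal d / ((d:ℝ)+3)^(d+1) with hR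
  have hR0 : 0 < R := by positivity
  have hs0 : 0 < 1 / √R := by positivity
  have key := spectral ε (1 / √R) hs0 ?_ f hf0 hf2
  · simpa using key
  · intro s hs hss
    apply ne_of_gt
    rw [he]
    have hsum : ms.sum = d + 3 := by rw [← runs_length, ← he]; simp
    refine skew_pos (d+3) s hs (goodNS_of d hd hodd s ?_) ms hp hl hsum
    have h1 : s^2 ≤ 1 / R := by
      calc s^2 ≤ (1/√R)^2 := by gcongr
        _ = 1 / R := by rw [div_pow, Real.sq_sqrt hR0.le, one_pow]
    have h2 : s^2 * R ≤ 1 := by rwa [le_div_iff₀ hR0] at h1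
    rw [hR, mul_div_assoc', div_le_one (by positivity)] at h2
    unfold Cbal at h2
    linarith

lemma runs_short (ms : List ℕ) (hl : ms.length ≤ 4) : ∃ m1 m2 m3 m4 : ℕ, runsL ms true = List.replicate m1 true ++ (List.replicate m2 false ++ (List.replicate m3 true ++ List.replicate m4 false)) := by
  match ms, hl with
  | [], _ => exact ⟨0,0,0,0, by simp [runsL]⟩
  | [a], _ => exact ⟨a,0,0,0, by simp [runsL]⟩
  | [a,b], _ => exact ⟨a,b,0,0, by simp [runsL]⟩
  | [a,b,c], _ => exact ⟨a,b,c,0, by simp [runsL]⟩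
  | [a,b,c,e], _ => exact ⟨a,b,c,e, by simp [runsL]⟩
  | a::b::c::e::f::t, h => simp at h; omega

lemma short_intervals {n : ℕ} (ε : Fin n → Bool) (ms : List ℕ) (hl : ms.length ≤ 4) (he : List.ofFn ε = runsL ms true) :
    ∃ a b c : ℕ, a ≤ b ∧ b ≤ c ∧ c ≤ n ∧ ∀ i : Fin n, ε i = true ↔ (i.1 < a ∨ (b ≤ i.1 ∧ i.1 < c)) := by
  obtain ⟨m1,m2,m3,m4,h⟩ := runs_short ms hl
  rw [h] at he
  have hlen := congrArg List.length he
  simp at hlen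
  refine ⟨m1, m1+m2, m1+m2+m3, by omega, by omega, by omega, ?_⟩
  intro i
  have h1 : (List.ofFn ε)[i.1]? = some (ε i) := by simp
  rw [he] at h1
  simp only [List.getElem?_append, List.length_replicate, List.getElem?_replicate] at h1
  have := i.2
  cases hei : ε i <;> rw [hei] at h1 <;> split_ifs at h1 <;> simp at h1 ⊢ <;> omega

section PM
set_option linter.unusedSectionVars false
variable {ι m p q : Type*} [Fintype ι] [Fintype m] [DecidableEq m] [Fintype p] [DecidableEq p]

/-- weighted cross Gram matrix -/
def sw (A : Matrix ι p ℝ) (w : ι → ℝ) (B : Matrix ι q ℝ) : Matrix p q ℝ :=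
  Matrix.of fun a b => ∑ i, w i * A i a * B i b

lemma sw_apply (A : Matrix ι p ℝ) (w : ι → ℝ) (B : Matrix ι q ℝ) (a : p) (b : q) : sw A w B a b = ∑ i, w i * A i a * B i b := rfl

lemma det_sandwich (e : ι ≃ m) (A B : Matrix ι m ℝ) (w : ι → ℝ) :
    (sw A w B).det = (A.submatrix e.symm id).det * (∏ i, w i) * (B.submatrix e.symm id).det := by
  have h : sw A w B = (A.submatrix e.symm id).transpose * Matrix.diagonal (w ∘ e.symm) * (B.submatrix e.symm id) := by
    ext i j
    rw [Matrix.mul_apply, sw_apply, ← e.symm.sum_comp]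
    apply Finset.sum_congr rfl
    intro k _
    simp only [Matrix.mul_diagonal, Matrix.transpose_apply, Matrix.submatrix_apply, id, Function.comp]
    ring
  rw [h, Matrix.det_mul, Matrix.det_mul, Matrix.det_transpose, Matrix.det_diagonal]
  congr 2
  exact e.symm.prod_comp w

lemma det_weighted (e : ι ≃ m ⊕ p) (X : Matrix ι m ℝ) (Y : Matrix ι p ℝ) (hXY : sw X 1 Y = 0) (lam : ι → ℝ)
    (hl : ∀ i, lam i ≠ 0) :
    (sw X lam X).det * (sw Y 1 Y).det = 
      (∏ i, lam i) * (sw X 1 X).det * (sw Y (fun i => (lam i)⁻¹) Y).det := by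
  have hXY' : ∀ a b, ∑ i, X i a * Y i b = 0 := by
    intro a b
    have := congrFun (congrFun hXY a) b
    simpa [sw_apply] using this
  set Z : Matrix ι (m ⊕ p) ℝ := Matrix.of fun i => Sum.elim (X i) (Y i) with hZ
  set T : Matrix ι (m ⊕ p) ℝ := Matrix.of fun i => Sum.elim (fun a => lam i * X i a) (Y i) with hT
  have h1 : sw Z 1 T = Matrix.fromBlocks (sw X lam X) 0 (sw Y lam X) (sw Y 1 Y) := by
    ext (a | a) (b | b) <;> simp only [sw_apply, hZ, hT, Matrix.of_apply, Sum.elim_inl, Sum.elim_inr, Matrix.fromBlocks_apply₁₁, 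
      Matrix.fromBlocks_apply₁₂, Matrix.fromBlocks_apply₂₁, Matrix.fromBlocks_apply₂₂, Matrix.zero_apply, Pi.one_apply, one_mul]
    · exact Finset.sum_congr rfl fun i _ => by ring
    · exact hXY' a b
    · exact Finset.sum_congr rfl fun i _ => by ring
  have h2 : sw Z (fun i => (lam i)⁻¹) T = Matrix.fromBlocks (sw X 1 X) (sw X (fun i => (lam i)⁻¹) Y) 0 (sw Y (fun i => (lam i)⁻¹) Y) := by
    ext (a | a) (b | b) <;> simp only [sw_apply, hZ, hT, Matrix.of_apply, Sum.elim_inl, Sum.elim_inr, Matrix.fromBlocks_apply₁₁, 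
      Matrix.fromBlocks_apply₁₂, Matrix.fromBlocks_apply₂₁, Matrix.fromBlocks_apply₂₂, Matrix.zero_apply, Pi.one_apply, one_mul]
    · exact Finset.sum_congr rfl fun i _ => by have := hl i; field_simp
    · rw [← hXY' b a]; exact Finset.sum_congr rfl fun i _ => by have := hl i; field_simp
  have d1 := congrArg Matrix.det h1
  have d2 := congrArg Matrix.det h2
  rw [det_sandwich e, Matrix.det_fromBlocks_zero₁₂] at d1
  rw [det_sandwich e, Matrix.det_fromBlocks_zero₂₁] at d2
  rw [← d1, mul_assoc (∏ i, lam i), ← d2]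
  have : (∏ i, lam i) * (∏ i, (lam i)⁻¹) = 1 := by
    rw [← Finset.prod_mul_distrib]
    exact Finset.prod_eq_one fun i _ => mul_inv_cancel₀ (hl i)
  simp only [Pi.one_apply, Finset.prod_const_one]
  linear_combination (-(Z.submatrix e.symm id).det * (T.submatrix e.symm id).det) * this

lemma det_drop_two (e : ι ≃ m ⊕ Fin 2) (X : Matrix ι m ℝ) (Y : Matrix ι (Fin 2) ℝ) (hXY : sw X 1 Y = 0) (b c : ι) (hbc : b ≠ c) :
    (sw X (fun i => if i = b ∨ i = c then 0 else 1) X).det * (sw Y 1 Y).det = 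
      (sw X 1 X).det * (Y b 0 * Y c 1 - Y b 1 * Y c 0) ^ 2 := by
  set S : ι → ℝ := fun i => if i = b ∨ i = c then 0 else 1 with hS
  set F : ℝ → ℝ := fun t => (sw X (fun i => if i = b ∨ i = c then t else 1) X).det * (sw Y 1 Y).det with hF
  set G : ℝ → ℝ := fun t => (sw X 1 X).det * (t • (sw Y S Y) + sw Y (fun i => 1 - S i) Y).det with hG
  have hFG : ∀ t, 0 < t → F t = G t := by
    intro t ht
    simp only [hF, hG]
    have hne : ∀ i, (if i = b ∨ i = c then t else 1 : ℝ) ≠ 0 := by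
      intro i; split_ifs
      · exact ht.ne'
      · norm_num
    rw [det_weighted e X Y hXY _ hne]
    have hp : ∏ i, (if i = b ∨ i = c then t else 1) = t ^ 2 := by
      rw [Finset.prod_ite, Finset.prod_const, Finset.prod_const_one, mul_one]
      have : Finset.univ.filter (fun i => i = b ∨ i = c) = {b, c} := by ext; simp
      rw [this, Finset.card_pair hbc]
    rw [hp]
    have : t • (sw Y S Y) + sw Y (fun i => 1 - S i) Y = 
        t • (sw Y (fun i => ((if i = b ∨ i = c then t else 1 : ℝ))⁻¹) Y) := by
      ext i j
      simp only [Matrix.add_apply, Matrix.smul_apply, sw_apply, smul_eq_mul, Finset.mul_sum, ← Finset.sum_add_distrib]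
      apply Finset.sum_congr rfl
      intro k _
      simp only [hS]
      split_ifs
      · field_simp; ring
      · simp
    rw [this, Matrix.det_smul]
    simp; ring
  have hFc : Continuous F := by
    simp only [hF]
    refine Continuous.mul (Continuous.matrix_det ?_) continuous_const
    refine continuous_matrix fun i j => ?_
    simp only [sw_apply]
    refine continuous_finsetSum _ fun k _ => ?_
    by_cases h : k = b ∨ k = c <;> simp only [h, if_true, if_false] <;> fun_prop
  have hGc : Continuous G := by
    simp only [hG]
    refine Continuous.mul continuous_const (Continuous.matrix_det ?_)
    fun_prop
  have h0 : F 0 = G 0 := by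
    have h1 : Filter.Tendsto F (nhdsWithin 0 (Set.Ioi 0)) (nhds (F 0)) := hFc.continuousAt.tendsto.mono_left nhdsWithin_le_nhds
    have h2 : Filter.Tendsto G (nhdsWithin 0 (Set.Ioi 0)) (nhds (G 0)) := hGc.continuousAt.tendsto.mono_left nhdsWithin_le_nhds
    refine tendsto_nhds_unique h1 (h2.congr' ?_)
    filter_upwards [self_mem_nhdsWithin] with t ht
    exact (hFG t ht).symm
  simp only [hF, hG, zero_smul, zero_add] at h0
  rw [h0]
  congr 1
  have hs : ∀ f : ι → ℝ, ∑ i, (1 - S i) * f i = f b + f c := by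
    intro f
    rw [← Finset.sum_pair hbc]
    rw [← Finset.sum_subset (Finset.subset_univ {b, c})]
    · apply Finset.sum_congr rfl
      intro i hi
      have : i = b ∨ i = c := by simpa using hi
      simp [hS, this]
    · intro i _ hi
      have : ¬ (i = b ∨ i = c) := by simpa using hi
      simp [hS, this]
  rw [Matrix.det_fin_two]
  simp only [sw_apply, mul_assoc, hs]
  ring

lemma sw_posSemidef (X : Matrix ι m ℝ) (w : ι → ℝ) (hw : ∀ i, 0 ≤ w i) : (sw X w X).PosSemidef := by
  have : sw X w X = (Matrix.of fun i a => √(w i) * X i a).conjTranspose * (Matrix.of fun i a => √(w i) * X i a) := by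
    ext a b
    rw [Matrix.mul_apply, sw_apply]
    apply Finset.sum_congr rfl
    intro i _
    simp only [Matrix.conjTranspose_apply, Matrix.of_apply, star_trivial]
    nth_rewrite 1 [← Real.mul_self_sqrt (hw i)]
    ring
  rw [this]
  exact Matrix.posSemidef_conjTranspose_mul_self _

lemma psd_det_le (A : Matrix m m ℝ) (hA : A.PosSemidef) (ht : A.trace = Fintype.card m) : A.det ≤ 1 ∧ (A.det = 1 → A = 1) := by
  have hH := hA.isHermitian
  have hdet : A.det = ∏ i, hH.eigenvalues i := by
    have := hH.det_eq_prod_eigenvalues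
    simpa using this
  have htr : ∑ i, hH.eigenvalues i = Fintype.card m := by
    have := hH.trace_eq_sum_eigenvalues
    rw [ht] at this
    simpa using this.symm
  have hnn : ∀ i, 0 ≤ hH.eigenvalues i := hA.eigenvalues_nonneg
  have hexp : ∀ i, hH.eigenvalues i ≤ Real.exp (hH.eigenvalues i - 1) := fun i => by
    linarith [Real.add_one_le_exp (hH.eigenvalues i - 1)]
  have hprod : ∏ i, Real.exp (hH.eigenvalues i - 1) = 1 := by
    rw [← Real.exp_sum, Finset.sum_sub_distrib, htr]; simp
  constructor
  · rw [hdet, ← hprod]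
    exact Finset.prod_le_prod (fun i _ => hnn i) (fun i _ => hexp i)
  · intro h1
    have hpos : ∀ i, 0 < hH.eigenvalues i := by
      intro i
      rcases (hnn i).lt_or_eq with h | h
      · exact h
      · exfalso
        rw [hdet, Finset.prod_eq_zero (Finset.mem_univ i) h.symm] at h1
        norm_num at h1
    have hone : ∀ i, hH.eigenvalues i = 1 := by
      intro i
      by_contra hne
      have hlt : hH.eigenvalues i < Real.exp (hH.eigenvalues i - 1) := by
        linarith [Real.add_one_lt_exp (sub_ne_zero.mpr hne)]
      have : ∏ i, hH.eigenvalues i < ∏ i, Real.exp (hH.eigenvalues i - 1) :=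
        Finset.prod_lt_prod (fun i _ => hpos i) (fun i _ => hexp i) ⟨i, Finset.mem_univ i, hlt⟩
      rw [hprod, ← hdet, h1] at this
      exact lt_irrefl _ this
    have hsp := hH.spectral_theorem
    have : (RCLike.ofReal ∘ hH.eigenvalues : m → ℝ) = fun _ => 1 := by
      funext i; simp [hone i]
    rw [this] at hsp
    rw [hsp]; simp

end PM

def corner (d : ℕ) (r : ℝ) : Set (Fin d → ℝ) := {x | (∀ i, 0 ≤ x i) ∧ ∑ i, x i ≤ r}

lemma corner_closed (d : ℕ) (r : ℝ) : IsClosed (corner d r) := by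
  have h : corner d r = (⋂ i, {x : Fin d → ℝ | 0 ≤ x i}) ∩ {x | ∑ i, x i ≤ r} := by
    ext x; simp [corner]
  rw [h]
  exact (isClosed_iInter fun i => isClosed_le continuous_const (continuous_apply i)).inter
    (isClosed_le (by fun_prop) continuous_const)

lemma corner_vol (d : ℕ) : ∀ r : ℝ, 0 ≤ r → volume (corner d r) = ENNReal.ofReal (r ^ d / d.factorial) := by
  induction d with
  | zero =>
    intro r hr
    have : corner 0 r = Set.univ := by ext x; simp [corner, hr]
    rw [this]; simp [volume_pi]
  | succ d ih =>
    intro r hr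
    have mp := volume_preserving_piFinSuccAbove (fun _ : Fin (d+1) => ℝ) 0
    set T : Set (ℝ × (Fin d → ℝ)) := {q | 0 ≤ q.1 ∧ q.2 ∈ corner d (r - q.1)} with hT
    have hpre : corner (d+1) r = (MeasurableEquiv.piFinSuccAbove (fun _ : Fin (d+1) => ℝ) 0) ⁻¹' T := by
      ext x
      simp only [corner, hT, Set.mem_ofPred_eq, Set.mem_preimage, MeasurableEquiv.piFinSuccAbove_apply, Fin.forall_fin_succ, Fin.sum_univ_succ]
      simp [Fin.insertNthEquiv, and_assoc, le_sub_iff_add_le']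
      intro _; rfl
    have hTm : MeasurableSet T := by
      have h : T = {q : ℝ × (Fin d → ℝ) | 0 ≤ q.1} ∩ ((⋂ i, {q : ℝ × (Fin d → ℝ) | 0 ≤ q.2 i}) ∩ {q | ∑ i, q.2 i ≤ r - q.1}) := by
        ext q; simp [hT, corner]
      have : IsClosed T := by
        rw [h]
        exact (isClosed_le continuous_const continuous_fst).inter ((isClosed_iInter fun i => isClosed_le continuous_const (by fun_prop)).inter
          (isClosed_le (by fun_prop) (by fun_prop)))
      exact this.measurableSet
    rw [hpre, mp.measure_preimage hTm.nullMeasurableSet, Measure.volume_eq_prod, Measure.prod_apply hTm]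
    have hf : ∀ t : ℝ, volume (Prod.mk t ⁻¹' T) = (Set.Icc 0 r).indicator (fun t => ENNReal.ofReal ((r - t) ^ d / d.factorial)) t := by
      intro t
      by_cases ht : t ∈ Set.Icc 0 r
      · rw [Set.indicator_of_mem ht, ← ih (r - t) (by linarith [ht.2])]
        congr 1
        ext y; simp [hT, ht.1]
      · rw [Set.indicator_of_notMem ht]
        have : Prod.mk t ⁻¹' T = ∅ := by
          ext y
          simp only [hT, corner, Set.mem_preimage, Set.mem_ofPred_eq, Set.mem_empty_iff_false, iff_false]
          rintro ⟨h0, h1, h2⟩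
          apply ht
          refine ⟨h0, ?_⟩
          have := Finset.sum_nonneg (fun i (_ : i ∈ Finset.univ) => h1 i)
          linarith
        rw [this]; simp
    simp_rw [hf]
    rw [lintegral_indicator measurableSet_Icc, ← ofReal_integral_eq_lintegral_ofReal]
    · congr 1
      rw [integral_Icc_eq_integral_Ioc, ← intervalIntegral.integral_of_le hr]
      rw [intervalIntegral.integral_div, intervalIntegral.integral_comp_sub_left (fun x => x ^ d)]
      simp only [sub_self, sub_zero, integral_pow, Nat.factorial_succ]
      push_cast
      field_simp
      simp
    · exact (Continuous.continuousOn (by fun_prop)).integrableOn_compact isCompact_Icc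
    · rw [Filter.EventuallyLE, ae_restrict_iff' measurableSet_Icc]
      exact Filter.Eventually.of_forall fun t ht => div_nonneg (pow_nonneg (by linarith [ht.2]) _) (by positivity)

/-- lifted vector -/
noncomputable def tv {d : ℕ} (v : EuclideanSpace ℝ (Fin d)) : Fin d ⊕ Unit → ℝ := Sum.elim (fun j => √d * v j) (fun _ => 1)

lemma hull_fin {ι E : Type*} [Fintype ι] [AddCommGroup E] [Module ℝ E] (p : ι → E) (z : E) :
    z ∈ convexHull ℝ (Set.range p) ↔ ∃ w : ι → ℝ, (∀ i, 0 ≤ w i) ∧ ∑ i, w i = 1 ∧ ∑ i, w i • p i = z := by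
  constructor
  · intro h
    have h2 : convexHull ℝ (Set.range p) ⊆ {z | ∃ w : ι → ℝ, (∀ i, 0 ≤ w i) ∧ ∑ i, w i = 1 ∧ ∑ i, w i • p i = z} := by
      apply convexHull_min
      · rintro _ ⟨i, rfl⟩
        refine ⟨fun j => if j = i then 1 else 0, fun j => by dsimp only; split_ifs <;> simp, by simp, by simp⟩
      · rintro x ⟨w, hw, hs, rfl⟩ y ⟨u, hu, ht, rfl⟩ a b ha hb hab
        refine ⟨fun i => a * w i + b * u i, fun i => add_nonneg (mul_nonneg ha (hw i)) (mul_nonneg hb (hu i)), ?_, ?_⟩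
        · rw [Finset.sum_add_distrib, ← Finset.mul_sum, ← Finset.mul_sum, hs, ht]; linarith
        · simp only [add_smul, mul_smul, Finset.sum_add_distrib, Finset.smul_sum]
    exact h2 h
  · rintro ⟨w, hw, hs, rfl⟩
    exact (convex_convexHull ℝ _).sum_mem (fun i _ => hw i) hs (fun i _ => subset_convexHull ℝ _ ⟨i, rfl⟩)

lemma hull_eq {d : ℕ} (p : Fin d ⊕ Unit → EuclideanSpace ℝ (Fin d)) :
    convexHull ℝ (Set.range p) = (fun z => p (Sum.inr ()) + z) '' ((fun x : Fin d → ℝ => ∑ i, x i • (p (Sum.inl i) - p (Sum.inr ()))) '' corner d 1) := by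
  rw [Set.image_image]
  ext z
  rw [hull_fin]
  constructor
  · rintro ⟨w, hw, hs, rfl⟩
    refine ⟨fun i => w (Sum.inl i), ⟨fun i => hw _, ?_⟩, ?_⟩
    · rw [Fintype.sum_sum_type] at hs
      have := hw (Sum.inr ())
      simp at hs
      linarith
    · rw [Fintype.sum_sum_type] at hs ⊢
      simp only [Finset.univ_unique, Finset.sum_singleton] at hs ⊢
      simp only [smul_sub, Finset.sum_sub_distrib, ← Finset.sum_smul]
      have : w (Sum.inr default) = 1 - ∑ x, w (Sum.inl x) := by linarith
      rw [this]
      module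
  · rintro ⟨x, ⟨hx, hs⟩, rfl⟩
    refine ⟨Sum.elim x (fun _ => 1 - ∑ i, x i), ?_, ?_, ?_⟩
    · rintro (i | i)
      · exact hx i
      · simpa using hs
    · simp
    · simp only [Fintype.sum_sum_type, Sum.elim_inl, Sum.elim_inr, Finset.univ_unique, Finset.sum_singleton, smul_sub, Finset.sum_sub_distrib, ← Finset.sum_smul]
      module

lemma simplex_vol0 {d : ℕ} (p : Fin d ⊕ Unit → EuclideanSpace ℝ (Fin d)) :
    volume (convexHull ℝ (Set.range p)) = ENNReal.ofReal |(Matrix.of fun i j : Fin d => (p (Sum.inl i)) j - (p (Sum.inr ())) j).det| * ENNReal.ofReal (1 / d.factorial) := by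
  rw [hull_eq, Set.image_add_left, measure_preimage_add]
  set M : Matrix (Fin d) (Fin d) ℝ := Matrix.of fun i j : Fin d => (p (Sum.inl i)) j - (p (Sum.inr ())) j with hM
  have h : (fun x : Fin d → ℝ => ∑ i, x i • (p (Sum.inl i) - p (Sum.inr ()))) '' corner d 1 = 
      (WithLp.ofLp : EuclideanSpace ℝ (Fin d) → (Fin d → ℝ)) ⁻¹' (Matrix.toLin' M.transpose '' corner d 1) := by
    ext z
    simp only [Set.mem_image, Set.mem_preimage]
    apply exists_congr
    intro x
    apply and_congr_right
    intro _
    have : Matrix.toLin' M.transpose x = WithLp.ofLp (∑ i, x i • (p (Sum.inl i) - p (Sum.inr ()))) := by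
      ext j
      simp [Matrix.mulVec, dotProduct, hM, mul_comm]
    rw [this]
    exact (WithLp.ofLp_injective 2).eq_iff.symm
  have hc : IsCompact (corner d 1) := by
    apply (isCompact_Icc (a := (0 : Fin d → ℝ)) (b := 1)).of_isClosed_subset (corner_closed d 1)
    rintro x ⟨hx, hs⟩
    refine ⟨fun i => hx i, fun i => ?_⟩
    exact (Finset.single_le_sum (fun i _ => hx i) (Finset.mem_univ i)).trans hs
  have hm : MeasurableSet (Matrix.toLin' M.transpose '' corner d 1) := by
    apply IsClosed.measurableSet
    apply IsCompact.isClosed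
    apply hc.image
    exact LinearMap.continuous_of_finiteDimensional _
  rw [h, (PiLp.volume_preserving_ofLp (Fin d)).measure_preimage hm.nullMeasurableSet, Measure.addHaar_image_linearMap, corner_vol d 1 zero_le_one, LinearMap.det_toLin',
    Matrix.det_transpose]
  simp

lemma det_tv {d : ℕ} (p : Fin d ⊕ Unit → EuclideanSpace ℝ (Fin d)) :
    (Matrix.of fun i => tv (p i)).det = √d ^ d * (Matrix.of fun i j : Fin d => (p (Sum.inl i)) j - (p (Sum.inr ())) j).det := by
  have h : (Matrix.of fun i => tv (p i)) = Matrix.fromBlocks (Matrix.of fun i j : Fin d => √d * (p (Sum.inl i)) j) (Matrix.of fun _ _ => 1)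
      (Matrix.of fun _ j => √d * (p (Sum.inr ())) j) (1 : Matrix Unit Unit ℝ) := by
    ext (i | i) (j | j) <;> simp [tv]
  rw [h, Matrix.det_fromBlocks_one₂₂]
  have h2 : (Matrix.of fun i j : Fin d => √d * (p (Sum.inl i)) j) - (Matrix.of fun (_ : Fin d) (_ : Unit) => (1:ℝ)) * (Matrix.of fun (_ : Unit) (j : Fin d) => √d * (p (Sum.inr ())) j)
      = √d • (Matrix.of fun i j : Fin d => (p (Sum.inl i)) j - (p (Sum.inr ())) j) := by
    ext i j
    simp [Matrix.mul_apply]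
    ring
  rw [h2, Matrix.det_smul]
  simp

lemma simplex_vol {d : ℕ} (hd : 0 < d) (p : Fin d ⊕ Unit → EuclideanSpace ℝ (Fin d)) :
    volume (convexHull ℝ (Set.range p)) = ENNReal.ofReal (|(Matrix.of fun i => tv (p i)).det| / (√d ^ d * d.factorial)) := by
  rw [simplex_vol0, det_tv, ← ENNReal.ofReal_mul (abs_nonneg _)]
  congr 1
  have : 0 < √(d:ℝ) ^ d := by positivity
  rw [abs_mul, abs_of_pos this]
  field_simp

/-- lifted configuration -/
noncomputable def tX {d : ℕ} {ι : Type*} (v : ι → EuclideanSpace ℝ (Fin d)) : Matrix ι (Fin d ⊕ Unit) ℝ := Matrix.of fun i => tv (v i)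

lemma tX_apply {d : ℕ} {ι : Type*} (v : ι → EuclideanSpace ℝ (Fin d)) (i : ι) (a : Fin d ⊕ Unit) : tX v i a = tv (v i) a := rfl

/-- the dropped simplex -/
lemma drop_vol {d : ℕ} (hd : 0 < d) {ι : Type*} [Fintype ι] [DecidableEq ι] (hι : Fintype.card ι = d + 3) (v : ι → EuclideanSpace ℝ (Fin d)) (b c : ι) (hbc : b ≠ c) :
    volume (convexHull ℝ (v '' {i | i ≠ b ∧ i ≠ c})) =
     ENNReal.ofReal (√((sw (tX v) (fun i => if i = b ∨ i = c then 0 else 1) (tX v)).det) / (√d ^ d * d.factorial)) := by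
  have hcard : Fintype.card {i : ι // i ≠ b ∧ i ≠ c} = Fintype.card (Fin d ⊕ Unit) := by
    rw [Fintype.card_subtype]
    have : (Finset.univ.filter fun i : ι => i ≠ b ∧ i ≠ c) = (Finset.univ.erase b).erase c := by
      ext i; simp [and_comm]
    rw [this, Finset.card_erase_of_mem (by simp [hbc.symm]), Finset.card_erase_of_mem (by simp), Finset.card_univ, hι]
    simp
  let e := Fintype.equivOfCardEq hcard
  have hr : v '' {i | i ≠ b ∧ i ≠ c} = Set.range (fun k => v (e.symm k).1) := by
    ext z
    constructor
    · rintro ⟨i, hi, rfl⟩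
      exact ⟨e ⟨i, hi⟩, by simp⟩
    · rintro ⟨k, rfl⟩
      exact ⟨_, (e.symm k).2, rfl⟩
  rw [hr, simplex_vol hd]
  congr 2
  have h1 : sw (tX v) (fun i => if i = b ∨ i = c then 0 else 1) (tX v) = 
      sw (tX (fun i : {i : ι // i ≠ b ∧ i ≠ c} => v i)) 1 (tX (fun i : {i : ι // i ≠ b ∧ i ≠ c} => v i)) := by
    ext x y
    rw [sw_apply, sw_apply]
    simp only [tX_apply]
    refine Eq.trans ?_ (Finset.sum_subtype (p := fun i : ι => i ≠ b ∧ i ≠ c) (Finset.univ.filter fun i : ι => i ≠ b ∧ i ≠ c) (fun x => by simp) (fun i => (1:ℝ) * tv (v i) x * tv (v i) y))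
    rw [Finset.sum_filter]
    apply Finset.sum_congr rfl
    intro i _
    by_cases h : i = b ∨ i = c
    · rw [if_pos h, if_neg (by tauto)]; simp
    · rw [if_neg h, if_pos (by tauto)]
  rw [h1, det_sandwich e]
  simp only [Pi.one_apply, Finset.prod_const_one, mul_one]
  rw [Real.sqrt_mul_self_eq_abs]
  rfl

lemma tX_trace {d : ℕ} {ι : Type*} [Fintype ι] (v : ι → EuclideanSpace ℝ (Fin d)) (hv : ∀ i, ‖v i‖ = 1) (lam : ι → ℝ) (hl : ∑ i, lam i = 1) :
    (sw (tX v) lam (tX v)).trace = Fintype.card (Fin d ⊕ Unit) := by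
  have h : ∀ i, ∑ a, tv (v i) a * tv (v i) a = d + 1 := by
    intro i
    rw [Fintype.sum_sum_type]
    have h1 := EuclideanSpace.norm_sq_eq (v i)
    rw [hv i] at h1
    simp only [tv, Sum.elim_inl, Sum.elim_inr]
    have h2 : ∀ j, √(d:ℝ) * v i j * (√(d:ℝ) * v i j) = d * ‖v i j‖ ^ 2 := by
      intro j
      rw [Real.norm_eq_abs, sq_abs]
      have := Real.mul_self_sqrt (Nat.cast_nonneg (α := ℝ) d)
      linear_combination (v i j)^2 * this
    simp_rw [h2]
    rw [← Finset.mul_sum, ← h1]; simp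
  simp only [Matrix.trace, Matrix.diag_apply, sw_apply, tX_apply]
  rw [Finset.sum_comm]
  have : ∀ i, ∑ a, lam i * tv (v i) a * tv (v i) a = lam i * (d + 1) := by
    intro i
    rw [← h i, Finset.mul_sum]
    exact Finset.sum_congr rfl fun _ _ => by ring
  simp_rw [this]
  rw [← Finset.sum_mul, hl]; simp

lemma tX_det_le {d : ℕ} {ι : Type*} [Fintype ι] (v : ι → EuclideanSpace ℝ (Fin d)) (hv : ∀ i, ‖v i‖ = 1) (lam : ι → ℝ) (hl : ∑ i, lam i = 1) (hl0 : ∀ i, 0 ≤ lam i) :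
    (sw (tX v) lam (tX v)).det ≤ 1 ∧ ((sw (tX v) lam (tX v)).det = 1 → sw (tX v) lam (tX v) = 1) :=
  psd_det_le _ (sw_posSemidef _ _ hl0) (tX_trace v hv lam hl)

lemma tX_det_nonneg {d : ℕ} {ι : Type*} [Fintype ι] (v : ι → EuclideanSpace ℝ (Fin d)) (lam : ι → ℝ) (hl0 : ∀ i, 0 ≤ lam i) :
    0 ≤ (sw (tX v) lam (tX v)).det := (sw_posSemidef _ _ hl0).det_nonneg

lemma tX_det_le_pow {d : ℕ} {ι : Type*} [Fintype ι] (hι : Fintype.card ι = d + 3) (v : ι → EuclideanSpace ℝ (Fin d)) (hv : ∀ i, ‖v i‖ = 1) :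
    (sw (tX v) 1 (tX v)).det ≤ ((d:ℝ) + 3) ^ (d + 1) := by
  have h0 : (0:ℝ) < d + 3 := by positivity
  have h := (tX_det_le v hv (fun _ => 1 / ((d:ℝ) + 3)) (by simp [hι]; field_simp) (fun _ => by positivity)).1
  have h2 : sw (tX v) (fun _ => 1 / ((d:ℝ) + 3)) (tX v) = (1 / ((d:ℝ) + 3)) • sw (tX v) 1 (tX v) := by
    ext a b
    simp only [sw_apply, Matrix.smul_apply, smul_eq_mul, Finset.mul_sum, Pi.one_apply]
    exact Finset.sum_congr rfl fun _ _ => by ring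
  rw [h2, Matrix.det_smul] at h
  have h3 : Fintype.card (Fin d ⊕ Unit) = d + 1 := by simp
  rw [h3, div_pow, one_pow, one_div, inv_mul_le_iff₀ (by positivity)] at h
  linarith

/-- orthonormal pair of affine dependencies -/
structure KP {ι : Type*} [Fintype ι] {d : ℕ} (v : ι → EuclideanSpace ℝ (Fin d)) (x y : ι → ℝ) : Prop where
  sx : ∑ i, x i = 0
  sy : ∑ i, y i = 0
  vx : ∑ i, x i • v i = 0
  vy : ∑ i, y i • v i = 0
  xx : ∑ i, x i * x i = 1
  yy : ∑ i, y i * y i = 1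
  xy : ∑ i, x i * y i = 0

lemma KP_exists {d : ℕ} (v : Fin (d+3) → EuclideanSpace ℝ (Fin d)) : ∃ x y, KP v x y := by
  let L : EuclideanSpace ℝ (Fin (d+3)) →ₗ[ℝ] (EuclideanSpace ℝ (Fin d) × ℝ) :=
    { toFun := fun μ => (∑ i, μ i • v i, ∑ i, μ i)
      map_add' := by intro a b; simp [add_smul, Finset.sum_add_distrib]
      map_smul' := by intro a b; simp [mul_smul, Finset.smul_sum, Finset.mul_sum] }
  have h1 := L.finrank_range_add_finrank_ker
  have h2 : Module.finrank ℝ L.range ≤ d + 1 := by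
    have := Submodule.finrank_le L.range
    simpa using this
  have h3 : 2 ≤ Module.finrank ℝ L.ker := by
    simp at h1
    omega
  let B := stdOrthonormalBasis ℝ L.ker
  let i0 : Fin (Module.finrank ℝ L.ker) := ⟨0, by omega⟩
  let i1 : Fin (Module.finrank ℝ L.ker) := ⟨1, by omega⟩
  have hi : i0 ≠ i1 := by simp [i0, i1]
  have ho := B.orthonormal
  have k0 := (B i0).2
  have k1 := (B i1).2
  rw [LinearMap.mem_ker] at k0 k1
  have k0' := Prod.ext_iff.1 k0
  have k1' := Prod.ext_iff.1 k1
  have e00 : ⟪B i0, B i0⟫ = 1 := by simp [ho.1 i0]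
  have e11 : ⟪B i1, B i1⟫ = 1 := by simp [ho.1 i1]
  have e01 : ⟪B i0, B i1⟫ = 0 := ho.2 hi
  rw [Submodule.coe_inner, PiLp.inner_apply] at e00 e01 e11
  simp only [RCLike.inner_apply, conj_trivial] at e00 e01 e11
  refine ⟨fun i => (B i0 : EuclideanSpace ℝ (Fin (d+3))) i, fun i => (B i1 : EuclideanSpace ℝ (Fin (d+3))) i, k0'.2, k1'.2, k0'.1, k1'.1, e00, e11, ?_⟩
  rw [← e01]; exact Finset.sum_congr rfl fun i _ => mul_comm _ _

lemma KP_rot {ι : Type*} [Fintype ι] {d : ℕ} {v : ι → EuclideanSpace ℝ (Fin d)} {x y : ι → ℝ} (h : KP v x y) (p q : ℝ) (hpq : p*p+q*q = 1) :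
    KP v (fun i => p * x i + q * y i) (fun i => -q * x i + p * y i) := by
  have key : ∀ a b c e : ℝ, ∑ i, (a * x i + b * y i) * (c * x i + e * y i) = a * c + b * e := by
    intro a b c e
    have : ∀ i, (a * x i + b * y i) * (c * x i + e * y i) = a*c*(x i * x i) + b*e*(y i * y i) + (a*e+b*c)*(x i * y i) := fun i => by ring
    simp_rw [this, Finset.sum_add_distrib, ← Finset.mul_sum, h.xx, h.yy, h.xy]; ring
  have key2 : ∀ a b : ℝ, ∑ i, (a * x i + b * y i) = 0 := by
    intro a b
    rw [Finset.sum_add_distrib, ← Finset.mul_sum, ← Finset.mul_sum, h.sx, h.sy]; simp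
  have key3 : ∀ a b : ℝ, ∑ i, (a * x i + b * y i) • v i = 0 := by
    intro a b
    simp_rw [add_smul, mul_smul]
    rw [Finset.sum_add_distrib, ← Finset.smul_sum, ← Finset.smul_sum, h.vx, h.vy]; simp
  exact ⟨key2 _ _, key2 _ _, key3 _ _, key3 _ _, by rw [key]; linarith, by rw [key]; linarith, by rw [key]; ring⟩

lemma KP_generic {ι : Type*} [Fintype ι] {d : ℕ} {v : ι → EuclideanSpace ℝ (Fin d)} {x y : ι → ℝ} (h : KP v x y) :
    ∃ x' y', KP v x' y' ∧ ∀ i, x' i = 0 → y' i = 0 := by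
  obtain ⟨s, hs⟩ := Infinite.exists_notMem_finset (Finset.univ.image fun i => - x i / y i)
  simp only [Finset.mem_image, Finset.mem_univ, true_and, not_exists] at hs
  have hpos : 0 < √(1 + s*s) := Real.sqrt_pos.2 (by nlinarith [mul_self_nonneg s])
  have hsq : √(1 + s*s) * √(1 + s*s) = 1 + s*s := Real.mul_self_sqrt (by nlinarith [mul_self_nonneg s])
  refine ⟨_, _, KP_rot h (1/√(1+s*s)) (s/√(1+s*s)) ?_, ?_⟩
  · rw [div_mul_div_comm, div_mul_div_comm, hsq, ← add_div, one_mul, div_self]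
    nlinarith [mul_self_nonneg s]
  · intro i hi
    have h1 : x i + s * y i = 0 := by
      field_simp at hi; linarith
    have h2 : y i = 0 := by
      by_contra hy
      apply hs i
      field_simp; linarith
    have h3 : x i = 0 := by rw [h2] at h1; linarith
    simp [h2, h3]

lemma KP_perm {ι : Type*} [Fintype ι] {d : ℕ} {v : ι → EuclideanSpace ℝ (Fin d)} {x y : ι → ℝ} (h : KP v x y) (σ : Equiv.Perm ι) :
    KP (v ∘ σ) (x ∘ σ) (y ∘ σ) :=
  ⟨(Equiv.sum_comp σ x).trans h.sx, (Equiv.sum_comp σ y).trans h.sy, (Equiv.sum_comp σ fun i => x i • v i).trans h.vx, (Equiv.sum_comp σ fun i => y i • v i).trans h.vy,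
   (Equiv.sum_comp σ fun i => x i * x i).trans h.xx, (Equiv.sum_comp σ fun i => y i * y i).trans h.yy, (Equiv.sum_comp σ fun i => x i * y i).trans h.xy⟩

lemma separate {ι : Type*} (P N : Finset ι) (f : ι → ℝ) (h : ∀ b ∈ P, ∀ c ∈ N, f b ≤ f c) : ∃ t, (∀ b ∈ P, f b ≤ t) ∧ ∀ c ∈ N, t ≤ f c := by
  by_cases hP : P.Nonempty
  · obtain ⟨b, hb, hm⟩ := P.exists_max_image f hP
    exact ⟨f b, hm, fun c hc => h b hb c hc⟩
  · by_cases hN : N.Nonempty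
    · obtain ⟨b, hb, hm⟩ := N.exists_min_image f hN
      exact ⟨f b, fun c hc => absurd ⟨c, hc⟩ hP, hm⟩
    · exact ⟨0, fun c hc => absurd ⟨c, hc⟩ hP, fun c hc => absurd ⟨c, hc⟩ hN⟩

lemma covering {ι : Type*} [Fintype ι] {d : ℕ} {v : ι → EuclideanSpace ℝ (Fin d)} {x y : ι → ℝ} (h : KP v x y) (hg : ∀ i, x i = 0 → y i = 0)
    (z : EuclideanSpace ℝ (Fin d)) (hz : z ∈ convexHull ℝ (Set.range v)) :
    ∃ b c, 0 < x b ∧ x c < 0 ∧ y c / x c < y b / x b ∧ z ∈ convexHull ℝ (v '' {i | i ≠ b ∧ i ≠ c}) := by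
  set F : Set (ι → ℝ) := {μ | (∀ i, 0 ≤ μ i) ∧ ∑ i, μ i = 1 ∧ ∑ i, μ i • v i = z} with hF
  have hFc : IsCompact F := by
    apply (isCompact_Icc (a := (0 : ι → ℝ)) (b := 1)).of_isClosed_subset
    · have : F = (⋂ i, {μ : ι → ℝ | 0 ≤ μ i}) ∩ ({μ | ∑ i, μ i = 1} ∩ {μ | ∑ i, μ i • v i = z}) := by
        ext μ; simp [hF]
      rw [this]
      exact (isClosed_iInter fun i => isClosed_le continuous_const (continuous_apply i)).inter
        ((isClosed_eq (by fun_prop) continuous_const).inter (isClosed_eq (by fun_prop) continuous_const))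
    · rintro μ ⟨h1, h2, _⟩
      refine ⟨fun i => h1 i, fun i => ?_⟩
      exact (Finset.single_le_sum (fun i _ => h1 i) (Finset.mem_univ i)).trans h2.le
  have hFn : F.Nonempty := by
    rw [hull_fin] at hz
    obtain ⟨w, h1, h2, h3⟩ := hz
    exact ⟨w, h1, h2, h3⟩
  obtain ⟨μ, hμF, hmin⟩ := hFc.exists_isMinOn hFn (f := fun μ => ∑ i, μ i * y i) (by fun_prop)
  obtain ⟨h1, h2, h3⟩ := hμF
  by_cases hex : ∃ b c, μ b = 0 ∧ μ c = 0 ∧ 0 < x b ∧ x c < 0 ∧ y c / x c < y b / x b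
  · obtain ⟨b, c, hb, hc, hxb, hxc, hs⟩ := hex
    refine ⟨b, c, hxb, hxc, hs, ?_⟩
    rw [← h3]
    have hz' : ∑ i, μ i • v i = ∑ i ∈ Finset.univ.filter (fun i => i ≠ b ∧ i ≠ c), μ i • v i := by
      rw [Finset.sum_filter]
      apply Finset.sum_congr rfl
      intro i _
      split_ifs with hi
      · rfl
      · have : μ i = 0 := by
          by_cases h' : i = b
          · rw [h', hb]
          · have : i = c := by tauto
            rw [this, hc]
        rw [this, zero_smul]
    have hz2 : ∑ i, μ i = ∑ i ∈ Finset.univ.filter (fun i => i ≠ b ∧ i ≠ c), μ i := by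
      rw [Finset.sum_filter]
      apply Finset.sum_congr rfl
      intro i _
      split_ifs with hi
      · rfl
      · by_cases h' : i = b
        · rw [h', hb]
        · have : i = c := by tauto
          rw [this, hc]
    rw [hz']
    apply (convex_convexHull ℝ _).sum_mem (fun i _ => h1 i) (by rw [← hz2, h2])
    intro i hi
    apply subset_convexHull
    exact ⟨i, by simpa using hi, rfl⟩
  · exfalso
    push Not at hex
    obtain ⟨t, ht1, ht2⟩ := separate (Finset.univ.filter fun i => μ i = 0 ∧ 0 < x i) (Finset.univ.filter fun i => μ i = 0 ∧ x i < 0) (fun i => y i / x i)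
      (by
        intro b hb c hc
        simp only [Finset.mem_filter, Finset.mem_univ, true_and] at hb hc
        exact hex b c hb.1 hc.1 hb.2 hc.2)
    have hδ : ∀ i, μ i = 0 → 0 ≤ t * x i - y i := by
      intro i hi
      rcases lt_trichotomy (x i) 0 with hx | hx | hx
      · have := ht2 i (by simp [hi, hx])
        rw [le_div_iff_of_neg hx] at this
        linarith
      · rw [hg i hx, hx]; simp
      · have := ht1 i (by simp [hi, hx])
        rw [div_le_iff₀ hx] at this
        linarith
    -- small step
    have hstep : ∃ r : ℝ, 0 < r ∧ ∀ i, 0 ≤ μ i + r * (t * x i - y i) := by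
      have : ∀ᶠ r in nhdsWithin (0:ℝ) (Set.Ioi 0), ∀ i, 0 ≤ μ i + r * (t * x i - y i) := by
        rw [Filter.eventually_all]
        intro i
        rcases (h1 i).eq_or_lt with h0 | h0
        · filter_upwards [self_mem_nhdsWithin] with r hr
          rw [← h0, zero_add]
          exact mul_nonneg (le_of_lt hr) (hδ i h0.symm)
        · have hc : Filter.Tendsto (fun r : ℝ => μ i + r * (t * x i - y i)) (nhdsWithin 0 (Set.Ioi 0)) (nhds (μ i + 0 * (t * x i - y i))) := 
            Filter.Tendsto.mono_left (Continuous.tendsto (by fun_prop) 0) nhdsWithin_le_nhds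
          filter_upwards [hc.eventually (lt_mem_nhds (show (0:ℝ) < μ i + 0 * (t * x i - y i) by simpa using h0))] with r hr
          exact hr.le
      obtain ⟨r, hr1, hr2⟩ := (this.and self_mem_nhdsWithin).exists
      exact ⟨r, hr2, hr1⟩
    obtain ⟨r, hr, hri⟩ := hstep
    have hmem : (fun i => μ i + r * (t * x i - y i)) ∈ F := by
      refine ⟨hri, ?_, ?_⟩
      · rw [Finset.sum_add_distrib, ← Finset.mul_sum, Finset.sum_sub_distrib, ← Finset.mul_sum, h.sx, h.sy, h2]; simp
      · have : ∀ i, (μ i + r * (t * x i - y i)) • v i = μ i • v i + (r * t) • (x i • v i) - r • (y i • v i) := fun i => by module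
        simp_rw [this]
        rw [Finset.sum_sub_distrib, Finset.sum_add_distrib, ← Finset.smul_sum, ← Finset.smul_sum, h.vx, h.vy, h3]; simp
    have := hmin hmem
    simp only [Set.mem_ofPred_eq] at this
    have e : ∑ i, (μ i + r * (t * x i - y i)) * y i = ∑ i, μ i * y i - r := by
      have : ∀ i, (μ i + r * (t * x i - y i)) * y i = μ i * y i + (r * t) * (x i * y i) - r * (y i * y i) := fun i => by ring
      simp_rw [this]
      rw [Finset.sum_sub_distrib, Finset.sum_add_distrib, ← Finset.mul_sum, ← Finset.mul_sum, h.xy, h.yy]; ring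
    linarith

/-- the two column matrix -/
def YM {ι : Type*} (x y : ι → ℝ) : Matrix ι (Fin 2) ℝ := Matrix.of fun i => ![x i, y i]

lemma YM_zero {ι : Type*} (x y : ι → ℝ) (i : ι) : YM x y i 0 = x i := rfl
lemma YM_one {ι : Type*} (x y : ι → ℝ) (i : ι) : YM x y i 1 = y i := rfl

lemma sw_tX_YM {ι : Type*} [Fintype ι] {d : ℕ} {v : ι → EuclideanSpace ℝ (Fin d)} {x y : ι → ℝ} (sx : ∑ i, x i = 0) (sy : ∑ i, y i = 0) 
    (vx : ∑ i, x i • v i = 0) (vy : ∑ i, y i • v i = 0) : sw (tX v) 1 (YM x y) = 0 := by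
  have hh : ∀ u : ι → ℝ, ∑ i, u i = 0 → ∑ i, u i • v i = 0 → ∀ a, ∑ i, (1 : ι → ℝ) i * tX v i a * u i = 0 := by
    intro u hu hv a
    rcases a with j | j
    · have h1 := congrArg (fun w : EuclideanSpace ℝ (Fin d) => w j) hv
      simp only [WithLp.ofLp_sum, Finset.sum_apply, PiLp.smul_apply, smul_eq_mul, PiLp.zero_apply] at h1
      have h2 : ∀ i, (1 : ι → ℝ) i * tX v i (Sum.inl j) * u i = √d * (u i * v i j) := by
        intro i; simp [tX_apply, tv]; ring
      simp_rw [h2]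
      rw [← Finset.mul_sum, h1, mul_zero]
    · simpa [tX_apply, tv] using hu
  ext a b
  rw [sw_apply]
  fin_cases b
  · exact hh x sx vx a
  · exact hh y sy vy a

lemma sw_YM_YM {ι : Type*} [Fintype ι] {d : ℕ} {v : ι → EuclideanSpace ℝ (Fin d)} {x y : ι → ℝ} (h : KP v x y) : sw (YM x y) 1 (YM x y) = 1 := by
  ext a b
  rw [sw_apply]
  fin_cases a <;> fin_cases b <;> simp [YM_zero, YM_one, h.xx, h.yy, h.xy]
  rw [← h.xy]
  exact Finset.sum_congr rfl fun i _ => mul_comm _ _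

lemma card_equiv {d : ℕ} {ι : Type*} [Fintype ι] (hι : Fintype.card ι = d + 3) : Nonempty (ι ≃ (Fin d ⊕ Unit) ⊕ Fin 2) :=
  ⟨Fintype.equivOfCardEq (by simp [hι])⟩

/-- the complex encoding -/
noncomputable def gC {ι : Type*} (x y : ι → ℝ) : ι → ℂ := fun i => ⟨x i, y i⟩

/-- sign pattern -/
noncomputable def sgn {ι : Type*} (x : ι → ℝ) : ι → Bool := fun i => decide (¬ x i < 0)

lemma cover_vol {d : ℕ} (hd : 0 < d) {v : Fin (d+3) → EuclideanSpace ℝ (Fin d)} {x y : Fin (d+3) → ℝ} (h : KP v x y) (hg : ∀ i, x i = 0 → y i = 0)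
    (hs : Monotone fun i => y i / x i) :
    volume (convexHull ℝ (Set.range v)) ≤ ENNReal.ofReal (√((sw (tX v) 1 (tX v)).det) * TT (sgn x) (gC x y) (gC x y) / (√d ^ d * d.factorial)) := by
  obtain ⟨e⟩ := card_equiv (d := d) (ι := Fin (d+3)) (by simp)
  set D := (sw (tX v) 1 (tX v)).det with hD
  have hdrop : ∀ b c, b ≠ c → volume (convexHull ℝ (v '' {i | i ≠ b ∧ i ≠ c})) = ENNReal.ofReal (√D * |x b * y c - y b * x c| / (√d ^ d * d.factorial)) := by
    intro b c hbc
    rw [drop_vol hd (by simp) v b c hbc]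
    have h1 := det_drop_two e (tX v) (YM x y) (sw_tX_YM h.sx h.sy h.vx h.vy) b c hbc
    rw [sw_YM_YM h, Matrix.det_one, mul_one] at h1
    simp only [YM_zero, YM_one] at h1
    congr 2
    rw [← Real.sqrt_sq_eq_abs, ← Real.sqrt_mul' _ (sq_nonneg _), ← h1]
    congr!
  have hterm : ∀ i j, wt (sgn x) i j * ((starRingEnd ℂ) (gC x y i) * gC x y j).im = wt (sgn x) i j * |x i * y j - y i * x j| := by
    intro i j
    unfold wt
    split_ifs with hw
    · obtain ⟨hij, hj, hi⟩ := hw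
      simp only [sgn, decide_eq_false_iff_not, decide_eq_true_eq, not_lt, not_le] at hi hj
      have him : ((starRingEnd ℂ) (gC x y i) * gC x y j).im = x i * y j - y i * x j := by
        simp [gC]; ring
      rw [him, abs_of_nonneg]
      rcases hi.eq_or_lt with h0 | h0
      · rw [← h0, hg i h0.symm]; simp
      · have := hs hij.le
        simp only at this
        rw [le_div_iff₀ h0, div_mul_eq_mul_div, div_le_iff_of_neg hj] at this
        linarith
    · simp
  have hsub : convexHull ℝ (Set.range v) ⊆ ⋃ p ∈ (Finset.univ.filter fun p : Fin (d+3) × Fin (d+3) => wt (sgn x) p.1 p.2 = 1), convexHull ℝ (v '' {i | i ≠ p.1 ∧ i ≠ p.2}) := by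
    intro z hz
    obtain ⟨b, c, hb, hc, hsl, hm⟩ := covering h hg z hz
    simp only [Set.mem_iUnion]
    refine ⟨(b, c), ?_, hm⟩
    rw [Finset.mem_filter]
    refine ⟨Finset.mem_univ _, ?_⟩
    rw [wt, if_pos]
    refine ⟨?_, by simp [sgn, hc], by simp [sgn, hb.le]⟩
    by_contra hcb
    have := hs (not_lt.1 hcb)
    simp only at this
    linarith
  refine (measure_mono hsub).trans ((measure_biUnion_finset_le _ _).trans ?_)
  have hwt : ∀ i j, wt (sgn x) i j = 1 → i ≠ j := by
    intro i j hw hij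
    rw [wt, if_neg] at hw
    · simp at hw
    · rintro ⟨h1, -⟩; rw [hij] at h1; exact lt_irrefl _ h1
  rw [Finset.sum_congr rfl (fun p hp => hdrop p.1 p.2 (hwt _ _ (by simpa using hp)))]
  rw [← ENNReal.ofReal_sum_of_nonneg (fun _ _ => by positivity)]
  apply le_of_eq
  congr 1
  rw [← Finset.sum_div, ← Finset.mul_sum]
  congr 2
  rw [TT]
  simp_rw [hterm]
  rw [Finset.sum_filter, ← Finset.univ_product_univ, Finset.sum_product]
  refine Finset.sum_congr rfl fun i _ => Finset.sum_congr rfl fun j _ => ?_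
  unfold wt
  split_ifs <;> simp_all

lemma setup {d : ℕ} (hd : 0 < d) (v : Fin (d+3) → EuclideanSpace ℝ (Fin d)) : ∃ (σ : Equiv.Perm (Fin (d+3))) (x y : Fin (d+3) → ℝ), KP (v ∘ σ) x y ∧ 
    sgn x 0 = true ∧ volume (convexHull ℝ (Set.range v)) ≤ ENNReal.ofReal (√((sw (tX (v ∘ σ)) 1 (tX (v ∘ σ))).det) * TT (sgn x) (gC x y) (gC x y) / (√d ^ d * d.factorial)) := by
  obtain ⟨x0, y0, h0⟩ := KP_exists v
  obtain ⟨x, y, h, hg⟩ := KP_generic h0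
  let σ := Tuple.sort (fun i => y i / x i)
  have hm : Monotone ((fun i => y i / x i) ∘ σ) := Tuple.monotone_sort _
  have h1 := KP_perm h σ
  have hr : Set.range v = Set.range (v ∘ σ) := by rw [EquivLike.range_comp]
  rw [hr]
  by_cases hx : (x ∘ σ) 0 < 0
  · have h2 := KP_rot h1 (-1) 0 (by norm_num)
    refine ⟨σ, _, _, h2, ?_, cover_vol hd h2 ?_ ?_⟩
    · simp only [sgn, Function.comp] at hx ⊢
      simp; linarith
    · intro i; simp; exact hg (σ i)
    · intro i j hij
      simpa using hm hij
  · refine ⟨σ, _, _, h1, ?_, cover_vol hd h1 (fun i => hg (σ i)) hm⟩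
    simpa [sgn] using hx

section cls
variable {ι : Type*} [Fintype ι] (κ : ι → Fin 3) (k : Fin 3 → ℕ) (hc : ∀ X, (Finset.univ.filter fun i => κ i = X).card = k X + 1)

lemma sum_if_cls (hc : ∀ X, (Finset.univ.filter fun i => κ i = X).card = k X + 1) (X : Fin 3) (r : ℝ) : ∑ i, (if κ i = X then r else 0) = (k X + 1) * r := by
  rw [← Finset.sum_filter, Finset.sum_const, hc]; simp

lemma sum_cls (hc : ∀ X, (Finset.univ.filter fun i => κ i = X).card = k X + 1) (F : Fin 3 → ℝ) : ∑ i, F (κ i) = ∑ X, (k X + 1) * F X := by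
  rw [← Finset.sum_fiberwise Finset.univ κ]
  apply Finset.sum_congr rfl
  intro X _
  rw [Finset.sum_congr rfl (g := fun _ => F X) (fun i hi => by simp at hi; rw [hi]), Finset.sum_const, hc]; simp

lemma prod_cls (hc : ∀ X, (Finset.univ.filter fun i => κ i = X).card = k X + 1) (F : Fin 3 → ℝ) : ∏ i, F (κ i) = ∏ X, F X ^ (k X + 1) := by
  rw [← Finset.prod_fiberwise Finset.univ κ]
  apply Finset.prod_congr rfl
  intro X _
  rw [Finset.prod_congr rfl (g := fun _ => F X) (fun i hi => by simp at hi; rw [hi]), Finset.prod_const, hc]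

lemma card_cls (hc : ∀ X, (Finset.univ.filter fun i => κ i = X).card = k X + 1) : Fintype.card ι = ∑ X, (k X + 1) := by
  rw [← Finset.card_univ, Finset.card_eq_sum_card_fiberwise (f := κ) (t := Finset.univ) (by simp)]
  exact Finset.sum_congr rfl fun X _ => hc X

lemma config_exists (d : ℕ) (hk : ∀ X, 0 < k X) (hc : ∀ X, (Finset.univ.filter fun i => κ i = X).card = k X + 1) (hsum : ∑ X, k X = d) :
    ∃ w : ι → EuclideanSpace ℝ (Fin d), (∀ i j, ⟪w i, w j⟫ = if i = j then 1 else if κ i = κ j then -(1 / (k (κ i) : ℝ)) else 0) ∧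
      (∀ u u', ∑ i, ((k (κ i) : ℝ) / (k (κ i) + 1)) * (⟪w i, u⟫ * ⟪w i, u'⟫) = ⟪u, u'⟫) ∧ 
      (∀ F : Fin 3 → ℝ, ∑ i, F (κ i) • w i = 0) := by
  let T : EuclideanSpace ℝ ι →ₗ[ℝ] (Fin 3 → ℝ) :=
    { toFun := fun f X => ∑ i, if κ i = X then f i else 0
      map_add' := by
        intro a b; ext X
        simp only [Pi.add_apply, ← Finset.sum_add_distrib]
        apply Finset.sum_congr rfl; intro i _; split_ifs <;> simp
      map_smul' := by
        intro a b; ext X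
        simp only [Pi.smul_apply, smul_eq_mul, Finset.mul_sum, RingHom.id_apply]
        apply Finset.sum_congr rfl; intro i _; split_ifs <;> simp }
  have hTs : LinearMap.range T = ⊤ := by
    rw [LinearMap.range_eq_top]
    intro g
    refine ⟨WithLp.toLp 2 (fun i => g (κ i) / (k (κ i) + 1)), ?_⟩
    ext X
    have : ∀ i, (if κ i = X then g (κ i) / ((k (κ i) : ℝ) + 1) else 0) = if κ i = X then g X / ((k X : ℝ) + 1) else 0 := by
      intro i; split_ifs with h
      · rw [h]
      · rfl
    change (∑ i, if κ i = X then g (κ i) / ((k (κ i) : ℝ) + 1) else 0) = g X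
    simp_rw [this]
    rw [sum_if_cls κ k hc]
    field_simp
  have hcard := card_cls κ k hc
  have hdim : Module.finrank ℝ (LinearMap.ker T) = d := by
    have h1 := T.finrank_range_add_finrank_ker
    rw [hTs, finrank_top, finrank_euclideanSpace, hcard, Finset.sum_add_distrib, hsum] at h1
    simp at h1
    omega
  let φ : LinearMap.ker T ≃ₗᵢ[ℝ] EuclideanSpace ℝ (Fin d) := ((stdOrthonormalBasis ℝ (LinearMap.ker T)).reindex (finCongr hdim)).repr
  let f : ι → EuclideanSpace ℝ ι := fun i => WithLp.toLp 2 (fun j => (if i = j then 1 else 0) - (if κ j = κ i then 1 / ((k (κ i) : ℝ) + 1) else 0))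
  have hf : ∀ i, f i ∈ LinearMap.ker T := by
    intro i
    rw [LinearMap.mem_ker]
    ext X
    change (∑ j, if κ j = X then ((if i = j then (1:ℝ) else 0) - (if κ j = κ i then 1 / ((k (κ i) : ℝ) + 1) else 0)) else 0) = 0
    have : ∀ j, (if κ j = X then ((if i = j then (1:ℝ) else 0) - (if κ j = κ i then 1 / ((k (κ i) : ℝ) + 1) else 0)) else 0) =
       (if i = j then (if κ i = X then (1:ℝ) else 0) else 0) - (if κ j = X then (if X = κ i then 1 / ((k (κ i) : ℝ) + 1) else 0) else 0) := by
      intro j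
      by_cases h1 : κ j = X
      · by_cases h2 : i = j
        · subst h2; simp [h1]
        · simp [h1, h2]
      · by_cases h2 : i = j
        · subst h2; simp [h1]
        · simp [h1, h2]
    simp_rw [this]
    rw [Finset.sum_sub_distrib, sum_if_cls κ k hc]
    by_cases h : κ i = X
    · subst h; simp; field_simp; simp
    · simp [h, Ne.symm h]
  let c : Fin 3 → ℝ := fun X => √(((k X : ℝ) + 1) / k X)
  have hc2 : ∀ X, c X * c X = ((k X : ℝ) + 1) / k X := fun X => Real.mul_self_sqrt (by positivity)
  let w : ι → EuclideanSpace ℝ (Fin d) := fun i => φ (c (κ i) • ⟨f i, hf i⟩)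
  have key : ∀ i (g : LinearMap.ker T), ⟪w i, φ g⟫ = c (κ i) * (g : EuclideanSpace ℝ ι) i := by
    intro i g
    have hg := g.2
    rw [LinearMap.mem_ker] at hg
    have hg := congrFun hg (κ i)
    change (∑ j, if κ j = κ i then (g : EuclideanSpace ℝ ι) j else 0) = 0 at hg
    simp only [w]
    rw [LinearIsometryEquiv.inner_map_map, Submodule.coe_inner, Submodule.coe_smul, inner_smul_left, PiLp.inner_apply]
    simp only [RCLike.inner_apply, conj_trivial]
    congr 1
    have : ∀ j, (g : EuclideanSpace ℝ ι) j * (f i) j = (if i = j then (g : EuclideanSpace ℝ ι) j else 0) - (1 / ((k (κ i) : ℝ) + 1)) * (if κ j = κ i then (g : EuclideanSpace ℝ ι) j else 0) := by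
      intro j
      change (g : EuclideanSpace ℝ ι) j * ((if i = j then (1:ℝ) else 0) - (if κ j = κ i then 1 / ((k (κ i) : ℝ) + 1) else 0)) = _
      split_ifs <;> ring
    simp_rw [this]
    rw [Finset.sum_sub_distrib, ← Finset.mul_sum, hg]
    simp
  refine ⟨w, ?_, ?_, ?_⟩
  · intro i j
    change ⟪w i, φ (c (κ j) • ⟨f j, hf j⟩)⟫ = _
    rw [key]
    change c (κ i) * (c (κ j) * ((if j = i then (1:ℝ) else 0) - (if κ i = κ j then 1 / ((k (κ j) : ℝ) + 1) else 0))) = _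
    have hki : (0:ℝ) < k (κ i) := by exact_mod_cast hk (κ i)
    by_cases h : i = j
    · subst h
      simp only [if_true]
      rw [← mul_assoc, hc2]; field_simp; ring
    · rw [if_neg (Ne.symm h), if_neg h]
      by_cases h2 : κ i = κ j
      · rw [if_pos h2, if_pos h2, ← h2, ← mul_assoc, hc2]; field_simp; ring
      · rw [if_neg h2, if_neg h2]; ring
  · intro u u'
    obtain ⟨g, rfl⟩ := φ.surjective u
    obtain ⟨g', rfl⟩ := φ.surjective u'
    simp_rw [key]
    rw [LinearIsometryEquiv.inner_map_map, Submodule.coe_inner, PiLp.inner_apply]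
    simp only [RCLike.inner_apply, conj_trivial]
    apply Finset.sum_congr rfl
    intro i _
    have hki : (0:ℝ) < k (κ i) := by exact_mod_cast hk (κ i)
    have : ∀ a b : ℝ, c (κ i) * a * (c (κ i) * b) = c (κ i) * c (κ i) * a * b := fun a b => by ring
    rw [this, hc2]; field_simp
  · intro F
    apply ext_inner_right ℝ
    intro u
    obtain ⟨g, rfl⟩ := φ.surjective u
    rw [sum_inner, inner_zero_left]
    simp_rw [inner_smul_left, key]
    have hg := g.2
    rw [LinearMap.mem_ker] at hg
    rw [← Finset.sum_fiberwise Finset.univ κ]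
    apply Finset.sum_eq_zero
    intro X _
    have hg := congrFun hg X
    change (∑ j, if κ j = X then (g : EuclideanSpace ℝ ι) j else 0) = 0 at hg
    rw [← Finset.sum_filter] at hg
    rw [Finset.sum_congr rfl (g := fun i => (F X * c X) * (g : EuclideanSpace ℝ ι) i) (fun i hi => by simp at hi; rw [hi]; simp; ring), ← Finset.mul_sum, hg, mul_zero]
end cls

section cls2
variable {ι : Type*} [Fintype ι] (κ : ι → Fin 3) (k : Fin 3 → ℕ) 

lemma frame_one (d : ℕ) (hd : 0 < d) (hc : ∀ X, (Finset.univ.filter fun i => κ i = X).card = k X + 1) (hsum : ∑ X, k X = d)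
    (w : ι → EuclideanSpace ℝ (Fin d)) 
    (hfr : ∀ u u', ∑ i, ((k (κ i) : ℝ) / (k (κ i) + 1)) * (⟪w i, u⟫ * ⟪w i, u'⟫) = ⟪u, u'⟫) (hcs : ∀ F : Fin 3 → ℝ, ∑ i, F (κ i) • w i = 0) :
    sw (tX w) (fun i => (k (κ i) : ℝ) / (d * (k (κ i) + 1))) (tX w) = 1 := by
  have hd' : (0:ℝ) < d := by exact_mod_cast hd
  have hdd := Real.mul_self_sqrt hd'.le
  have hcs' : ∀ (F : Fin 3 → ℝ) a, ∑ i, F (κ i) * w i a = 0 := by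
    intro F a
    have h1 := congrArg (fun w : EuclideanSpace ℝ (Fin d) => w a) (hcs F)
    simpa only [WithLp.ofLp_sum, Finset.sum_apply, PiLp.smul_apply, smul_eq_mul, PiLp.zero_apply] using h1
  ext a b
  rw [sw_apply]
  rcases a with a | a <;> rcases b with b | b
  · have h1 := hfr (EuclideanSpace.single a 1) (EuclideanSpace.single b 1)
    simp only [EuclideanSpace.inner_single_right, conj_trivial, one_mul] at h1
    simp only [tX_apply, tv, Sum.elim_inl]
    have h2 : ∀ i, (k (κ i) : ℝ) / (d * (k (κ i) + 1)) * (√d * w i a) * (√d * w i b) = ((k (κ i) : ℝ) / (k (κ i) + 1)) * (w i a * w i b) := by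
      intro i
      have : (k (κ i) : ℝ) / (d * (k (κ i) + 1)) * (√d * w i a) * (√d * w i b) = (k (κ i) : ℝ) / (d * (k (κ i) + 1)) * (√d * √d) * w i a * w i b := by ring
      rw [this, hdd]; field_simp
    simp_rw [h2, h1]
    simp [Matrix.one_apply, eq_comm]
  · simp only [tX_apply, tv, Sum.elim_inl, Sum.elim_inr, mul_one]
    have := hcs' (fun X => (k X : ℝ) / (d * (k X + 1)) * √d) a
    simp only [mul_assoc] at this
    rw [this]; simp
  · simp only [tX_apply, tv, Sum.elim_inl, Sum.elim_inr, mul_one]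
    have := hcs' (fun X => (k X : ℝ) / (d * (k X + 1)) * √d) b
    simp only [mul_assoc] at this
    rw [this]; simp
  · simp only [tX_apply, tv, Sum.elim_inr, mul_one]
    rw [sum_cls κ k hc (fun X => (k X : ℝ) / (d * (k X + 1)))]
    have : ∀ X, ((k X : ℝ) + 1) * ((k X : ℝ) / (d * (k X + 1))) = (k X : ℝ) / d := fun X => by field_simp
    simp_rw [this]
    rw [← Finset.sum_div, ← Nat.cast_sum, hsum, div_self hd'.ne']
    simp

/-- test dependency -/
noncomputable def F0 (k : Fin 3 → ℕ) : Fin 3 → ℝ := ![-(1 / ((k 0 : ℝ) + 1)), 1 / ((k 1 : ℝ) + 1), 0]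
/-- test dependency -/
noncomputable def F1 (k : Fin 3 → ℕ) : Fin 3 → ℝ := ![-(1 / ((k 0 : ℝ) + 1)), 0, 1 / ((k 2 : ℝ) + 1)]

lemma det_test (hc : ∀ X, (Finset.univ.filter fun i => κ i = X).card = k X + 1) (L : Fin 3 → ℝ) (hL : ∀ X, 0 < L X) : 
    (sw (YM (F0 k ∘ κ) (F1 k ∘ κ)) (fun i => (L (κ i) / (k (κ i) + 1))⁻¹) (YM (F0 k ∘ κ) (F1 k ∘ κ))).det = (L 0 + L 1 + L 2) / (L 0 * L 1 * L 2) := by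
  have h0 := hL 0; have h1 := hL 1; have h2 := hL 2
  have e : ∀ P Q : Fin 3 → ℝ, ∑ i, (L (κ i) / (k (κ i) + 1))⁻¹ * P (κ i) * Q (κ i) = ∑ X, ((k X : ℝ) + 1) * ((L X / (k X + 1))⁻¹ * P X * Q X) := fun P Q => sum_cls κ k hc (fun X => (L X / (k X + 1))⁻¹ * P X * Q X)
  rw [Matrix.det_fin_two]
  simp only [sw_apply, YM_zero, YM_one, Function.comp, e, Fin.sum_univ_three]
  simp [F0, F1]
  field_simp
  ring

lemma drop_det (d : ℕ) (hd : 0 < d) (hk : ∀ X, 0 < k X) (hc : ∀ X, (Finset.univ.filter fun i => κ i = X).card = k X + 1) (hsum : ∑ X, k X = d)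
    (w : ι → EuclideanSpace ℝ (Fin d)) 
    (hfr : ∀ u u', ∑ i, ((k (κ i) : ℝ) / (k (κ i) + 1)) * (⟪w i, u⟫ * ⟪w i, u'⟫) = ⟪u, u'⟫) (hcs : ∀ F : Fin 3 → ℝ, ∑ i, F (κ i) • w i = 0)
    (b c : ι) (hb : κ b = 1) (hcc : κ c = 2) :
    (sw (tX w) (fun i => if i = b ∨ i = c then 0 else 1) (tX w)).det = ((d:ℝ)^d * ∏ X, hK (k X)) / (((k 1 : ℝ) + 1) * (k 2 + 1))^2 := by
  have hd' : (0:ℝ) < d := by exact_mod_cast hd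
  have hk' : ∀ X, (0:ℝ) < k X := fun X => by exact_mod_cast hk X
  have hcard : Fintype.card ι = d + 3 := by
    rw [card_cls κ k hc, Finset.sum_add_distrib, hsum]; simp
  obtain ⟨e⟩ := card_equiv hcard
  have hbc : b ≠ c := by rintro rfl; rw [hb] at hcc; exact absurd hcc (by decide)
  have s0 : ∑ i, (F0 k ∘ κ) i = 0 := by
    simp only [Function.comp]
    rw [sum_cls κ k hc (F0 k), Fin.sum_univ_three]; simp [F0]; field_simp; ring
  have s1 : ∑ i, (F1 k ∘ κ) i = 0 := by
    simp only [Function.comp]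
    rw [sum_cls κ k hc (F1 k), Fin.sum_univ_three]; simp [F1]; field_simp; ring
  have hXY : sw (tX w) 1 (YM (F0 k ∘ κ) (F1 k ∘ κ)) = 0 := sw_tX_YM s0 s1 (hcs (F0 k)) (hcs (F1 k))
  have h1 := det_drop_two e (tX w) (YM (F0 k ∘ κ) (F1 k ∘ κ)) hXY b c hbc
  have h2 := det_weighted e (tX w) (YM (F0 k ∘ κ) (F1 k ∘ κ)) hXY (fun i => (k (κ i) : ℝ) / (d * (k (κ i) + 1))) (fun i => by have := hk' (κ i); positivity)
  have h3 := det_test κ k hc (fun X => (k X : ℝ) / d) (fun X => div_pos (hk' X) hd')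
  have h4 := det_test κ k hc (fun X => (k X : ℝ) + 1) (fun X => by positivity)
  have e1 : (fun i => (((k (κ i) : ℝ) + 1) / ((k (κ i) : ℝ) + 1))⁻¹) = (1 : ι → ℝ) := by
    ext i; rw [div_self (by positivity)]; simp
  have e2 : (fun i => ((k (κ i) : ℝ) / d / ((k (κ i) : ℝ) + 1))⁻¹) = (fun i => ((k (κ i) : ℝ) / (d * (k (κ i) + 1)))⁻¹) := by
    ext i; rw [div_div]
  rw [e1] at h4
  rw [e2] at h3
  rw [frame_one κ k d hd hc hsum w hfr hcs, Matrix.det_one, one_mul, h3, prod_cls κ k hc (fun X => (k X : ℝ) / (d * (k X + 1))), h4] at h2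
  rw [h4] at h1
  simp only [YM_zero, YM_one, Function.comp, hb, hcc] at h1
  simp only [F0, F1, Matrix.cons_val] at h1
  set Q := (sw (tX w) 1 (tX w)).det
  set D := (sw (tX w) (fun i => if i = b ∨ i = c then 0 else 1) (tX w)).det
  have hsumR : (k 0 : ℝ) + k 1 + k 2 = d := by rw [← hsum, Fin.sum_univ_three]; push_cast; ring
  have hsum1 : (k 0 : ℝ) / d + k 1 / d + k 2 / d = 1 := by rw [← add_div, ← add_div, hsumR, div_self hd'.ne']
  rw [hsum1] at h2
  have hdpow : (d:ℝ)^d = (d:ℝ)^(k 0) * (d:ℝ)^(k 1) * (d:ℝ)^(k 2) := by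
    rw [← pow_add, ← pow_add]; congr 1; rw [← hsum, Fin.sum_univ_three]
  have a0 := hk' 0; have a1 := hk' 1; have a2 := hk' 2
  rw [hdpow]
  simp only [Fin.prod_univ_three, hK] at h2 ⊢
  set x0 := (k 0 : ℝ); set x1 := (k 1 : ℝ); set x2 := (k 2 : ℝ)
  simp only [div_pow, mul_pow, pow_succ] at h1 h2 ⊢
  simp only [pow_zero, one_mul] at h1 h2 ⊢
  set p0 := x0 ^ k 0; set p1 := x1 ^ k 1; set p2 := x2 ^ k 2
  set q0 := (x0+1) ^ k 0; set q1 := (x1+1) ^ k 1; set q2 := (x2+1) ^ k 2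
  set d0 := (d:ℝ) ^ k 0; set d1 := (d:ℝ) ^ k 1; set d2 := (d:ℝ) ^ k 2
  have : 0 < p0 := by positivity
  have : 0 < p1 := by positivity
  have : 0 < p2 := by positivity
  have : 0 < q0 := by positivity
  have : 0 < q1 := by positivity
  have : 0 < q2 := by positivity
  have : 0 < d0 := by positivity
  have : 0 < d1 := by positivity
  have : 0 < d2 := by positivity
  have hM : 0 < (x0 + 1 + (x1 + 1) + (x2 + 1)) / ((x0 + 1) * (x1 + 1) * (x2 + 1)) := by positivity
  set M := (x0 + 1 + (x1 + 1) + (x2 + 1)) / ((x0 + 1) * (x1 + 1) * (x2 + 1))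
  have hQ : Q = M * (q0 * (x0+1) * (q1 * (x1+1)) * (q2 * (x2+1))) * (d0*d1*d2) / (p0*p1*p2) := by
    field_simp at h2 ⊢
    linear_combination -h2
  apply mul_right_cancel₀ hM.ne'
  rw [h1, hQ]
  field_simp
  try ring
end cls2

lemma null_hyper {d : ℕ} (u : EuclideanSpace ℝ (Fin d)) (hu : u ≠ 0) : volume {z : EuclideanSpace ℝ (Fin d) | ⟪u, z⟫ = 0} = 0 := by
  have h : {z : EuclideanSpace ℝ (Fin d) | ⟪u, z⟫ = 0} = ((LinearMap.ker (innerSL ℝ u).toLinearMap : Submodule ℝ (EuclideanSpace ℝ (Fin d))) : Set (EuclideanSpace ℝ (Fin d))) := by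
    ext z; simp
  rw [h]
  apply Measure.addHaar_submodule
  intro ht
  have : u ∈ LinearMap.ker (innerSL ℝ u).toLinearMap := by rw [ht]; trivial
  simp at this
  exact hu this

section cls3
variable {ι : Type*} [Fintype ι] (κ : ι → Fin 3) (k : Fin 3 → ℕ) 

set_option linter.unusedSectionVars false in
lemma hull_half {d : ℕ} (w : ι → EuclideanSpace ℝ (Fin d)) (hk : ∀ X, 0 < k X)
    (hw : ∀ i j, ⟪w i, w j⟫ = if i = j then 1 else if κ i = κ j then -(1 / (k (κ i) : ℝ)) else 0) (S : Set ι) (b b' : ι) (hb : b ∉ S) (hbb : κ b = κ b')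
    (z : EuclideanSpace ℝ (Fin d)) (hz : z ∈ convexHull ℝ (w '' S)) : ⟪w b - w b', z⟫ ≤ 0 := by
  have h : convexHull ℝ (w '' S) ⊆ {z | ⟪w b - w b', z⟫ ≤ 0} := by
    apply convexHull_min
    · rintro _ ⟨i, hi, rfl⟩
      have hne : b ≠ i := fun h => hb (h ▸ hi)
      have hp : 0 < (1 / (k (κ b') : ℝ)) := by have := hk (κ b'); positivity
      rw [Set.mem_ofPred_eq, inner_sub_left, hw, hw, if_neg hne, hbb]
      split_ifs <;> linarith
    · exact convex_halfSpace_le (IsLinearMap.mk (fun x y => inner_add_right _ _ _) (fun c x => by rw [inner_smul_right]; rfl)) 0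
  exact h hz

lemma config_vol (d : ℕ) (hd : 0 < d) (hk : ∀ X, 0 < k X) (hc : ∀ X, (Finset.univ.filter fun i => κ i = X).card = k X + 1) (hsum : ∑ X, k X = d)
    (w : ι → EuclideanSpace ℝ (Fin d)) 
    (hw : ∀ i j, ⟪w i, w j⟫ = if i = j then 1 else if κ i = κ j then -(1 / (k (κ i) : ℝ)) else 0)
    (hfr : ∀ u u', ∑ i, ((k (κ i) : ℝ) / (k (κ i) + 1)) * (⟪w i, u⟫ * ⟪w i, u'⟫) = ⟪u, u'⟫) (hcs : ∀ F : Fin 3 → ℝ, ∑ i, F (κ i) • w i = 0) :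
    ENNReal.ofReal (√(∏ X, hK (k X)) / d.factorial) ≤ volume (convexHull ℝ (Set.range w)) := by
  have hd' : (0:ℝ) < d := by exact_mod_cast hd
  have hcard : Fintype.card ι = d + 3 := by
    rw [card_cls κ k hc, Finset.sum_add_distrib, hsum]; simp
  have hP : 0 ≤ ∏ X, hK (k X) := Finset.prod_nonneg fun X _ => (hK_pos _).le
  have hinj : ∀ i j, i ≠ j → w i - w j ≠ 0 := by
    intro i j hij h
    have h1 := hw i j
    rw [sub_eq_zero] at h
    rw [← h, hw i i, if_pos rfl, if_neg hij] at h1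
    have hp : 0 < (1 / (k (κ i) : ℝ)) := by have := hk (κ i); positivity
    split_ifs at h1 <;> linarith
  set P := (Finset.univ.filter fun i => κ i = 1) ×ˢ (Finset.univ.filter fun i => κ i = 2) with hPdef
  have hmemP : ∀ p ∈ P, κ p.1 = 1 ∧ κ p.2 = 2 := by
    intro p hp; simpa [hPdef] using hp
  let S : ι × ι → Set (EuclideanSpace ℝ (Fin d)) := fun p => convexHull ℝ (w '' {i | i ≠ p.1 ∧ i ≠ p.2})
  have hS : ∀ p, S p = convexHull ℝ (w '' {i | i ≠ p.1 ∧ i ≠ p.2}) := fun p => rfl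
  have hvol : ∀ p ∈ P, volume (S p) = ENNReal.ofReal (√(∏ X, hK (k X)) / d.factorial / (((k 1 : ℝ) + 1) * (k 2 + 1))) := by
    intro p hp
    obtain ⟨h1, h2⟩ := hmemP p hp
    have hne : p.1 ≠ p.2 := by intro h; rw [h, h2] at h1; exact absurd h1 (by decide)
    rw [hS, drop_vol hd hcard w p.1 p.2 hne]
    have := drop_det κ k d hd hk hc hsum w hfr hcs p.1 p.2 h1 h2
    congr 1
    have h3 : √((sw (tX w) (fun i => if i = p.1 ∨ i = p.2 then 0 else 1) (tX w)).det) = √d ^ d * √(∏ X, hK (k X)) / (((k 1 : ℝ) + 1) * (k 2 + 1)) := by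
      rw [this, Real.sqrt_div (by positivity), Real.sqrt_mul (by positivity), Real.sqrt_sq (by positivity)]
      congr 2
      rw [Real.sqrt_eq_rpow, Real.sqrt_eq_rpow, ← Real.rpow_natCast, ← Real.rpow_mul hd'.le, mul_comm, Real.rpow_mul hd'.le, Real.rpow_natCast]
    rw [h3]
    have : 0 < √(d:ℝ) ^ d := by positivity
    field_simp
  have hdisj : (P : Set (ι × ι)).Pairwise (fun p q => AEDisjoint volume (S p) (S q)) := by
    have aux : ∀ p q : ι × ι, ∀ b b', b ≠ b' → κ b = κ b' → (b = p.1 ∨ b = p.2) → (b' = q.1 ∨ b' = q.2) → AEDisjoint volume (S p) (S q) := by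
      intro p q b b' hne hκ hb hb'
      apply measure_mono_null _ (null_hyper (w b - w b') (hinj b b' hne))
      rintro z ⟨hz1, hz2⟩
      have h1 := hull_half κ k w hk hw {i | i ≠ p.1 ∧ i ≠ p.2} b b' (by simp; tauto) hκ z hz1
      have h2 := hull_half κ k w hk hw {i | i ≠ q.1 ∧ i ≠ q.2} b' b (by simp; tauto) hκ.symm z hz2
      rw [inner_sub_left] at h1 h2
      rw [Set.mem_ofPred_eq, inner_sub_left]
      linarith
    intro p hp q hq hpq
    have p1 := hmemP p hp
    have q1 := hmemP q hq
    by_cases h : p.1 = q.1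
    · have h2 : p.2 ≠ q.2 := fun h2 => hpq (Prod.ext h h2)
      exact aux p q p.2 q.2 h2 (by rw [p1.2, q1.2]) (Or.inr rfl) (Or.inr rfl)
    · exact aux p q p.1 q.1 h (by rw [p1.1, q1.1]) (Or.inl rfl) (Or.inl rfl)
  have hmeas : ∀ p ∈ P, NullMeasurableSet (S p) volume := by
    intro p _
    apply MeasurableSet.nullMeasurableSet
    apply IsClosed.measurableSet
    exact ((Set.toFinite (w '' {i | i ≠ p.1 ∧ i ≠ p.2})).isCompact_convexHull ℝ).isClosed
  have hle : volume (⋃ p ∈ P, S p) ≤ volume (convexHull ℝ (Set.range w)) := by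
    apply measure_mono
    apply Set.iUnion₂_subset
    intro p _
    exact convexHull_mono (Set.image_subset_range _ _)
  refine le_trans ?_ hle
  rw [measure_biUnion_finset₀ hdisj hmeas, Finset.sum_congr rfl hvol, Finset.sum_const, hPdef, Finset.card_product, hc, hc]
  rw [nsmul_eq_mul, ← ENNReal.ofReal_natCast, ← ENNReal.ofReal_mul (by positivity)]
  apply ENNReal.ofReal_le_ofReal
  push_cast
  apply le_of_eq
  field_simp

end cls3

/-- balanced triple -/
def kb (d : ℕ) : Fin 3 → ℕ := ![d/3, (d+1)/3, (d+2)/3]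

lemma partL (d : ℕ) (hd : 3 ≤ d) : ∃ W : Finset (EuclideanSpace ℝ (Fin d)),
    (W : Set (EuclideanSpace ℝ (Fin d))) ⊆ Metric.sphere 0 1 ∧ W.card = d + 3 ∧ 
    ENNReal.ofReal (√(Cbal d) / d.factorial) ≤ volume (convexHull ℝ (W : Set (EuclideanSpace ℝ (Fin d)))) := by
  let k := kb d
  let ι := (X : Fin 3) × Fin (k X + 1)
  let κ : ι → Fin 3 := Sigma.fst
  have hk : ∀ X, 0 < k X := by
    intro X; fin_cases X <;> simp [k, kb] <;> omega
  have hsum : ∑ X, k X = d := by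
    rw [Fin.sum_univ_three]; simp [k, kb]; omega
  have hc : ∀ X, (Finset.univ.filter fun i => κ i = X).card = k X + 1 := by
    intro X
    have : (Finset.univ.filter fun i : ι => κ i = X) = Finset.univ.map ⟨fun j : Fin (k X + 1) => (⟨X, j⟩ : ι), fun a b h => by simpa using h⟩ := by
      ext ⟨Y, j⟩
      simp only [Finset.mem_filter, Finset.mem_univ, true_and, Finset.mem_map, κ]
      constructor
      · rintro rfl; exact ⟨j, rfl⟩
      · rintro ⟨a, ha⟩; exact (congrArg Sigma.fst ha).symm
    rw [this, Finset.card_map]; simp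
  obtain ⟨w, hw, hfr, hcs⟩ := config_exists κ k d hk hc hsum
  have hv := config_vol κ k d (by omega) hk hc hsum w hw hfr hcs
  have hinj : Function.Injective w := by
    intro i j h
    by_contra hij
    have h1 := hw i j
    rw [← h, hw i i, if_pos rfl, if_neg hij] at h1
    have hp : 0 < (1 / (k (κ i) : ℝ)) := by have := hk (κ i); positivity
    split_ifs at h1 <;> linarith
  have hcard : Fintype.card ι = d + 3 := by
    rw [card_cls κ k hc, Finset.sum_add_distrib, hsum]; simp
  refine ⟨Finset.univ.image w, ?_, ?_, ?_⟩
  · intro z hz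
    simp at hz
    obtain ⟨i, rfl⟩ := hz
    rw [mem_sphere_zero_iff_norm]
    have := hw i i
    rw [if_pos rfl, real_inner_self_eq_norm_sq] at this
    nlinarith [norm_nonneg (w i)]
  · rw [Finset.card_image_of_injective _ hinj, Finset.card_univ, hcard]
  · rw [Finset.coe_image, Finset.coe_univ, Set.image_univ]
    convert hv using 4
    rw [Fin.prod_univ_three]; simp [k, kb, Cbal]

lemma two_det (p q r s t u : ℝ) (hp : 0 < p) (hr : 0 < r) (hA : 0 < p * r - q * q) (hs : 0 ≤ s) (hu : 0 ≤ u) (hB : 0 ≤ s * u - t * t) 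
    (hquad : ∀ a b : ℝ, 0 ≤ a^2*s + 2*a*b*t + b^2*u) :
    p * r - q * q ≤ (p+s)*(r+u) - (q+t)*(q+t) ∧ ((p+s)*(r+u) - (q+t)*(q+t) ≤ p * r - q * q → s = 0 ∧ u = 0) := by
  have h1 : p * (p*u + r*s - 2*q*t) = (p*r-q*q)*s + (q^2*s + 2*q*(-p)*t + (-p)^2*u) := by ring
  have h2 : r * (p*u + r*s - 2*q*t) = (p*r-q*q)*u + ((-r)^2*s + 2*(-r)*q*t + q^2*u) := by ring
  have k1 := hquad q (-p)
  have k2 := hquad (-r) q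
  have k3 := mul_nonneg hA.le hs
  have k4 := mul_nonneg hA.le hu
  have h3 : 0 ≤ p*u + r*s - 2*q*t := by
    by_contra h
    push Not at h
    nlinarith [mul_pos_of_neg_of_neg h (neg_lt_zero.2 hp)]
  refine ⟨by nlinarith, fun h => ?_⟩
  have h4 : p*u + r*s - 2*q*t = 0 := by nlinarith
  rw [h4] at h1 h2
  constructor
  · have : (p*r-q*q)*s = 0 := by nlinarith
    exact (mul_eq_zero.1 this).resolve_left hA.ne'
  · have : (p*r-q*q)*u = 0 := by nlinarith
    exact (mul_eq_zero.1 this).resolve_left hA.ne'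

lemma two_psd (s t v : ℝ) (hs0 : 0 ≤ s) (hv0 : 0 ≤ v) (hquad : ∀ a b : ℝ, 0 ≤ a^2*s + 2*a*b*t + b^2*v) : 0 ≤ s * v - t * t := by
  rcases hs0.eq_or_lt with h0 | h0
  · have a2 := hquad (-(v+1)) t
    subst h0
    have h1 : (v+2) * t^2 ≤ 0 := by linarith [show (-(v+1))^2*0 + 2*(-(v+1))*t*t+t^2*v = -((v+2)*t^2) by ring]
    have h2 : t^2 ≤ 0 := by
      by_contra h
      push Not at h
      linarith [mul_pos (show 0 < v+2 by linarith) h]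
    linarith [show (0:ℝ) * v - t * t = -t^2 by ring]
  · have := hquad (-t) s
    have h2 : s * (s * v - t * t) = (-t)^2*s + 2*(-t)*s*t + s^2*v := by ring
    rw [← h2] at this
    exact nonneg_of_mul_nonneg_right this h0

/-- class sum -/
noncomputable def cs {ι : Type*} [Fintype ι] (κ : ι → Fin 3) (x : ι → ℝ) (X : Fin 3) : ℝ := ∑ i, if κ i = X then x i else 0

section clsT
variable {ι : Type*} [Fintype ι] (κ : ι → Fin 3) (k : Fin 3 → ℕ)

lemma cs_mul (x : ι → ℝ) (F : Fin 3 → ℝ) : ∑ i, F (κ i) * x i = ∑ X, F X * cs κ x X := by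
  simp only [cs, Finset.mul_sum]
  rw [Finset.sum_comm]
  apply Finset.sum_congr rfl
  intro i _
  simp

lemma cs_total (x : ι → ℝ) : ∑ i, x i = cs κ x 0 + cs κ x 1 + cs κ x 2 := by
  have := cs_mul κ x (fun _ => 1)
  simpa [Fin.sum_univ_three] using this

/-- centred -/
noncomputable def ctr (x : ι → ℝ) (i : ι) : ℝ := x i - cs κ x (κ i) / (k (κ i) + 1)

lemma cs_ctr (hc : ∀ X, (Finset.univ.filter fun i => κ i = X).card = k X + 1) (x : ι → ℝ) (X : Fin 3) : cs κ (ctr κ k x) X = 0 := by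
  have : ∀ i, (if κ i = X then ctr κ k x i else 0) = (if κ i = X then x i else 0) - (if κ i = X then cs κ x X / (k X + 1) else 0) := by
    intro i; split_ifs with h
    · rw [ctr, h]
    · simp
  unfold cs at this ⊢
  simp_rw [this]
  rw [Finset.sum_sub_distrib, sum_if_cls κ k hc]
  field_simp
  simp

lemma split_sum (hc : ∀ X, (Finset.univ.filter fun i => κ i = X).card = k X + 1) (x y : ι → ℝ) (L : Fin 3 → ℝ) :
    ∑ i, L (κ i) * x i * y i = ∑ X, L X * (cs κ x X * cs κ y X / (k X + 1)) + ∑ i, L (κ i) * ctr κ k x i * ctr κ k y i := by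
  have e : ∀ i, L (κ i) * x i * y i = L (κ i) * (cs κ x (κ i) * cs κ y (κ i) / (k (κ i) + 1)^2) + (L (κ i) * (cs κ x (κ i) / (k (κ i) + 1))) * ctr κ k y i
      + (L (κ i) * (cs κ y (κ i) / (k (κ i) + 1))) * ctr κ k x i + L (κ i) * ctr κ k x i * ctr κ k y i := by
    intro i; unfold ctr; field_simp; ring
  simp_rw [e]
  rw [Finset.sum_add_distrib, Finset.sum_add_distrib, Finset.sum_add_distrib, cs_mul κ (ctr κ k y) (fun X => L X * (cs κ x X / (k X + 1))), 
    cs_mul κ (ctr κ k x) (fun X => L X * (cs κ y X / (k X + 1))), sum_cls κ k hc (fun X => L X * (cs κ x X * cs κ y X / (k X + 1)^2))]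
  simp only [cs_ctr κ k hc, mul_zero, Finset.sum_const_zero, add_zero]
  congr 1
  apply Finset.sum_congr rfl
  intro X _
  field_simp

set_option maxHeartbeats 1000000 in
lemma T_main {d : ℕ} (hc : ∀ X, (Finset.univ.filter fun i => κ i = X).card = k X + 1) (hsum : ∑ X, k X = d)
    (u : ι → EuclideanSpace ℝ (Fin d)) (hu : ∀ i, ‖u i‖ = 1) (x y : ι → ℝ) (h : KP u x y) (τ : ℝ) (hτ : τ = cs κ x 2 * cs κ y 1 - cs κ y 2 * cs κ x 1) (hτ0 : τ ≠ 0)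
    (hQ : 0 < (sw (tX u) 1 (tX u)).det)
    (L : Fin 3 → ℝ) (hL : ∀ X, 0 < L X) (hL1 : ∑ X, L X = 1) :
    (sw (tX u) 1 (tX u)).det * τ^2 * ∏ X, (L X / (k X + 1))^(k X + 1) ≤ ∏ X, L X ∧
    (∏ X, L X ≤ (sw (tX u) 1 (tX u)).det * τ^2 * ∏ X, (L X / (k X + 1))^(k X + 1) → 
      sw (tX u) (fun i => L (κ i) / (k (κ i) + 1)) (tX u) = 1 ∧ (∀ i, x i = cs κ x (κ i) / (k (κ i) + 1)) ∧ (∀ i, y i = cs κ y (κ i) / (k (κ i) + 1))) := by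
  have hcard : Fintype.card ι = d + 3 := by
    rw [card_cls κ k hc, Finset.sum_add_distrib, hsum]; simp
  obtain ⟨e⟩ := card_equiv hcard
  set D := (sw (tX u) 1 (tX u)).det
  have hlpos : ∀ i, 0 < L (κ i) / ((k (κ i) : ℝ) + 1) := fun i => div_pos (hL _) (by positivity)
  have hw := det_weighted e (tX u) (YM x y) (sw_tX_YM h.sx h.sy h.vx h.vy) (fun i => L (κ i) / (k (κ i) + 1)) (fun i => (hlpos i).ne')
  rw [sw_YM_YM h, Matrix.det_one, mul_one, prod_cls κ k hc (fun X => L X / (k X + 1)), Matrix.det_fin_two] at hw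
  simp only [sw_apply, YM_zero, YM_one] at hw
  have hl1 : ∑ i, L (κ i) / ((k (κ i) : ℝ) + 1) = 1 := by
    rw [sum_cls κ k hc (fun X => L X / (k X + 1)), ← hL1]
    exact Finset.sum_congr rfl fun X _ => by field_simp
  have hle := tX_det_le u hu (fun i => L (κ i) / (k (κ i) + 1)) hl1 (fun i => (hlpos i).le)
  set M : Fin 3 → ℝ := fun X => (L X / (k X + 1))⁻¹ with hM
  have hMpos : ∀ X, 0 < M X := fun X => inv_pos.2 (div_pos (hL _) (by positivity))
  have ss := split_sum κ k hc
  have e1 : ∀ a b : ι → ℝ, ∑ i, (L (κ i) / ((k (κ i) : ℝ) + 1))⁻¹ * a i * b i = ∑ X, (cs κ a X * cs κ b X / L X) + ∑ i, M (κ i) * ctr κ k a i * ctr κ k b i := by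
    intro a b
    have := ss a b M
    rw [hM] at this
    simp only at this
    rw [this]
    congr 1
    apply Finset.sum_congr rfl
    intro X _
    have := (hL X).ne'
    field_simp
  rw [e1 x x, e1 y y, e1 x y, e1 y x] at hw
  have comm1 : ∑ X, (cs κ y X * cs κ x X / L X) = ∑ X, (cs κ x X * cs κ y X / L X) := Finset.sum_congr rfl fun X _ => by ring
  have comm2 : ∑ i, M (κ i) * ctr κ k y i * ctr κ k x i = ∑ i, M (κ i) * ctr κ k x i * ctr κ k y i := Finset.sum_congr rfl fun X _ => by ring
  rw [comm1, comm2] at hw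
  set p := ∑ X, (cs κ x X * cs κ x X / L X) with hp
  set q := ∑ X, (cs κ x X * cs κ y X / L X) with hq
  set r := ∑ X, (cs κ y X * cs κ y X / L X) with hr
  set s := ∑ i, M (κ i) * ctr κ k x i * ctr κ k x i with hs
  set t := ∑ i, M (κ i) * ctr κ k x i * ctr κ k y i with ht
  set v := ∑ i, M (κ i) * ctr κ k y i * ctr κ k y i with hv
  have hx0 : cs κ x 0 = - cs κ x 1 - cs κ x 2 := by have := cs_total κ x; rw [h.sx] at this; linarith
  have hy0 : cs κ y 0 = - cs κ y 1 - cs κ y 2 := by have := cs_total κ y; rw [h.sy] at this; linarith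
  have L0 := hL 0; have L1 := hL 1; have L2 := hL 2
  have hLs : L 0 + L 1 + L 2 = 1 := by rw [← hL1, Fin.sum_univ_three]
  have hdetA : p * r - q * q = τ^2 / ∏ X, L X := by
    rw [hp, hq, hr, hτ]
    simp only [Fin.sum_univ_three, Fin.prod_univ_three, hx0, hy0]
    have : (cs κ x 2 * cs κ y 1 - cs κ y 2 * cs κ x 1)^2 / (L 0 * L 1 * L 2) = (cs κ x 2 * cs κ y 1 - cs κ y 2 * cs κ x 1)^2 * (L 0 + L 1 + L 2) / (L 0 * L 1 * L 2) := by rw [hLs, mul_one]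
    rw [this]
    field_simp
    ring
  have hLp : 0 < ∏ X, L X := Finset.prod_pos fun X _ => hL X
  have hApos : 0 < p * r - q * q := by rw [hdetA]; positivity
  have hp0 : 0 ≤ p := Finset.sum_nonneg fun X _ => div_nonneg (mul_self_nonneg _) (hL X).le
  have hr0 : 0 ≤ r := Finset.sum_nonneg fun X _ => div_nonneg (mul_self_nonneg _) (hL X).le
  have hpp : 0 < p := by
    rcases hp0.eq_or_lt with h0 | h0
    · rw [← h0] at hApos; nlinarith [mul_self_nonneg q]
    · exact h0
  have hrp : 0 < r := by
    rcases hr0.eq_or_lt with h0 | h0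
    · rw [← h0] at hApos; nlinarith [mul_self_nonneg q]
    · exact h0
  have hs0 : 0 ≤ s := Finset.sum_nonneg fun i _ => by rw [mul_assoc]; exact mul_nonneg (hMpos _).le (mul_self_nonneg _)
  have hv0 : 0 ≤ v := Finset.sum_nonneg fun i _ => by rw [mul_assoc]; exact mul_nonneg (hMpos _).le (mul_self_nonneg _)
  have hquad : ∀ a b : ℝ, 0 ≤ a^2*s + 2*a*b*t + b^2*v := by
    intro a b
    have : a^2*s + 2*a*b*t + b^2*v = ∑ i, M (κ i) * (a * ctr κ k x i + b * ctr κ k y i)^2 := by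
      rw [hs, ht, hv, Finset.mul_sum, Finset.mul_sum, Finset.mul_sum, ← Finset.sum_add_distrib, ← Finset.sum_add_distrib]
      exact Finset.sum_congr rfl fun i _ => by ring
    rw [this]
    exact Finset.sum_nonneg fun i _ => mul_nonneg (hMpos _).le (sq_nonneg _)
  have hB : 0 ≤ s * v - t * t := two_psd s t v hs0 hv0 hquad
  obtain ⟨td1, td2⟩ := two_det p q r s t v hpp hrp hApos hs0 hv0 hB hquad
  set Pl := ∏ X, (L X / ((k X : ℝ) + 1))^(k X + 1) with hPl
  have hPlpos : 0 < Pl := Finset.prod_pos fun X _ => pow_pos (div_pos (hL _) (by positivity)) _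
  have hDP : 0 < Pl * D := mul_pos hPlpos hQ
  have hτA : τ^2 = (p * r - q * q) * ∏ X, L X := by rw [hdetA]; field_simp
  have c1 : Pl * D * (p * r - q * q) ≤ 1 := by
    calc Pl * D * (p * r - q * q) ≤ Pl * D * ((p+s)*(r+v) - (q+t)*(q+t)) := by gcongr
      _ ≤ 1 := by rw [← hw]; exact hle.1
  refine ⟨?_, fun hge => ?_⟩
  · calc D * τ^2 * Pl = (Pl * D * (p * r - q * q)) * ∏ X, L X := by rw [hτA]; ring
      _ ≤ 1 * ∏ X, L X := by gcongr
      _ = _ := one_mul _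
  · have c2 : 1 ≤ Pl * D * (p * r - q * q) := by
      have : 1 * ∏ X, L X ≤ (Pl * D * (p * r - q * q)) * ∏ X, L X := by
        calc 1 * ∏ X, L X ≤ D * τ^2 * Pl := by rw [one_mul]; exact hge
          _ = _ := by rw [hτA]; ring
      exact le_of_mul_le_mul_right this hLp
    have c3 : (p+s)*(r+v) - (q+t)*(q+t) ≤ p * r - q * q := by
      have : Pl * D * ((p+s)*(r+v) - (q+t)*(q+t)) ≤ Pl * D * (p * r - q * q) := by
        rw [← hw]; exact hle.1.trans c2
      exact le_of_mul_le_mul_left this hDP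
    obtain ⟨z1, z2⟩ := td2 c3
    have aux : ∀ a : ι → ℝ, ∑ i, M (κ i) * ctr κ k a i * ctr κ k a i = 0 → ∀ i, a i = cs κ a (κ i) / (k (κ i) + 1) := by
      intro a ha i
      rw [Finset.sum_eq_zero_iff_of_nonneg (fun i _ => by rw [mul_assoc]; exact mul_nonneg (hMpos _).le (mul_self_nonneg _))] at ha
      have := ha i (Finset.mem_univ _)
      rw [mul_assoc] at this
      have := (mul_eq_zero.1 this).resolve_left (hMpos _).ne'
      have := mul_self_eq_zero.1 this
      unfold ctr at this
      linarith
    refine ⟨hle.2 (le_antisymm hle.1 ?_), aux x z1, aux y z2⟩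
    rw [hw]
    calc 1 ≤ Pl * D * (p * r - q * q) := c2
      _ ≤ _ := by gcongr
end clsT

lemma hK_step (a b c : ℕ) (h : b + 2 ≤ a) : hK a * hK b * hK c < hK (a - 1) * hK (b + 1) * hK c :=
  mul_lt_mul_of_pos_right (hK_smooth a b h) (hK_pos c)

lemma sq_step (a b c : ℕ) (h : b + 2 ≤ a) : (a-1)^2 + (b+1)^2 + c^2 < a^2+b^2+c^2 := by
  obtain ⟨e, rfl⟩ : ∃ e, a = e + 1 := ⟨a - 1, by omega⟩
  simp only [Nat.add_sub_cancel]
  nlinarith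

lemma hK_bal (d a b c : ℕ) (h : a + b + c = d) (h1 : a ≤ b + 1) (h2 : b ≤ a + 1) (h3 : a ≤ c + 1) (h4 : c ≤ a + 1) (h5 : b ≤ c + 1) (h6 : c ≤ b + 1) :
    hK a * hK b * hK c = Cbal d := by
  have : (a = d/3 ∧ b = (d+1)/3 ∧ c = (d+2)/3) ∨ (a = d/3 ∧ c = (d+1)/3 ∧ b = (d+2)/3) ∨ (b = d/3 ∧ a = (d+1)/3 ∧ c = (d+2)/3)
    ∨ (b = d/3 ∧ c = (d+1)/3 ∧ a = (d+2)/3) ∨ (c = d/3 ∧ a = (d+1)/3 ∧ b = (d+2)/3) ∨ (c = d/3 ∧ b = (d+1)/3 ∧ a = (d+2)/3) := by omega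
  unfold Cbal
  rcases this with ⟨e1,e2,e3⟩ | ⟨e1,e2,e3⟩ | ⟨e1,e2,e3⟩ | ⟨e1,e2,e3⟩ | ⟨e1,e2,e3⟩ | ⟨e1,e2,e3⟩ <;> rw [← e1, ← e2, ← e3] <;> ring

lemma hK_le (d : ℕ) : ∀ (n a b c : ℕ), a^2+b^2+c^2 = n → a + b + c = d → hK a * hK b * hK c ≤ Cbal d := by
  intro n
  induction n using Nat.strong_induction_on with
  | _ n ih =>
    have key : ∀ a b c, a^2+b^2+c^2 = n → a + b + c = d → b + 2 ≤ a → hK a * hK b * hK c ≤ Cbal d := by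
      intro a b c hn hs hab
      exact (hK_step a b c hab).le.trans (ih _ (hn ▸ sq_step a b c hab) _ _ _ rfl (by omega))
    intro a b c hn hs
    by_cases h1 : b + 2 ≤ a
    · exact key a b c hn hs h1
    by_cases h2 : a + 2 ≤ b
    · have := key b a c (by omega) (by omega) h2; linarith
    by_cases h3 : c + 2 ≤ a
    · have := key a c b (by omega) (by omega) h3; linarith
    by_cases h4 : a + 2 ≤ c
    · have := key c a b (by omega) (by omega) h4; linarith
    by_cases h5 : c + 2 ≤ b
    · have := key b c a (by omega) (by omega) h5; linarith
    by_cases h6 : b + 2 ≤ c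
    · have := key c b a (by omega) (by omega) h6; linarith
    exact (hK_bal d a b c hs (by omega) (by omega) (by omega) (by omega) (by omega) (by omega)).le

lemma hK_near (d a b c : ℕ) (h : a + b + c = d) (hC : Cbal d ≤ hK a * hK b * hK c) : a ≤ b + 1 := by
  by_contra hh
  have := hK_step a b c (by omega)
  have := hK_le d _ (a-1) (b+1) c rfl (by omega)
  linarith

lemma hK_conc (d a b c : ℕ) (hd : 3 ≤ d) (h : a + b + c = d) (hC : Cbal d ≤ hK a * hK b * hK c) :
    hK a * hK b * hK c = Cbal d ∧ 0 < a ∧ 0 < b ∧ 0 < c ∧ (a = d/3 ∨ a = (d+2)/3) ∧ (b = d/3 ∨ b = (d+2)/3) ∧ (c = d/3 ∨ c = (d+2)/3) := by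
  have h1 := hK_near d a b c h hC
  have h2 := hK_near d b a c (by omega) (by linarith)
  have h3 := hK_near d a c b (by omega) (by linarith)
  have h4 := hK_near d c a b (by omega) (by linarith)
  have h5 := hK_near d b c a (by omega) (by linarith)
  have h6 := hK_near d c b a (by omega) (by linarith)
  refine ⟨hK_bal d a b c h h1 h2 h3 h4 h5 h6, ?_⟩
  omega

/-- rpow form -/
lemma sqrt_hK (k : ℕ) (hk : 0 < k) : √(hK k) = ((k : ℝ) + 1) ^ (((k : ℝ) + 1) / 2) * (k : ℝ) ^ (-(k : ℝ) / 2) := by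
  have hk' : (0:ℝ) < k := by exact_mod_cast hk
  have h1 : (0:ℝ) < k + 1 := by positivity
  rw [Real.sqrt_eq_iff_mul_self_eq (hK_pos k).le (by positivity)]
  rw [mul_mul_mul_comm, ← Real.rpow_add h1, ← Real.rpow_add hk']
  have e1 : ((k:ℝ)+1)/2 + ((k:ℝ)+1)/2 = ((k+1 : ℕ) : ℝ) := by push_cast; ring
  have e2 : -(k:ℝ)/2 + -(k:ℝ)/2 = -(k:ℝ) := by ring
  rw [e1, e2, Real.rpow_natCast, Real.rpow_neg hk'.le, Real.rpow_natCast]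
  rfl

/-- the limit argument -/
lemma lim_bound (d : ℕ) (hd : 0 < d) (k : Fin 3 → ℕ) (hsum : ∑ X, k X = d) (A : ℝ) (h : ∀ L : Fin 3 → ℝ, (∀ X, 0 < L X) → ∑ X, L X = 1 → A * ∏ X, (L X / (k X + 1))^(k X + 1) ≤ ∏ X, L X) :
    A ≤ (d:ℝ)^d * ∏ X, hK (k X) := by
  have hd' : (0:ℝ) < d := by exact_mod_cast hd
  have h2 : ∀ L : Fin 3 → ℝ, (∀ X, 0 < L X) → ∑ X, L X = 1 → A * ∏ X, (L X) ^ (k X) ≤ ∏ X, ((k X : ℝ) + 1)^(k X + 1) := by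
    intro L hL hL1
    have := h L hL hL1
    have hp : 0 < ∏ X, L X := Finset.prod_pos fun X _ => hL X
    have e : ∏ X, (L X / ((k X:ℝ) + 1))^(k X + 1) = (∏ X, (L X) ^ (k X)) * (∏ X, L X) / ∏ X, ((k X : ℝ) + 1)^(k X + 1) := by
      rw [← Finset.prod_mul_distrib, ← Finset.prod_div_distrib]
      exact Finset.prod_congr rfl fun X _ => by rw [div_pow, pow_succ (L X)]
    have hq : 0 < ∏ X, ((k X : ℝ) + 1)^(k X + 1) := Finset.prod_pos fun X _ => by positivity
    rw [e, ← mul_div_assoc, div_le_iff₀ hq, ← mul_assoc, mul_comm (∏ X, L X)] at this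
    exact le_of_mul_le_mul_right this hp
  let Lf : ℝ → Fin 3 → ℝ := fun η X => (1 - η) * ((k X : ℝ) / d) + η / 3
  have hs' : ∑ X, (k X : ℝ) = d := by exact_mod_cast hsum
  have h3 : A * ∏ X, ((k X : ℝ) / d) ^ (k X) ≤ ∏ X, ((k X : ℝ) + 1)^(k X + 1) := by
    have hc : Continuous fun η => A * ∏ X, (Lf η X) ^ (k X) := by
      simp only [Lf]; fun_prop
    have ht : Filter.Tendsto (fun η => A * ∏ X, (Lf η X) ^ (k X)) (nhdsWithin 0 (Set.Ioi 0)) (nhds (A * ∏ X, (Lf 0 X) ^ (k X))) :=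
      (hc.tendsto 0).mono_left nhdsWithin_le_nhds
    have e0 : A * ∏ X, (Lf 0 X) ^ (k X) = A * ∏ X, ((k X : ℝ) / d) ^ (k X) := by simp [Lf]
    rw [e0] at ht
    refine le_of_tendsto ht ?_
    filter_upwards [Ioo_mem_nhdsGT (show (0:ℝ) < 1 by norm_num)] with η hη
    refine h2 _ (fun X => ?_) ?_
    · have : 0 ≤ (1 - η) * ((k X : ℝ) / d) := mul_nonneg (by linarith [hη.2]) (by positivity)
      simp only [Lf]; linarith [hη.1]
    · simp only [Lf]
      rw [Finset.sum_add_distrib, ← Finset.mul_sum, ← Finset.sum_div, hs', div_self hd'.ne']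
      simp; ring
  have hpow : ∏ X, (d:ℝ) ^ (k X) = (d:ℝ)^d := by rw [Finset.prod_pow_eq_pow_sum, hsum]
  have hkk : ∀ X, (0:ℝ) < (k X : ℝ) ^ (k X) := by
    intro X
    rcases Nat.eq_zero_or_pos (k X) with h | h
    · rw [h]; simp
    · positivity
  have e3 : ∏ X, ((k X : ℝ) / d) ^ (k X) = (∏ X, (k X : ℝ) ^ (k X)) / (d:ℝ)^d := by
    rw [← hpow, ← Finset.prod_div_distrib]
    exact Finset.prod_congr rfl fun X _ => by rw [div_pow]
  have hP : 0 < ∏ X, (k X : ℝ) ^ (k X) := Finset.prod_pos fun X _ => hkk X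
  have e4 : ∏ X, hK (k X) = (∏ X, ((k X : ℝ) + 1)^(k X + 1)) / ∏ X, (k X : ℝ) ^ (k X) := by
    rw [← Finset.prod_div_distrib]; rfl
  rw [e3, ← mul_div_assoc, div_le_iff₀ (by positivity)] at h3
  rw [e4, ← mul_div_assoc, le_div_iff₀ hP]
  linarith

section clsF
variable {ι : Type*} [Fintype ι] (κ : ι → Fin 3) (k : Fin 3 → ℕ)

lemma three_zero (L0 L1 L2 X0 X1 X2 Y0 Y1 Y2 m0 m1 m2 : ℝ) (hX : X0 + X1 + X2 = 0) (hY : Y0 + Y1 + Y2 = 0) (hL : L0 + L1 + L2 = 1)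
    (hτ : X2 * Y1 - Y2 * X1 ≠ 0) (h1 : X0 * m0 + X1 * m1 + X2 * m2 = 0) (h2 : Y0 * m0 + Y1 * m1 + Y2 * m2 = 0)
    (h3 : L0 * m0 + L1 * m1 + L2 * m2 = 0) : m0 = 0 ∧ m1 = 0 ∧ m2 = 0 := by
  have eX : X0 = - X1 - X2 := by linarith
  have eY : Y0 = - Y1 - Y2 := by linarith
  subst eX eY
  have a1 : (X2 * Y1 - Y2 * X1) * (m1 - m0) = 0 := by linear_combination X2 * h2 - Y2 * h1
  have a2 : (X2 * Y1 - Y2 * X1) * (m2 - m0) = 0 := by linear_combination Y1 * h1 - X1 * h2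
  have b1 := (mul_eq_zero.1 a1).resolve_left hτ
  have b2 := (mul_eq_zero.1 a2).resolve_left hτ
  have c1 : m1 = m0 := by linarith
  have c2 : m2 = m0 := by linarith
  rw [c1, c2] at h3 ⊢
  have : m0 = 0 := by linear_combination h3 - m0 * hL
  exact ⟨this, this, this⟩

lemma cls_zero {d : ℕ} (hd : 0 < d) (hsum : ∑ X, k X = d)
    (u : ι → EuclideanSpace ℝ (Fin d)) (x y : ι → ℝ) (h : KP u x y)
    (hτ0 : cs κ x 2 * cs κ y 1 - cs κ y 2 * cs κ x 1 ≠ 0)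
    (hQ1 : sw (tX u) (fun i => (k (κ i) : ℝ) / d / (k (κ i) + 1)) (tX u) = 1)
    (hx : ∀ i, x i = cs κ x (κ i) / (k (κ i) + 1)) (hy : ∀ i, y i = cs κ y (κ i) / (k (κ i) + 1)) (a : Fin d) (X : Fin 3) :
    cs κ (fun i => u i a) X = 0 := by
  have hd' : (0:ℝ) < d := by exact_mod_cast hd
  have hsd : √(d:ℝ) ≠ 0 := (Real.sqrt_pos.2 hd').ne'
  set S := cs κ (fun i => u i a) with hS
  have aux : ∀ z : ι → ℝ, ∑ i, z i • u i = 0 → (∀ i, z i = cs κ z (κ i) / (k (κ i) + 1)) → 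
      cs κ z 0 * (S 0 / (k 0 + 1)) + cs κ z 1 * (S 1 / (k 1 + 1)) + cs κ z 2 * (S 2 / (k 2 + 1)) = 0 := by
    intro z hz hz2
    have h1 : ∑ i, z i * u i a = 0 := by
      have := congrArg (fun w : EuclideanSpace ℝ (Fin d) => w a) hz
      simpa using this
    have h2 := cs_mul κ (fun i => u i a) (fun X => cs κ z X / (k X + 1))
    have h3 : ∑ i, cs κ z (κ i) / ((k (κ i) : ℝ) + 1) * u i a = 0 := by
      rw [← h1]; exact Finset.sum_congr rfl fun i _ => by rw [← hz2 i]
    simp only at h2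
    rw [h3, Fin.sum_univ_three] at h2
    rw [← hS] at h2
    rw [h2]; ring
  have a1 := aux x h.vx hx
  have a2 := aux y h.vy hy
  have a3 : (k 0 : ℝ) / d * (S 0 / (k 0 + 1)) + k 1 / d * (S 1 / (k 1 + 1)) + k 2 / d * (S 2 / (k 2 + 1)) = 0 := by
    have h1 := congrFun (congrFun hQ1 (Sum.inl a)) (Sum.inr ())
    rw [sw_apply] at h1
    simp only [tX_apply, tv, Sum.elim_inl, Sum.elim_inr, mul_one] at h1
    rw [Matrix.one_apply_ne (by simp)] at h1
    have h2 := cs_mul κ (fun i => u i a) (fun X => (k X : ℝ) / d / (k X + 1))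
    have h3 : √(d:ℝ) * ∑ i, (k (κ i) : ℝ) / d / ((k (κ i) : ℝ) + 1) * u i a = 0 := by
      rw [← h1, Finset.mul_sum]; exact Finset.sum_congr rfl fun i _ => by ring
    have h4 := (mul_eq_zero.1 h3).resolve_left hsd
    simp only at h2
    rw [h4, Fin.sum_univ_three, ← hS] at h2
    rw [h2]; ring
  have hs' : (k 0 : ℝ) + k 1 + k 2 = d := by rw [Fin.sum_univ_three] at hsum; exact_mod_cast hsum
  obtain ⟨r0, r1, r2⟩ := three_zero _ _ _ _ _ _ _ _ _ _ _ _ (by rw [← cs_total, h.sx]) (by rw [← cs_total, h.sy])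
    (by rw [← add_div, ← add_div, hs', div_self hd'.ne']) hτ0 a1 a2 a3
  have fin : ∀ X, S X / (k X + 1) = 0 → S X = 0 := fun X h => (div_eq_zero_iff.1 h).resolve_right (by positivity)
  fin_cases X
  · exact fin _ r0
  · exact fin _ r1
  · exact fin _ r2

lemma gram_of {d : ℕ} (hd : 0 < d) (hk : ∀ X, 0 < k X) (hc : ∀ X, (Finset.univ.filter fun i => κ i = X).card = k X + 1) (hsum : ∑ X, k X = d)
    (u : ι → EuclideanSpace ℝ (Fin d)) 
    (hQ1 : sw (tX u) (fun i => (k (κ i) : ℝ) / d / (k (κ i) + 1)) (tX u) = 1)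
    (hcl : ∀ (a : Fin d) (X : Fin 3), cs κ (fun i => u i a) X = 0) (i j : ι) (hij : i ≠ j) : 
    ⟪u i, u j⟫ = if κ i = κ j then -(1 / (k (κ i) : ℝ)) else 0 := by
  have hd' : (0:ℝ) < d := by exact_mod_cast hd
  let s : Fin 3 → ℝ := fun X => √((k X : ℝ) / (k X + 1))
  have hs0 : ∀ X, 0 < s X := fun X => Real.sqrt_pos.2 (div_pos (by exact_mod_cast hk X) (by positivity))
  have hss : ∀ X, s X * s X = (k X : ℝ) / (k X + 1) := fun X => Real.mul_self_sqrt (by positivity)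
  let r : Fin 3 → ℝ := fun X => 1 / √((k X : ℝ) + 1)
  have hrr : ∀ X, r X * r X = 1 / ((k X : ℝ) + 1) := fun X => by
    simp only [r]; rw [div_mul_div_comm, Real.mul_self_sqrt (by positivity), one_mul]
  let Z : Matrix ι (Fin d ⊕ Fin 3) ℝ := Matrix.of fun i => Sum.elim (fun a => s (κ i) * u i a) (fun X => if κ i = X then r X else 0)
  have hcard : Fintype.card ι = Fintype.card (Fin d ⊕ Fin 3) := by
    rw [card_cls κ k hc, Finset.sum_add_distrib, hsum]; simp
  have hll : ∀ a b, ∑ i, s (κ i) * u i a * (s (κ i) * u i b) = (1 : Matrix (Fin d) (Fin d) ℝ) a b := by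
    intro a b
    have h1 := congrFun (congrFun hQ1 (Sum.inl a)) (Sum.inl b)
    rw [sw_apply] at h1
    simp only [tX_apply, tv, Sum.elim_inl] at h1
    have h2 : (1 : Matrix (Fin d ⊕ Unit) (Fin d ⊕ Unit) ℝ) (Sum.inl a) (Sum.inl b) = (1 : Matrix (Fin d) (Fin d) ℝ) a b := by
      simp [Matrix.one_apply]
    rw [← h2, ← h1]
    refine Finset.sum_congr rfl fun i _ => ?_
    have h3 : √(d:ℝ) * √(d:ℝ) = d := Real.mul_self_sqrt hd'.le
    calc s (κ i) * u i a * (s (κ i) * u i b) = (s (κ i) * s (κ i)) * (u i a * u i b) := by ring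
      _ = (k (κ i) : ℝ) / d / (k (κ i) + 1) * (√(d:ℝ) * √(d:ℝ)) * (u i a * u i b) := by rw [hss, h3]; field_simp
      _ = _ := by ring
  have hlr : ∀ a X, ∑ i, s (κ i) * u i a * (if κ i = X then r X else 0) = 0 := by
    intro a X
    have : s X * r X * cs κ (fun i => u i a) X = 0 := by rw [hcl, mul_zero]
    refine Eq.trans ?_ this
    rw [cs, Finset.mul_sum]
    refine Finset.sum_congr rfl fun i _ => ?_
    split_ifs with h
    · rw [h]; ring
    · simp
  have hZ : Z.transpose * Z = 1 := by
    ext p q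
    rw [Matrix.mul_apply]
    simp only [Matrix.transpose_apply, Z, Matrix.of_apply]
    rcases p with a | X <;> rcases q with b | Y <;> simp only [Sum.elim_inl, Sum.elim_inr]
    · rw [hll]; simp [Matrix.one_apply]
    · rw [hlr]; simp
    · rw [Matrix.one_apply_ne (by simp)]; refine Eq.trans ?_ (hlr b X); exact Finset.sum_congr rfl fun i _ => by ring
    · by_cases hXY : X = Y
      · subst hXY
        rw [Matrix.one_apply_eq]
        have : ∀ i, (if κ i = X then r X else 0) * (if κ i = X then r X else 0) = if κ i = X then r X * r X else 0 := by
          intro i; split_ifs <;> simp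
        simp_rw [this]
        rw [sum_if_cls κ k hc, hrr]
        field_simp
      · rw [Matrix.one_apply_ne (by simpa using hXY)]
        apply Finset.sum_eq_zero
        intro i _
        split_ifs with h1 h2 <;> simp
        exact absurd (h1.symm.trans h2) hXY
  have hZ2 : Z * Z.transpose = 1 := (Matrix.mul_eq_one_comm_of_equiv (Fintype.equivOfCardEq hcard)).2 hZ
  have h1 := congrFun (congrFun hZ2 i) j
  rw [Matrix.mul_apply, Matrix.one_apply_ne hij, Fintype.sum_sum_type] at h1
  simp only [Matrix.transpose_apply, Z, Matrix.of_apply, Sum.elim_inl, Sum.elim_inr] at h1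
  have e1 : ∑ a, s (κ i) * u i a * (s (κ j) * u j a) = s (κ i) * s (κ j) * ⟪u i, u j⟫ := by
    rw [PiLp.inner_apply, Finset.mul_sum]
    refine Finset.sum_congr rfl fun a _ => ?_
    simp
    ring
  rw [e1] at h1
  have e2 : ∑ X, (if κ i = X then r X else 0) * (if κ j = X then r X else 0) = if κ i = κ j then r (κ i) * r (κ i) else 0 := by
    rw [Finset.sum_eq_single (κ i)]
    · simp only [if_true, eq_comm (a := κ j)]; split_ifs <;> simp
    · intro b _ hb; rw [if_neg hb.symm, zero_mul]
    · simp
  rw [e2] at h1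
  split_ifs at h1 ⊢ with hκ
  · rw [← hκ, hss, hrr] at h1
    have hkp : (0:ℝ) < k (κ i) := by exact_mod_cast hk _
    field_simp at h1 ⊢
    linarith
  · rw [add_zero] at h1
    exact (mul_eq_zero.1 h1).resolve_left (mul_pos (hs0 _) (hs0 _)).ne'
end clsF

/-- classes from intervals -/
def kap (n a b c : ℕ) (i : Fin n) : Fin 3 := if a ≤ i.1 ∧ i.1 < b then 1 else if b ≤ i.1 ∧ i.1 < c then 2 else 0

lemma kap_one {n a b c : ℕ} (i : Fin n) : kap n a b c i = 1 ↔ (a ≤ i.1 ∧ i.1 < b) := by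
  unfold kap; split_ifs with h1 h2 <;> simp [h1]

lemma kap_two {n a b c : ℕ} (i : Fin n) : kap n a b c i = 2 ↔ (b ≤ i.1 ∧ i.1 < c) := by
  unfold kap; split_ifs with h1 h2
  · constructor
    · intro h; exact absurd h (by decide)
    · intro h; omega
  · simp [h2]
  · constructor
    · intro h; exact absurd h (by decide)
    · intro h; omega

lemma TT_cls {n : ℕ} (ε : Fin n → Bool) (a b c : ℕ) (hab : a ≤ b) (hbc : b ≤ c) (he : ∀ i : Fin n, ε i = true ↔ (i.1 < a ∨ (b ≤ i.1 ∧ i.1 < c)))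
    (x y : Fin n → ℝ) : TT ε (gC x y) (gC x y) = cs (kap n a b c) x 2 * cs (kap n a b c) y 1 - cs (kap n a b c) y 2 * cs (kap n a b c) x 1 := by
  have hw : ∀ i j, wt ε i j = (if kap n a b c i = 2 then 1 else 0) * (if kap n a b c j = 1 then 1 else 0) := by
    intro i j
    have hj : ε j = false ↔ ¬ (j.1 < a ∨ (b ≤ j.1 ∧ j.1 < c)) := by rw [← he, Bool.not_eq_true]
    unfold wt
    rw [ite_zero_mul_ite_zero, one_mul]
    refine if_congr ?_ rfl rfl
    rw [hj, he, kap_one, kap_two, Fin.lt_def]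
    omega
  unfold TT cs
  simp_rw [hw]
  rw [Finset.sum_mul_sum, Finset.sum_mul_sum, ← Finset.sum_sub_distrib]
  refine Finset.sum_congr rfl fun i _ => ?_
  rw [← Finset.sum_sub_distrib]
  refine Finset.sum_congr rfl fun j _ => ?_
  have : ((starRingEnd ℂ) (gC x y i) * gC x y j).im = x i * y j - y i * x j := by
    simp [gC, Complex.mul_im]; ring
  rw [this]
  split_ifs <;> simp

lemma cls_ne {n : ℕ} (κ : Fin n → Fin 3) (x y : Fin n → ℝ) (hx : ∑ i, x i = 0) (hy : ∑ i, y i = 0) (hτ : cs κ x 2 * cs κ y 1 - cs κ y 2 * cs κ x 1 ≠ 0) (X : Fin 3) :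
    0 < (Finset.univ.filter fun i => κ i = X).card := by
  rw [Finset.card_pos]
  by_contra h
  rw [Finset.not_nonempty_iff_eq_empty, Finset.filter_eq_empty_iff] at h
  have h0 : ∀ z : Fin n → ℝ, cs κ z X = 0 := by
    intro z
    unfold cs
    exact Finset.sum_eq_zero fun i hi => if_neg (h hi)
  have tx := cs_total κ x
  have ty := cs_total κ y
  have zx := h0 x
  have zy := h0 y
  apply hτ
  fin_cases X
  · simp only [Fin.zero_eta, Fin.isValue] at zx zy
    have e1 : cs κ x 1 = - cs κ x 2 := by linarith
    have e2 : cs κ y 1 = - cs κ y 2 := by linarith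
    rw [e1, e2]; ring
  · simp only [Fin.mk_one, Fin.isValue] at zx zy
    rw [zx, zy]; ring
  · simp only [Fin.reduceFinMk, Fin.isValue] at zx zy
    rw [zx, zy]; ring

lemma gC_sum {n : ℕ} (x y : Fin n → ℝ) (hx : ∑ i, x i = 0) (hy : ∑ i, y i = 0) : ∑ i, gC x y i = 0 := by
  apply Complex.ext
  · rw [Complex.re_sum]; simpa [gC] using hx
  · rw [Complex.im_sum]; simpa [gC] using hy

lemma gC_norm {n : ℕ} (x y : Fin n → ℝ) (hx : ∑ i, x i * x i = 1) (hy : ∑ i, y i * y i = 1) : ∑ i, ‖gC x y i‖^2 = 2 := by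
  simp_rw [Complex.sq_norm, Complex.normSq_apply]
  simp only [gC]
  rw [Finset.sum_add_distrib, hx, hy]; norm_num

lemma main_struct (d : ℕ) (hd : 3 ≤ d) (hodd : Odd d) (v : Fin (d+3) → EuclideanSpace ℝ (Fin d)) (hv : ∀ i, ‖v i‖ = 1)
    (hvol : ENNReal.ofReal (√(Cbal d) / d.factorial) ≤ volume (convexHull ℝ (Set.range v))) :
    ∃ (σ : Equiv.Perm (Fin (d+3))) (κ : Fin (d+3) → Fin 3) (k : Fin 3 → ℕ), 
      (∀ X, (Finset.univ.filter fun i => κ i = X).card = k X + 1) ∧ k 0 + k 1 + k 2 = d ∧ (∀ X, 0 < k X) ∧ (∀ X, k X = d/3 ∨ k X = (d+2)/3) ∧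
      (∀ i j, i ≠ j → ⟪v (σ i), v (σ j)⟫ = if κ i = κ j then -(1 / (k (κ i) : ℝ)) else 0) ∧ 
      volume (convexHull ℝ (Set.range v)) = ENNReal.ofReal (√(hK (k 0) * hK (k 1) * hK (k 2)) / d.factorial) := by
  obtain ⟨σ, x, y, h, hs0, hup⟩ := setup (by omega) v
  have hd' : (0:ℝ) < d := by exact_mod_cast (by omega : 0 < d)
  have hC := Cbal_pos d
  set u : Fin (d+3) → EuclideanSpace ℝ (Fin d) := v ∘ σ with hudef
  have hu : ∀ i, ‖u i‖ = 1 := fun i => hv _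
  set D := (sw (tX u) 1 (tX u)).det with hD
  set τ := TT (sgn x) (gC x y) (gC x y) with hτ
  have hfac : (0:ℝ) < d.factorial := by exact_mod_cast d.factorial_pos
  have hsd : 0 < √(d:ℝ)^d := pow_pos (Real.sqrt_pos.2 hd') _
  have hsC : 0 < √(Cbal d) := Real.sqrt_pos.2 hC
  have hD0 : 0 ≤ D := tX_det_nonneg u 1 (fun _ => zero_le_one)
  have hsq : (√(d:ℝ)^d)^2 = (d:ℝ)^d := by rw [← pow_mul, mul_comm, pow_mul, Real.sq_sqrt hd'.le]
  have hA : √(d:ℝ)^d * √(Cbal d) ≤ √D * τ := by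
    have h1 := hvol.trans hup
    rw [ENNReal.ofReal_le_ofReal_iff'] at h1
    rcases h1 with h1 | h1
    · rw [div_le_div_iff₀ hfac (by positivity)] at h1
      have : (√(d:ℝ)^d * √(Cbal d)) * d.factorial ≤ (√D * τ) * d.factorial := by linarith
      exact le_of_mul_le_mul_right this hfac
    · exact absurd h1 (not_le.2 (by positivity))
  have hApos : 0 < √D * τ := lt_of_lt_of_le (by positivity) hA
  have hDp : 0 < D := by
    rcases hD0.eq_or_lt with h0 | h0
    · rw [← h0] at hApos; simp at hApos
    · exact h0
  have hτp : 0 < τ := (mul_pos_iff_of_pos_left (Real.sqrt_pos.2 hDp)).1 hApos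
  have hA2 : (d:ℝ)^d * Cbal d ≤ D * τ^2 := by
    have := pow_le_pow_left₀ (by positivity) hA 2
    rwa [mul_pow, mul_pow, hsq, Real.sq_sqrt hC.le, Real.sq_sqrt hD0] at this
  obtain ⟨ms, hms, hrun⟩ := runs_exist (List.ofFn (sgn x)) true (by intro hne; rw [List.head_ofFn]; exact hs0)
  have hlen : ms.length ≤ 4 := by
    by_contra hl
    have h1 := TT_lt d hd hodd (sgn x) ms hms (by omega) hrun (gC x y) (gC_sum x y h.sx h.sy) (gC_norm x y h.xx h.yy)
    rw [← hτ] at h1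
    have hp : (0:ℝ) < ((d:ℝ)+3)^(d+1) := by positivity
    have h2 := pow_lt_pow_left₀ h1 hτp.le (two_ne_zero)
    rw [Real.sq_sqrt (by positivity), lt_div_iff₀ hp] at h2
    have h3 := tX_det_le_pow (by simp) u hu
    have h4 : D * τ^2 ≤ ((d:ℝ)+3)^(d+1) * τ^2 := by gcongr
    linarith
  obtain ⟨a, b, c, hab, hbc, hcn, he⟩ := short_intervals (sgn x) ms hlen hrun
  set κ := kap (d+3) a b c with hκ
  have hTc : τ = cs κ x 2 * cs κ y 1 - cs κ y 2 * cs κ x 1 := TT_cls (sgn x) a b c hab hbc he x y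
  have hne := cls_ne κ x y h.sx h.sy (by rw [← hTc]; exact hτp.ne')
  let k : Fin 3 → ℕ := fun X => (Finset.univ.filter fun i => κ i = X).card - 1
  have hc : ∀ X, (Finset.univ.filter fun i => κ i = X).card = k X + 1 := fun X => (Nat.sub_add_cancel (hne X)).symm
  have hsum : ∑ X, k X = d := by
    have := card_cls κ k hc
    rw [Finset.sum_add_distrib] at this
    simp at this
    exact this.symm
  have hsum3 : k 0 + k 1 + k 2 = d := by rw [← hsum, Fin.sum_univ_three]
  have TM := T_main κ k hc hsum u hu x y h τ hTc hτp.ne' hDp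
  have hb := lim_bound d (by omega) k hsum (D * τ^2) (fun L hL hL1 => (TM L hL hL1).1)
  rw [Fin.prod_univ_three] at hb
  have hdd : (0:ℝ) < (d:ℝ)^d := by positivity
  have hCle : Cbal d ≤ hK (k 0) * hK (k 1) * hK (k 2) := le_of_mul_le_mul_left (hA2.trans hb) hdd
  obtain ⟨hCeq, p0, p1, p2, q0, q1, q2⟩ := hK_conc d _ _ _ hd hsum3 hCle
  have hk : ∀ X, 0 < k X := by intro X; fin_cases X <;> assumption
  have hk' : ∀ X, (0:ℝ) < k X := fun X => by exact_mod_cast hk X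
  have hkb : ∀ X, k X = d/3 ∨ k X = (d+2)/3 := by intro X; fin_cases X <;> assumption
  have hEq : D * τ^2 = (d:ℝ)^d * Cbal d := le_antisymm (by rw [← hCeq]; exact hb) hA2
  obtain ⟨_, TM2⟩ := TM (fun X => (k X : ℝ) / d) (fun X => div_pos (hk' X) hd') 
    (by rw [← Finset.sum_div]; rw [div_eq_one_iff_eq hd'.ne']; exact_mod_cast hsum)
  obtain ⟨hQ1, hx, hy⟩ := TM2 (by
    rw [hEq, ← hCeq, ← Fin.prod_univ_three (fun X => hK (k X))]
    have hpow : (d:ℝ)^d = ∏ X, (d:ℝ) ^ (k X) := by rw [Finset.prod_pow_eq_pow_sum, hsum]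
    rw [hpow, ← Finset.prod_mul_distrib, ← Finset.prod_mul_distrib]
    refine (Finset.prod_congr rfl fun X _ => ?_).le
    have := hk' X
    unfold hK
    rw [div_div, div_pow, mul_pow, pow_succ (k X : ℝ), pow_succ (d:ℝ)]
    field_simp)
  have hcl := cls_zero κ k (by omega) hsum u x y h (by rw [← hTc]; exact hτp.ne') hQ1 hx hy
  refine ⟨σ, κ, k, hc, hsum3, hk, hkb, gram_of κ k (by omega) hk hc hsum u hQ1 hcl, ?_⟩
  rw [hCeq]
  refine le_antisymm (hup.trans ?_) hvol
  apply ENNReal.ofReal_le_ofReal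
  have : √D * τ = √(d:ℝ)^d * √(Cbal d) := by
    have h1 : (√D * τ)^2 = (√(d:ℝ)^d * √(Cbal d))^2 := by
      rw [mul_pow, mul_pow, hsq, Real.sq_sqrt hC.le, Real.sq_sqrt hD0, hEq]
    exact (pow_left_inj₀ hApos.le (by positivity) two_ne_zero).1 h1
  rw [this]
  apply le_of_eq
  field_simp

theorem max_volume_d_plus_3_odd_structure (d : ℕ) (hd : 3 ≤ d) (hodd : Odd d)
    (V : Finset (EuclideanSpace ℝ (Fin d)))
    (hVsph : (V : Set (EuclideanSpace ℝ (Fin d))) ⊆ Metric.sphere 0 1)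
    (hVcard : V.card = d + 3)
    (hmax : ∀ W : Finset (EuclideanSpace ℝ (Fin d)),
      (W : Set (EuclideanSpace ℝ (Fin d))) ⊆ Metric.sphere 0 1 → W.card = d + 3 →
      volume (convexHull ℝ (W : Set (EuclideanSpace ℝ (Fin d)))) ≤
        volume (convexHull ℝ (V : Set (EuclideanSpace ℝ (Fin d))))) :
    ∃ (k₁ k₂ k₃ : ℕ) (V₁ V₂ V₃ : Finset (EuclideanSpace ℝ (Fin d))),
      0 < k₁ ∧ 0 < k₂ ∧ 0 < k₃ ∧ k₁ + k₂ + k₃ = d ∧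
      (k₁ = d / 3 ∨ k₁ = (d + 2) / 3) ∧ (k₂ = d / 3 ∨ k₂ = (d + 2) / 3) ∧
      (k₃ = d / 3 ∨ k₃ = (d + 2) / 3) ∧
      V₁ ∪ V₂ ∪ V₃ = V ∧ Disjoint V₁ V₂ ∧ Disjoint V₁ V₃ ∧ Disjoint V₂ V₃ ∧
      V₁.card = k₁ + 1 ∧ V₂.card = k₂ + 1 ∧ V₃.card = k₃ + 1 ∧
      (∀ u ∈ V₁, ∀ v ∈ V₁, u ≠ v → ⟪u, v⟫ = -(1 / (k₁ : ℝ))) ∧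
      (∀ u ∈ V₂, ∀ v ∈ V₂, u ≠ v → ⟪u, v⟫ = -(1 / (k₂ : ℝ))) ∧
      (∀ u ∈ V₃, ∀ v ∈ V₃, u ≠ v → ⟪u, v⟫ = -(1 / (k₃ : ℝ))) ∧
      (∀ u ∈ V₁, ∀ v ∈ V₂, ⟪u, v⟫ = 0) ∧
      (∀ u ∈ V₁, ∀ v ∈ V₃, ⟪u, v⟫ = 0) ∧
      (∀ u ∈ V₂, ∀ v ∈ V₃, ⟪u, v⟫ = 0) ∧
      (volume (convexHull ℝ (V : Set (EuclideanSpace ℝ (Fin d))))).toReal =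
        (1 / (Nat.factorial d : ℝ)) *
          ((((k₁ : ℝ) + 1) ^ (((k₁ : ℝ) + 1) / 2) * (k₁ : ℝ) ^ (-(k₁ : ℝ) / 2)) *
           (((k₂ : ℝ) + 1) ^ (((k₂ : ℝ) + 1) / 2) * (k₂ : ℝ) ^ (-(k₂ : ℝ) / 2)) *
           (((k₃ : ℝ) + 1) ^ (((k₃ : ℝ) + 1) / 2) * (k₃ : ℝ) ^ (-(k₃ : ℝ) / 2))) := by
  obtain ⟨W, hW1, hW2, hW3⟩ := partL d hd
  let e : Fin (d+3) ≃ V := (finCongr hVcard.symm).trans V.equivFin.symm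
  let v : Fin (d+3) → EuclideanSpace ℝ (Fin d) := fun i => (e i).1
  have hvinj : Function.Injective v := Subtype.val_injective.comp e.injective
  have hvmem : ∀ i, v i ∈ V := fun i => (e i).2
  have hvsurj : ∀ z ∈ V, ∃ i, v i = z := fun z hz => ⟨e.symm ⟨z, hz⟩, by simp [v]⟩
  have hrange : Set.range v = (V : Set (EuclideanSpace ℝ (Fin d))) := by
    ext z; constructor
    · rintro ⟨i, rfl⟩; exact hvmem i
    · intro hz; exact hvsurj z hz
  have hv : ∀ i, ‖v i‖ = 1 := fun i => by simpa using hVsph (hvmem i)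
  obtain ⟨σ, κ, k, hc, hsum, hk, hkb, hG, hvol⟩ := main_struct d hd hodd v hv (by rw [hrange]; exact hW3.trans (hmax W hW1 hW2))
  rw [hrange] at hvol
  have huinj : Function.Injective (fun i => v (σ i)) := hvinj.comp σ.injective
  let P : Fin 3 → Finset (EuclideanSpace ℝ (Fin d)) := fun X => (Finset.univ.filter fun i => κ i = X).image fun i => v (σ i)
  have hP : ∀ X z, z ∈ P X ↔ ∃ i, κ i = X ∧ v (σ i) = z := by
    intro X z; simp [P]
  have hdis : ∀ X Y, X ≠ Y → Disjoint (P X) (P Y) := by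
    intro X Y hXY
    rw [Finset.disjoint_left]
    intro z h1 h2
    obtain ⟨i, hi, rfl⟩ := (hP _ _).1 h1
    obtain ⟨j, hj, hij⟩ := (hP _ _).1 h2
    have := huinj hij
    exact hXY (by rw [← hi, ← hj, this])
  have hcard : ∀ X, (P X).card = k X + 1 := by
    intro X
    rw [← hc X]
    exact Finset.card_image_of_injective _ huinj
  have hin : ∀ X, ∀ z ∈ P X, ∀ w ∈ P X, z ≠ w → ⟪z, w⟫ = -(1 / (k X : ℝ)) := by
    intro X z hz w hw hzw
    obtain ⟨i, hi, rfl⟩ := (hP _ _).1 hz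
    obtain ⟨j, hj, rfl⟩ := (hP _ _).1 hw
    rw [hG i j (fun h => hzw (by rw [h])), if_pos (by rw [hi, hj]), hi]
  have hout : ∀ X Y, X ≠ Y → ∀ z ∈ P X, ∀ w ∈ P Y, ⟪z, w⟫ = 0 := by
    intro X Y hXY z hz w hw
    obtain ⟨i, hi, rfl⟩ := (hP _ _).1 hz
    obtain ⟨j, hj, rfl⟩ := (hP _ _).1 hw
    have hne : κ i ≠ κ j := by rw [hi, hj]; exact hXY
    rw [hG i j (fun h => hne (by rw [h])), if_neg hne]
  refine ⟨k 0, k 1, k 2, P 0, P 1, P 2, hk 0, hk 1, hk 2, hsum, hkb 0, hkb 1, hkb 2, ?_, hdis 0 1 (by decide), hdis 0 2 (by decide), 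
    hdis 1 2 (by decide), hcard 0, hcard 1, hcard 2, hin 0, hin 1, hin 2, hout 0 1 (by decide), hout 0 2 (by decide), hout 1 2 (by decide), ?_⟩
  · ext z
    rw [Finset.mem_union, Finset.mem_union, hP, hP, hP]
    constructor
    · rintro ((⟨i, _, rfl⟩ | ⟨i, _, rfl⟩) | ⟨i, _, rfl⟩) <;> exact hvmem _
    · intro hz
      obtain ⟨i, rfl⟩ := hvsurj z hz
      have key : ∃ j, v (σ j) = v i := ⟨σ.symm i, by simp⟩
      obtain ⟨j, hj⟩ := key
      have h3 : κ j = 0 ∨ κ j = 1 ∨ κ j = 2 := by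
        generalize κ j = X
        fin_cases X <;> simp
      rcases h3 with h | h | h
      · exact Or.inl (Or.inl ⟨j, h, hj⟩)
      · exact Or.inl (Or.inr ⟨j, h, hj⟩)
      · exact Or.inr ⟨j, h, hj⟩
  · rw [hvol, ENNReal.toReal_ofReal (by positivity), Real.sqrt_mul (mul_pos (hK_pos _) (hK_pos _)).le, Real.sqrt_mul (hK_pos _).le,
      sqrt_hK _ (hk 0), sqrt_hK _ (hk 1), sqrt_hK _ (hk 2)]
    ring
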